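/- Addition theorem for tameness of multiarrangements: Let (A,m) be a multiarrangement on an essential arrangement A in K^ℓ and H ∈ A. Assume that (A, m−δ_H) is tame and that both (A,m) and (A, m−δ_H) are locally free along H. Then both (A,m) and the Euler restriction (A^H, m^*) are tame. -/

import Mathlib

noncomputable section
open Classical MvPolynomial

/-- `pdLE R n M` : the `R`-module `M` has projective dimension at most `n`. -/
def pdLE (R : Type) [CommRing R] : ℕ → (M : Type) → [AddCommGroup M] → [Module R M] → Prop
  | 0, M, _, _ => Module.Projective R M
  | n + 1, M, _, _ => ∃ (ι : Type) (f : (ι →₀ R) →ₗ[R] M),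
      Function.Surjective f ∧ pdLE R n (LinearMap.ker f)

/-- Projective dimension as an element of `ℕ∞`. -/
def pdim (R : Type) [CommRing R] (M : Type) [AddCommGroup M] [Module R M] : ℕ∞ :=
  sInf {n : ℕ∞ | ∃ k : ℕ, pdLE R k M ∧ n = (k : ℕ∞)}

/-- The coordinate ring `S = K[x_1, …, x_ℓ]`. -/
abbrev PS (K : Type) [Field K] (ℓ : ℕ) : Type := MvPolynomial (Fin ℓ) K

/-- The free `S`-module of polynomial differential forms of all degrees, realized as the
exterior algebra over `S` on the free module `S^ℓ` (with `dx_i` the standard basis). -/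
abbrev ExtF (K : Type) [Field K] (ℓ : ℕ) : Type :=
  ExteriorAlgebra (PS K ℓ) (Fin ℓ → PS K ℓ)

variable {K : Type} [Field K] {ℓ : ℕ}

/-- The module `Ω^p_V` of polynomial differential `p`-forms. -/
def formsP (K : Type) [Field K] (ℓ : ℕ) (p : ℕ) : Submodule (PS K ℓ) (ExtF K ℓ) :=
  (LinearMap.range (ExteriorAlgebra.ι (PS K ℓ) :
      (Fin ℓ → PS K ℓ) →ₗ[PS K ℓ] ExtF K ℓ)) ^ p

/-- The defining linear form `α = ∑ c_i x_i` of the hyperplane with coefficient vector `c`. -/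
def linP (c : Fin ℓ → K) : PS K ℓ := ∑ i, MvPolynomial.C (c i) * MvPolynomial.X i

/-- The constant one-form `dα = ∑ c_i dx_i`. -/
def dP (c : Fin ℓ → K) : ExtF K ℓ :=
  ExteriorAlgebra.ι (PS K ℓ) (fun i => MvPolynomial.C (c i))

/-- A central hyperplane arrangement in `K^ℓ`: a finite set of (pairwise non-proportional,
nonzero) coefficient vectors of defining linear forms, each representing the hyperplane
`{x : ∑ c_i x_i = 0}`. -/
structure Arrangement (K : Type) [Field K] (ℓ : ℕ) : Type where
  hyps : Finset (Fin ℓ → K)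
  ne_zero : ∀ c ∈ hyps, c ≠ 0
  nonprop : ∀ c ∈ hyps, ∀ c' ∈ hyps, c ≠ c' → ∀ t : K, c ≠ t • c'

/-- The polynomial model of the module `Ω^p(A,m)` of logarithmic `p`-forms of the
multiarrangement `(A,m)`; it is `Q(A,m)·Ω^p(A,m)`, i.e. the image of `Ω^p(A,m)` under the
degree-shifting isomorphism given by multiplication with `Q(A,m)`, so that
`η = Q(A,m)·ω` ranges over polynomial `p`-forms with `dα_H ∧ η ∈ α_H^{m(H)} Ω^{p+1}_V`
for all `H ∈ A`. -/
def Omega (A : Arrangement K ℓ) (m : (Fin ℓ → K) → ℕ) (p : ℕ) :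
    Submodule (PS K ℓ) (ExtF K ℓ) :=
  formsP K ℓ p ⊓ ⨅ c ∈ A.hyps,
    Submodule.comap (LinearMap.mulLeft (PS K ℓ) (dP c))
      (Submodule.map (LinearMap.lsmul (PS K ℓ) (ExtF K ℓ) (linP c ^ m c))
        (formsP K ℓ (p + 1)))

/-- Tameness of a multiarrangement: `pd_S Ω^p(A,m) ≤ p` for all `0 ≤ p ≤ ℓ`. -/
def TameM (A : Arrangement K ℓ) (m : (Fin ℓ → K) → ℕ) : Prop :=
  ∀ p : ℕ, p ≤ ℓ → pdLE (PS K ℓ) p (Omega A m p)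

/-- Tameness of a simple arrangement (constant multiplicity `1`). -/
def Tame (A : Arrangement K ℓ) : Prop := TameM A (fun _ => 1)

/-- Freeness of a multiarrangement: `Ω^1(A,m)` is a free `S`-module. -/
def FreeM (A : Arrangement K ℓ) (m : (Fin ℓ → K) → ℕ) : Prop :=
  Module.Free (PS K ℓ) (Omega A m 1)

/-- An arrangement is essential when the intersection of its hyperplanes is `{0}`,
equivalently the defining forms span the dual space. -/
def Essential (A : Arrangement K ℓ) : Prop :=
  Submodule.span K (A.hyps : Set (Fin ℓ → K)) = ⊤

/-- The localization `A_x = {H ∈ A : x ∈ H}` of an arrangement at a point `x`. -/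
def locArr (A : Arrangement K ℓ) (x : Fin ℓ → K) : Arrangement K ℓ where
  hyps := A.hyps.filter (fun c => ∑ i, c i * x i = 0)
  ne_zero := fun c hc => A.ne_zero c (Finset.mem_filter.mp hc).1
  nonprop := fun c hc c' hc' =>
    A.nonprop c (Finset.mem_filter.mp hc).1 c' (Finset.mem_filter.mp hc').1

/-- `(A,m)` is locally free along the hyperplane `{x : ∑ (c0)_i x_i = 0}` :
`(A_x, m_x)` is free for every nonzero point `x` of this hyperplane. -/
def LocallyFreeAlong (A : Arrangement K ℓ) (m : (Fin ℓ → K) → ℕ) (c0 : Fin ℓ → K) : Prop :=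
  ∀ x : Fin ℓ → K, x ≠ 0 → (∑ i, c0 i * x i = 0) → FreeM (locArr A x) m

/-- The deletion `A ∖ {H}`. -/
def delArr (A : Arrangement K ℓ) (c0 : Fin ℓ → K) : Arrangement K ℓ where
  hyps := A.hyps.erase c0
  ne_zero := fun c hc => A.ne_zero c (Finset.mem_of_mem_erase hc)
  nonprop := fun c hc c' hc' =>
    A.nonprop c (Finset.mem_of_mem_erase hc) c' (Finset.mem_of_mem_erase hc')

/-- The coefficient vector of the restriction of the linear form `c` to the hyperplane `H`
along the linear identification `e : K^{ℓ-1} ≃ H`. -/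
def restrictForm (e : (Fin (ℓ - 1) → K) →ₗ[K] (Fin ℓ → K)) (c : Fin ℓ → K) :
    Fin (ℓ - 1) → K := fun i => ∑ j, c j * e (Pi.single i 1) j

/-- The linear form on `K^ℓ` with coefficient vector `c`. -/
def dotLin (c : Fin ℓ → K) : (Fin ℓ → K) →ₗ[K] K := ∑ i, c i • LinearMap.proj i

/-- `e` identifies `K^{ℓ-1}` with the hyperplane `ker(α_{c0})`. -/
def IsHypEmbedding (c0 : Fin ℓ → K) (e : (Fin (ℓ - 1) → K) →ₗ[K] (Fin ℓ → K)) : Prop :=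
  Function.Injective e ∧ LinearMap.range e = LinearMap.ker (dotLin c0)

/-- `B` (an arrangement in `K^{ℓ-1}`) represents the restriction `A^H` of `A` to the
hyperplane `H` determined by `c0 ∈ A`, via the identification `e : K^{ℓ-1} ≃ H`:
its hyperplanes are exactly the restrictions to `H` of the hyperplanes of `A ∖ {H}`. -/
def IsRestrictionOf (B : Arrangement K (ℓ - 1)) (A : Arrangement K ℓ) (c0 : Fin ℓ → K)
    (e : (Fin (ℓ - 1) → K) →ₗ[K] (Fin ℓ → K)) : Prop :=
  (∀ c ∈ A.hyps, c ≠ c0 → ∃ c' ∈ B.hyps, ∃ t : K, t ≠ 0 ∧ restrictForm e c = t • c') ∧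
  (∀ c' ∈ B.hyps, ∃ c ∈ A.hyps, c ≠ c0 ∧ ∃ t : K, t ≠ 0 ∧ restrictForm e c = t • c')
/-- The Ziegler multiplicity `m^H` on the restriction: `m^H(X) = #{L ∈ A∖{H} : L ∩ H = X}`. -/
def zieglerMult (A : Arrangement K ℓ) (c0 : Fin ℓ → K)
    (e : (Fin (ℓ - 1) → K) →ₗ[K] (Fin ℓ → K)) (c' : Fin (ℓ - 1) → K) : ℕ :=
  (A.hyps.filter (fun c => c ≠ c0 ∧ ∃ t : K, t ≠ 0 ∧ restrictForm e c = t • c')).card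

/-- The wedge `dx_{i_1} ∧ ⋯ ∧ dx_{i_p}` for a list of indices. -/
def wedgeList (l : List (Fin ℓ)) : ExtF K ℓ :=
  (l.map (fun i => ExteriorAlgebra.ι (PS K ℓ) (Pi.single i (1 : PS K ℓ)))).prod

/-- A polynomial `p`-form is homogeneous of (coefficient) degree `d` if it is a sum of
terms `f · dx_{i_1} ∧ ⋯ ∧ dx_{i_p}` with `f` homogeneous of degree `d`. -/
def IsHomogForm (p d : ℕ) (η : ExtF K ℓ) : Prop :=
  η ∈ AddSubgroup.closure {ξ : ExtF K ℓ | ∃ (f : PS K ℓ) (l : List (Fin ℓ)),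
    f.IsHomogeneous d ∧ l.length = p ∧ ξ = f • wedgeList l}

/-- `|m| = ∑_{H ∈ A} m(H)`. -/
def msum (A : Arrangement K ℓ) (m : (Fin ℓ → K) → ℕ) : ℕ := ∑ c ∈ A.hyps, m c

/-- The multiarrangement `(A,m)` is free with exponents `(d_1, …, d_ℓ)`: the polynomial
model of `Ω^1(A,m)` has a homogeneous basis whose `i`-th member has coefficient degree
`|m| - d_i`. -/
def FreeWithExp (A : Arrangement K ℓ) (m : (Fin ℓ → K) → ℕ) (d : Fin ℓ → ℕ) : Prop :=
  ∃ b : Fin ℓ → ExtF K ℓ,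
    (∀ i, b i ∈ Omega A m 1) ∧
    (∀ i, IsHomogForm 1 (msum A m - d i) (b i)) ∧
    LinearIndependent (PS K ℓ) b ∧
    Omega A m 1 ≤ Submodule.span (PS K ℓ) (Set.range b)

/-- The exponent vector `(d_1, d_2, 0, …, 0)`. -/
def expVec (d1 d2 : ℕ) : Fin ℓ → ℕ := fun i =>
  if (i : ℕ) = 0 then d1 else if (i : ℕ) = 1 then d2 else 0

/-- The localization `A_X` of `A` at the lattice element `X = H ∩ L` corresponding,
via the identification `e` of `H` with `K^{ℓ-1}`, to the hyperplane of `H`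
with coefficient vector `c'`. -/
def locOnRestr (A : Arrangement K ℓ) (e : (Fin (ℓ - 1) → K) →ₗ[K] (Fin ℓ → K))
    (c' : Fin (ℓ - 1) → K) : Arrangement K ℓ where
  hyps := A.hyps.filter (fun c => ∃ t : K, restrictForm e c = t • c')
  ne_zero := fun c hc => A.ne_zero c (Finset.mem_filter.mp hc).1
  nonprop := fun c hc c'' hc'' =>
    A.nonprop c (Finset.mem_filter.mp hc).1 c'' (Finset.mem_filter.mp hc'').1

/-- The multiplicity `m - δ_H`. -/
def mdel (m : (Fin ℓ → K) → ℕ) (c0 : Fin ℓ → K) : (Fin ℓ → K) → ℕ :=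
  fun c => if c = c0 then m c - 1 else m c

/-- `ms` is the Euler multiplicity `m^*` on the restriction `B = A^H` (presented via the
identification `e`): for each `X ∈ A^H` the rank-two localization `(A_X, m_X)` is free
with exponents `(d_1^X, d_2^X, 0, …, 0)` ordered so that `(A_X, m_X - δ_H)` is free with
exponents `(d_1^X - 1, d_2^X, 0, …, 0)`, and `m^*(X) = d_2^X`. -/
def IsEulerMult (A : Arrangement K ℓ) (m : (Fin ℓ → K) → ℕ) (c0 : Fin ℓ → K)
    (e : (Fin (ℓ - 1) → K) →ₗ[K] (Fin ℓ → K)) (B : Arrangement K (ℓ - 1))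
    (ms : (Fin (ℓ - 1) → K) → ℕ) : Prop :=
  ∀ c' ∈ B.hyps, ∃ d1 d2 : ℕ,
    FreeWithExp (locOnRestr A e c') m (expVec d1 d2) ∧
    FreeWithExp (locOnRestr A e c') (mdel m c0) (expVec (d1 - 1) d2) ∧
    ms c' = d2

/-- An arrangement is generic if any `k ≤ ℓ-1` of its hyperplanes intersect in
codimension `k`, i.e. any `≤ ℓ-1` of its defining forms are linearly independent. -/
def GenericArr (A : Arrangement K ℓ) : Prop :=
  ∀ s : Finset (Fin ℓ → K), s ⊆ A.hyps → s.card ≤ ℓ - 1 →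
    LinearIndependent K (fun x : {c // c ∈ s} => (x : Fin ℓ → K))

/-- An arrangement is irreducible if it is not a product of two lower-dimensional
arrangements, i.e. its defining forms cannot be split into two complementary proper
subspaces of the dual space. -/
def IrreducibleArr (A : Arrangement K ℓ) : Prop :=
  ¬ ∃ U1 U2 : Submodule K (Fin ℓ → K), U1 ≠ ⊥ ∧ U2 ≠ ⊥ ∧ U1 ⊓ U2 = ⊥ ∧ U1 ⊔ U2 = ⊤ ∧
      ∀ c ∈ A.hyps, c ∈ U1 ∨ c ∈ U2

/-- The defining polynomial `Q(A,m) = ∏_{H ∈ A} α_H^{m(H)}`. -/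
def Qpoly (A : Arrangement K ℓ) (m : (Fin ℓ → K) → ℕ) : PS K ℓ :=
  ∏ c ∈ A.hyps, linP c ^ m c

section Homological

open CategoryTheory CategoryTheory.Abelian

variable {R : Type} [CommRing R]

/-- `M` has projective dimension less than `n`. -/
def PdLT (R : Type) [CommRing R] (M : Type) [AddCommGroup M] [Module R M] (n : ℕ) : Prop :=
  HasProjectiveDimensionLT (ModuleCat.of R M) n

/-- `Ext^i(M, R)` vanishes. -/
def ExtVanish (R : Type) [CommRing R] (M : Type) [AddCommGroup M] [Module R M] (i : ℕ) : Prop :=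
  Subsingleton (Ext (ModuleCat.of R M) (ModuleCat.of R R) i)

section
variable {M₁ M₂ M₃ : Type} [AddCommGroup M₁] [Module R M₁] [AddCommGroup M₂] [Module R M₂]
  [AddCommGroup M₃] [Module R M₃]

theorem exists_shortExact {f : M₁ →ₗ[R] M₂} {g : M₂ →ₗ[R] M₃} (hf : Function.Injective f)
    (hg : Function.Surjective g) (hfg : Function.Exact f g) :
    ∃ S : ShortComplex (ModuleCat R), S.ShortExact ∧ S.X₁ = ModuleCat.of R M₁ ∧
      S.X₂ = ModuleCat.of R M₂ ∧ S.X₃ = ModuleCat.of R M₃ := by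
  refine ⟨ShortComplex.mk (ModuleCat.ofHom f) (ModuleCat.ofHom g) ?_, ?_, rfl, rfl, rfl⟩
  · ext x
    simpa using hfg.apply_apply_eq_zero x
  · have h1 : Mono (ModuleCat.ofHom f) := (ModuleCat.mono_iff_injective _).2 hf
    have h2 : Epi (ModuleCat.ofHom g) := (ModuleCat.epi_iff_surjective _).2 hg
    refine ⟨?_⟩
    rw [ShortComplex.ShortExact.moduleCat_exact_iff_function_exact]
    exact hfg

theorem PdLT.right {f : M₁ →ₗ[R] M₂} {g : M₂ →ₗ[R] M₃} (hf : Function.Injective f)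
    (hg : Function.Surjective g) (hfg : Function.Exact f g) {n : ℕ} (h₁ : PdLT R M₁ n)
    (h₂ : PdLT R M₂ (n + 1)) : PdLT R M₃ (n + 1) := by
  obtain ⟨S, hS, e1, e2, e3⟩ := exists_shortExact hf hg hfg
  unfold PdLT at *
  rw [← e1] at h₁; rw [← e2] at h₂; rw [← e3]
  exact hS.hasProjectiveDimensionLT_X₃ n h₁ h₂

theorem PdLT.left {f : M₁ →ₗ[R] M₂} {g : M₂ →ₗ[R] M₃} (hf : Function.Injective f)
    (hg : Function.Surjective g) (hfg : Function.Exact f g) {n : ℕ} (h₂ : PdLT R M₂ n)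
    (h₃ : PdLT R M₃ (n + 1)) : PdLT R M₁ n := by
  obtain ⟨S, hS, e1, e2, e3⟩ := exists_shortExact hf hg hfg
  unfold PdLT at *
  rw [← e3] at h₃; rw [← e2] at h₂; rw [← e1]
  exact hS.hasProjectiveDimensionLT_X₁ n h₂ h₃

theorem ExtVanish.middle {f : M₁ →ₗ[R] M₂} {g : M₂ →ₗ[R] M₃} (hf : Function.Injective f)
    (hg : Function.Surjective g) (hfg : Function.Exact f g) {i : ℕ} (h₁ : ExtVanish R M₁ i)
    (h₃ : ExtVanish R M₃ i) : ExtVanish R M₂ i := by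
  obtain ⟨S, hS, e1, e2, e3⟩ := exists_shortExact hf hg hfg
  unfold ExtVanish at *
  rw [← e1] at h₁; rw [← e3] at h₃; rw [← e2]
  refine subsingleton_of_forall_eq 0 fun x => ?_
  obtain ⟨y, rfl⟩ := Ext.contravariant_sequence_exact₂ hS _ x (Subsingleton.elim _ _)
  rw [Subsingleton.elim y 0, Ext.comp_zero]

theorem ExtVanish.left {f : M₁ →ₗ[R] M₂} {g : M₂ →ₗ[R] M₃} (hf : Function.Injective f)
    (hg : Function.Surjective g) (hfg : Function.Exact f g) {i : ℕ} (h₂ : ExtVanish R M₂ i)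
    (h₃ : ExtVanish R M₃ (i + 1)) : ExtVanish R M₁ i := by
  obtain ⟨S, hS, e1, e2, e3⟩ := exists_shortExact hf hg hfg
  unfold ExtVanish at *
  rw [← e2] at h₂; rw [← e3] at h₃; rw [← e1]
  refine subsingleton_of_forall_eq 0 fun x => ?_
  obtain ⟨y, rfl⟩ := Ext.contravariant_sequence_exact₁ hS _ x (add_comm 1 i)
    (Subsingleton.elim _ _)
  rw [Subsingleton.elim y 0, Ext.comp_zero]

theorem PdLT.of_equiv (e : M₁ ≃ₗ[R] M₂) {n : ℕ} (h : PdLT R M₁ n) : PdLT R M₂ n := by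
  unfold PdLT at *
  exact hasProjectiveDimensionLT_of_iso e.toModuleIso n

theorem PdLT.mono {n k : ℕ} (h : PdLT R M₁ n) (hnk : n ≤ k) : PdLT R M₁ k := by
  unfold PdLT at *
  exact hasProjectiveDimensionLT_of_ge _ n k hnk

theorem PdLT.extVanish {n i : ℕ} (h : PdLT R M₁ n) (hi : n ≤ i) : ExtVanish R M₁ i := by
  unfold PdLT at h
  exact HasProjectiveDimensionLT.subsingleton _ n i hi _

theorem pdLT_one_iff : PdLT R M₁ 1 ↔ Module.Projective R M₁ := by
  unfold PdLT
  rw [← projective_iff_hasProjectiveDimensionLT_one, IsProjective.iff_projective]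

theorem PdLT.of_retract (i : M₁ →ₗ[R] M₂) (r : M₂ →ₗ[R] M₁) (hri : r ∘ₗ i = LinearMap.id)
    {n : ℕ} (h : PdLT R M₂ n) : PdLT R M₁ n := by
  unfold PdLT at *
  refine Retract.hasProjectiveDimensionLT ⟨ModuleCat.ofHom i, ModuleCat.ofHom r, ?_⟩ n
  rw [← ModuleCat.ofHom_comp, hri]; rfl

end

theorem pdLT_free {ι : Type} : PdLT R (ι →₀ R) 1 := pdLT_one_iff.2 inferInstance

theorem PdLT.of_pdLE {n : ℕ} {M : Type} [AddCommGroup M] [Module R M] (h : pdLE R n M) :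
    PdLT R M (n + 1) := by
  induction n generalizing M with
  | zero => exact pdLT_one_iff.2 h
  | succ n ih =>
    obtain ⟨ι, f, hf, h⟩ := h
    exact PdLT.right (f := (LinearMap.ker f).subtype) Subtype.val_injective hf
      (LinearMap.exact_subtype_ker_map f) (ih h) (pdLT_free.mono (by omega))

theorem PdLT.pdLE {n : ℕ} {M : Type} [AddCommGroup M] [Module R M] (h : PdLT R M (n + 1)) :
    pdLE R n M := by
  induction n generalizing M with
  | zero => exact pdLT_one_iff.1 h
  | succ n ih =>
    refine ⟨M, Finsupp.linearCombination R (id : M → M),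
      Finsupp.linearCombination_id_surjective R M, ih ?_⟩
    exact PdLT.left (f := (LinearMap.ker _).subtype) Subtype.val_injective
      (Finsupp.linearCombination_id_surjective R M)
      (LinearMap.exact_subtype_ker_map _) (pdLT_free.mono (by omega)) h

theorem pdLE_iff {n : ℕ} {M : Type} [AddCommGroup M] [Module R M] :
    pdLE R n M ↔ PdLT R M (n + 1) := ⟨PdLT.of_pdLE, PdLT.pdLE⟩

end Homological

section Vanishing

open CategoryTheory CategoryTheory.Abelian

variable {R : Type} [CommRing R]

theorem ext_pi_subsingleton {M : Type} [AddCommGroup M] [Module R M] {n : ℕ}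
    (h : ExtVanish R M n) (k : ℕ) :
    Subsingleton (Ext (ModuleCat.of R M) (ModuleCat.of R (Fin k → R)) n) := by
  refine subsingleton_of_forall_eq 0 fun x => ?_
  have hadd : ∀ (s : Finset (Fin k))
      (F : Fin k → (ModuleCat.of R (Fin k → R) ⟶ ModuleCat.of R (Fin k → R))),
      (∀ i, x.comp (Ext.mk₀ (F i)) (add_zero n) = 0) →
        x.comp (Ext.mk₀ (∑ i ∈ s, F i)) (add_zero n) = 0 := by
    intro s F hF
    induction s using Finset.induction_on with
    | empty => simp
    | insert a s ha ih => rw [Finset.sum_insert ha, Ext.mk₀_add, Ext.comp_add, hF, ih, add_zero]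
  have hid : 𝟙 (ModuleCat.of R (Fin k → R)) = ∑ i : Fin k,
      (ModuleCat.ofHom (LinearMap.proj i) ≫ ModuleCat.ofHom (LinearMap.single R (fun _ => R) i) :
        ModuleCat.of R (Fin k → R) ⟶ ModuleCat.of R (Fin k → R)) := by
    ext v j
    simp [ModuleCat.hom_sum]
  rw [← Ext.comp_mk₀_id x, hid]
  refine hadd _ _ fun i => ?_
  rw [← Ext.mk₀_comp_mk₀, ← Ext.comp_assoc_of_third_deg_zero]
  have : x.comp (Ext.mk₀ (ModuleCat.ofHom (LinearMap.proj i : (Fin k → R) →ₗ[R] R)))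
      (add_zero n) = 0 := h.elim _ _
  rw [this, Ext.zero_comp]

theorem PdLT.descend [IsNoetherianRing R] {M : Type} [AddCommGroup M] [Module R M]
    [Module.Finite R M] {n : ℕ} (h : PdLT R M (n + 1)) (hv : ExtVanish R M n) :
    PdLT R M n := by
  refine ModuleCat.hasProjectiveDimensionLT_of_forall_finite (ModuleCat.of R M) n fun L hL => ?_
  obtain ⟨k, f, hf⟩ := Module.Finite.exists_fin' R L
  obtain ⟨S, hS, e1, e2, e3⟩ := exists_shortExact (f := (LinearMap.ker f).subtype) (g := f)
    Subtype.val_injective hf (LinearMap.exact_subtype_ker_map _)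
  refine subsingleton_of_forall_eq 0 fun x => ?_
  have hv' := ext_pi_subsingleton hv k
  rw [← e2] at hv'
  change Ext (ModuleCat.of R M) (ModuleCat.of R L) n at x
  change x = 0
  revert x
  rw [← e3]
  intro x
  unfold PdLT at h
  obtain ⟨y, rfl⟩ := Ext.covariant_sequence_exact₃ _ hS x rfl
    (Ext.eq_zero_of_hasProjectiveDimensionLT _ (n + 1) le_rfl)
  rw [Subsingleton.elim y 0, Ext.zero_comp]

/-- Descent of projective dimension by vanishing of `Ext^i(M, R)` for `q ≤ i < n`. -/
theorem PdLT.descend_range [IsNoetherianRing R] {M : Type} [AddCommGroup M] [Module R M]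
    [Module.Finite R M] {n q : ℕ} (h : PdLT R M n)
    (hv : ∀ i, q ≤ i → i < n → ExtVanish R M i) : PdLT R M q := by
  induction n with
  | zero => exact h.mono (Nat.zero_le _)
  | succ n ih =>
    rcases Nat.lt_or_ge n q with hq | hq
    · exact h.mono hq
    · exact ih (h.descend (hv n hq (Nat.lt_succ_self n))) fun i hi hin => hv i hi (by omega)

section Cofinite

theorem isRegular_X (K : Type) [Field K] (n : ℕ) :
    RingTheory.Sequence.IsRegular (PS K n)
      (List.ofFn fun i : Fin n => (X i : PS K n)) := by
  have key : ∀ j, Ideal.ofList ((List.ofFn fun i : Fin n => (X i : PS K n)).take j) •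
      (⊤ : Submodule (PS K n) (PS K n)) = Ideal.span (X '' {i : Fin n | (i : ℕ) < j}) := by
    intro j
    rw [smul_eq_mul, Ideal.mul_top]
    unfold Ideal.ofList
    congr 1
    ext p
    simp only [Set.mem_ofPred_eq, Set.mem_image, List.mem_take_iff_getElem]
    constructor
    · rintro ⟨i, hi, rfl⟩
      simp only [List.length_ofFn, lt_min_iff] at hi
      exact ⟨⟨i, hi.2⟩, hi.1, by simp⟩
    · rintro ⟨i, hi, rfl⟩
      exact ⟨i, by simp [hi], by simp⟩
  refine ⟨⟨fun i h => ?_⟩, ?_⟩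
  · rw [key, isSMulRegular_quotient_iff_mem_of_smul_mem]
    have hin : i < n := by simpa using h
    intro p hp
    simp only [List.getElem_ofFn, smul_eq_mul] at hp
    rw [mem_ideal_span_X_image] at hp ⊢
    intro d hd
    have hd' : d + Finsupp.single ⟨i, hin⟩ 1 ∈ ((X ⟨i, hin⟩ : PS K n) * p).support := by
      rw [mem_support_iff, add_comm, coeff_X_mul]
      exact mem_support_iff.1 hd
    obtain ⟨t, ht, h0⟩ := hp _ hd'
    refine ⟨t, ht, ?_⟩
    have hne : (⟨i, hin⟩ : Fin n) ≠ t := by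
      rintro rfl
      exact lt_irrefl i (show i < i from ht)
    simpa [Finsupp.single_apply, hne] using h0
  · intro h
    have h2 := key n
    rw [List.take_of_length_le (by simp), ← h] at h2
    have h1 : (1 : PS K n) ∈ Ideal.span (X '' {i : Fin n | (i : ℕ) < n}) := by
      rw [← h2]; trivial
    rw [mem_ideal_span_X_image] at h1
    obtain ⟨t, -, ht⟩ := h1 0 (by simp)
    exact ht rfl

theorem extVanish_of_irrelevant_pow {M : Type} [AddCommGroup M] [Module (PS K ℓ) M]
    [Module.Finite (PS K ℓ) M] (k : ℕ)
    (hk : ∀ i, ∀ x : M, (X i : PS K ℓ) ^ k • x = 0) {i : ℕ} (hi : i < ℓ) :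
    ExtVanish (PS K ℓ) M i := by
  have hreg := isRegular_X K ℓ
  refine ModuleCat.subsingleton_ext_of_exists_isRegular
    (Ideal.span (Set.range (X : Fin ℓ → PS K ℓ))) (ModuleCat.of (PS K ℓ) M) ?_
    (ModuleCat.of (PS K ℓ) (PS K ℓ)) ?_ _ ?_ hreg i (by simpa using hi)
  · rw [Module.support_eq_zeroLocus, PrimeSpectrum.zeroLocus_subset_zeroLocus_iff, Ideal.span_le]
    rintro _ ⟨j, rfl⟩
    exact ⟨k, Module.mem_annihilator.2 (hk j)⟩
  · have h1 := hreg.top_ne_smul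
    rw [lt_top_iff_ne_top]
    intro h
    refine h1 (h.symm.trans ?_)
    congr 1
    unfold Ideal.ofList
    congr 1
    ext; simp
  · intro r hr
    obtain ⟨j, rfl⟩ := (List.mem_ofFn' _ _).1 hr
    exact Ideal.subset_span ⟨j, rfl⟩

variable {I N M M' : Type} [AddCommGroup I] [Module (PS K ℓ) I] [AddCommGroup N]
  [Module (PS K ℓ) N] [AddCommGroup M] [Module (PS K ℓ) M] [AddCommGroup M'] [Module (PS K ℓ) M']

theorem extVanish_quotient_of_cofinite [Module.Finite (PS K ℓ) N] (j : I →ₗ[PS K ℓ] N) (k : ℕ)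
    (hk : ∀ i, ∀ x : N, (X i : PS K ℓ) ^ k • x ∈ LinearMap.range j) {i : ℕ} (hi : i < ℓ) :
    ExtVanish (PS K ℓ) (N ⧸ LinearMap.range j) i := by
  refine extVanish_of_irrelevant_pow k (fun i x => ?_) hi
  obtain ⟨y, rfl⟩ := Submodule.mkQ_surjective _ x
  rw [← map_smul, Submodule.mkQ_apply, Submodule.Quotient.mk_eq_zero]
  exact hk i y

theorem PdLT.of_cofinite [Module.Finite (PS K ℓ) N] (j : I →ₗ[PS K ℓ] N)
    (hj : Function.Injective j) (k : ℕ)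
    (hk : ∀ i, ∀ x : N, (X i : PS K ℓ) ^ k • x ∈ LinearMap.range j) {q : ℕ}
    (hI : PdLT (PS K ℓ) I q) (hN : PdLT (PS K ℓ) N ℓ) : PdLT (PS K ℓ) N q :=
  hN.descend_range fun _ hq hi =>
    ExtVanish.middle (g := (LinearMap.range j).mkQ) hj (Submodule.mkQ_surjective _)
      (LinearMap.exact_map_mkQ_range j) (hI.extVanish hq)
      (extVanish_quotient_of_cofinite j k hk hi)

theorem PdLT.of_exact_of_cofinite [Module.Finite (PS K ℓ) N] [Module.Finite (PS K ℓ) M]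
    (j : I →ₗ[PS K ℓ] N) (hj : Function.Injective j) (k : ℕ)
    (hk : ∀ i, ∀ x : N, (X i : PS K ℓ) ^ k • x ∈ LinearMap.range j) {q : ℕ}
    (hN : PdLT (PS K ℓ) N q) (f : M' →ₗ[PS K ℓ] M) (g : M →ₗ[PS K ℓ] I)
    (hf : Function.Injective f) (hg : Function.Surjective g) (hfg : Function.Exact f g)
    (hM' : PdLT (PS K ℓ) M' q) (hM : PdLT (PS K ℓ) M (ℓ - 1)) : PdLT (PS K ℓ) M q :=
  hM.descend_range fun i hq hi =>
    ExtVanish.middle hf hg hfg (hM'.extVanish hq) <|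
      ExtVanish.left (g := (LinearMap.range j).mkQ) hj (Submodule.mkQ_surjective _)
        (LinearMap.exact_map_mkQ_range j) (hN.extVanish hq)
        (extVanish_quotient_of_cofinite j k hk (by omega))

end Cofinite

end Vanishing

section HilbertSyzygy

open TensorProduct

variable {R : Type} [CommRing R]

theorem PdLT.baseChange_of_surjective (A : Type) [CommRing A] [Algebra R A] [Module.Flat R A]
    {n : ℕ} {N M : Type} [AddCommGroup N] [Module R N] [AddCommGroup M] [Module R M]
    (f : N →ₗ[R] M) (hf : Function.Surjective f) (h : PdLT A (A ⊗[R] LinearMap.ker f) n)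
    (h' : PdLT A (A ⊗[R] N) (n + 1)) : PdLT A (A ⊗[R] M) (n + 1) :=
  PdLT.right (f := (LinearMap.ker f).subtype.baseChange A) (g := f.baseChange A)
    (Module.Flat.lTensor_preserves_injective_linearMap _ Subtype.val_injective)
    (LinearMap.lTensor_surjective _ hf)
    (Module.Flat.lTensor_exact A (LinearMap.exact_subtype_ker_map f)) h h'

theorem PdLT.baseChange (A : Type) [CommRing A] [Algebra R A] [Module.Flat R A] {n : ℕ}
    {M : Type} [AddCommGroup M] [Module R M] (h : PdLT R M (n + 1)) :
    PdLT A (A ⊗[R] M) (n + 1) := by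
  rw [← pdLE_iff] at h
  induction n generalizing M with
  | zero =>
    have : Module.Projective R M := h
    exact pdLT_one_iff.2 inferInstance
  | succ n ih =>
    obtain ⟨ι, f, hf, h⟩ := h
    exact PdLT.baseChange_of_surjective A f hf (ih h)
      ((pdLT_one_iff.2 inferInstance).mono (by omega))

section Polynomial

open Polynomial

variable {M : Type} [AddCommGroup M] [Module R M] [Module R[X] M] [IsScalarTower R R[X] M]

/-- Multiplication by `X` on an `R[X]`-module, as an `R`-linear map. -/
def mulXEnd (R M : Type) [CommRing R] [AddCommGroup M] [Module R M] [Module R[X] M]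
    [IsScalarTower R R[X] M] : M →ₗ[R] M :=
  (Algebra.lsmul R R M (Polynomial.X : R[X]))

/-- The action map `R[X] ⊗ M → M`. -/
def actMap (R M : Type) [CommRing R] [AddCommGroup M] [Module R M] [Module R[X] M]
    [IsScalarTower R R[X] M] : R[X] ⊗[R] M →ₗ[R[X]] M :=
  AlgebraTensorModule.lift
    (((LinearMap.lsmul R[X] (M →ₗ[R] M)).flip LinearMap.id) : R[X] →ₗ[R[X]] (M →ₗ[R] M))

@[simp] theorem actMap_tmul (f : R[X]) (x : M) : actMap R M (f ⊗ₜ x) = f • x := rfl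

/-- The map `X ⊗ 1 - 1 ⊗ X` on `R[X] ⊗ M`. -/
def diffMap (R M : Type) [CommRing R] [AddCommGroup M] [Module R M] [Module R[X] M]
    [IsScalarTower R R[X] M] : R[X] ⊗[R] M →ₗ[R[X]] R[X] ⊗[R] M :=
  LinearMap.lsmul R[X] _ Polynomial.X - (mulXEnd R M).baseChange R[X]

theorem diffMap_tmul (f : R[X]) (x : M) :
    diffMap R M (f ⊗ₜ x) = (Polynomial.X * f) ⊗ₜ x - f ⊗ₜ ((Polynomial.X : R[X]) • x) := rfl

/-- The coefficient maps `R[X] ⊗ M → M`. -/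
def coeffMap (R M : Type) [CommRing R] [AddCommGroup M] [Module R M] (k : ℕ) :
    R[X] ⊗[R] M →ₗ[R] M :=
  TensorProduct.lift ((LinearMap.lsmul R M).comp (Polynomial.lcoeff R k))

omit [Module R[X] M] [IsScalarTower R R[X] M] in
theorem coeffMap_tmul (k : ℕ) (f : R[X]) (x : M) : coeffMap R M k (f ⊗ₜ x) = f.coeff k • x := rfl

omit [Module R[X] M] [IsScalarTower R R[X] M] in
theorem coeffMap_bound (t : R[X] ⊗[R] M) : ∃ N, ∀ n, N ≤ n → coeffMap R M n t = 0 ∧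
    t = ∑ k ∈ Finset.range n, (Polynomial.X ^ k : R[X]) ⊗ₜ[R] coeffMap R M k t := by
  induction t with
  | zero => exact ⟨0, fun n _ => by simp⟩
  | add t u ht hu =>
    obtain ⟨N, hN⟩ := ht
    obtain ⟨N', hN'⟩ := hu
    refine ⟨max N N', fun n hn => ?_⟩
    obtain ⟨h1, h2⟩ := hN n (le_trans (le_max_left _ _) hn)
    obtain ⟨h3, h4⟩ := hN' n (le_trans (le_max_right _ _) hn)
    refine ⟨by rw [map_add, h1, h3, add_zero], ?_⟩
    simp only [map_add, tmul_add, Finset.sum_add_distrib]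
    rw [← h2, ← h4]
  | tmul f x =>
    refine ⟨f.natDegree + 1, fun n hn => ⟨?_, ?_⟩⟩
    · rw [coeffMap_tmul, Polynomial.coeff_eq_zero_of_natDegree_lt (by omega), zero_smul]
    · simp only [coeffMap_tmul]
      conv_lhs => rw [f.as_sum_range' n (by omega), sum_tmul]
      refine Finset.sum_congr rfl fun k _ => ?_
      rw [tmul_smul, smul_tmul', Polynomial.smul_X_eq_monomial]

theorem diffMap_injective : Function.Injective (diffMap R M) := by
  rw [injective_iff_map_eq_zero]
  intro t ht
  have key : ∀ k, ∀ u : R[X] ⊗[R] M, coeffMap R M (k + 1) (diffMap R M u) =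
      coeffMap R M k u - (Polynomial.X : R[X]) • coeffMap R M (k + 1) u := by
    intro k u
    induction u with
    | zero => simp
    | add a b ha hb => simp only [map_add, ha, hb, smul_add]; abel
    | tmul f x =>
      rw [diffMap_tmul, map_sub]
      simp only [coeffMap_tmul, Polynomial.coeff_X_mul]
      rw [smul_comm]
  obtain ⟨N, hN⟩ := coeffMap_bound t
  have hz : ∀ j, coeffMap R M (N - j) t = 0 := by
    intro j
    induction j with
    | zero => exact (hN N le_rfl).1
    | succ j ih =>
      rcases Nat.lt_or_ge j N with hj | hj
      · have h1 := key (N - (j + 1)) t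
        rw [show N - (j + 1) + 1 = N - j by omega, ht, ih] at h1
        simpa using h1.symm
      · rwa [show N - (j + 1) = N - j by omega]
  rw [(hN N le_rfl).2]
  refine Finset.sum_eq_zero fun k hk => ?_
  have := hz (N - k)
  rw [Nat.sub_sub_self (Finset.mem_range.1 hk).le] at this
  rw [this, tmul_zero]

theorem actMap_surjective : Function.Surjective (actMap R M) :=
  fun x => ⟨1 ⊗ₜ x, by simp⟩

theorem diffMap_actMap_exact : Function.Exact (diffMap R M) (actMap R M) := by
  have h1 : ∀ f : R[X], ∀ x : M, f ⊗ₜ[R] x - 1 ⊗ₜ[R] (f • x) ∈ LinearMap.range (diffMap R M) := by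
    intro f
    induction f using Polynomial.induction_on with
    | C a =>
      intro x
      rw [← mul_one (Polynomial.C a), ← Polynomial.smul_eq_C_mul, smul_tmul, smul_assoc, one_smul,
        sub_self]
      exact zero_mem _
    | add f g hf hg =>
      intro x
      convert add_mem (hf x) (hg x) using 1
      rw [add_tmul, add_smul, tmul_add]
      abel
    | monomial n a ih =>
      intro x
      convert add_mem (ih ((Polynomial.X : R[X]) • x)) (LinearMap.mem_range_self (diffMap R M)
        ((Polynomial.C a * Polynomial.X ^ n) ⊗ₜ x)) using 1
      rw [diffMap_tmul, smul_smul, pow_succ]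
      rw [show Polynomial.X * (Polynomial.C a * Polynomial.X ^ n) =
        Polynomial.C a * (Polynomial.X ^ n * Polynomial.X : R[X]) by ring,
        mul_assoc]
      abel
  have h2 : ∀ t : R[X] ⊗[R] M, t - 1 ⊗ₜ[R] (actMap R M t) ∈ LinearMap.range (diffMap R M) := by
    intro t
    induction t with
    | zero => simp
    | add a b ha hb =>
      convert add_mem ha hb using 1
      rw [map_add, tmul_add]; abel
    | tmul f x => exact h1 f x
  intro t
  constructor
  · intro ht
    have := h2 t
    rw [ht, tmul_zero, sub_zero] at this
    exact this
  · rintro ⟨u, rfl⟩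
    induction u with
    | zero => simp
    | add a b ha hb => rw [map_add, map_add, ha, hb, add_zero]
    | tmul f x => rw [diffMap_tmul, map_sub, actMap_tmul, actMap_tmul, smul_smul,
        mul_comm f, sub_self]

end Polynomial

theorem pdLT_polynomial {n : ℕ}
    (h : ∀ (M : Type) [AddCommGroup M] [Module R M], PdLT R M (n + 1))
    (M : Type) [AddCommGroup M] [Module (Polynomial R) M] : PdLT (Polynomial R) M (n + 2) := by
  let _ : Module R M := Module.compHom M (Polynomial.C : R →+* Polynomial R)
  have : IsScalarTower R (Polynomial R) M := ⟨fun a f x => by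
    rw [Polynomial.smul_eq_C_mul, mul_smul]; rfl⟩
  exact PdLT.right diffMap_injective actMap_surjective diffMap_actMap_exact
    ((h M).baseChange _) (((h M).baseChange _).mono (Nat.le_succ _))

attribute [local instance] RingHomInvPair.of_ringEquiv in
theorem PdLT.of_ringEquiv {R' : Type} [CommRing R'] (e : R ≃+* R') {n : ℕ}
    (h : ∀ (M : Type) [AddCommGroup M] [Module R M], PdLT R M (n + 1))
    (M : Type) [AddCommGroup M] [Module R' M] : PdLT R' M (n + 1) := by
  let _ : Module R M := Module.compHom M (e : R →+* R')
  have h' := h M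
  unfold PdLT at *
  let e' : M ≃ₛₗ[RingHomClass.toRingHom e] M := { AddEquiv.refl M with map_smul' := fun _ _ => rfl }
  have : CategoryTheory.HasProjectiveDimensionLE (ModuleCat.of R M) n := h'
  exact ModuleCat.hasProjectiveDimensionLE_of_semiLinearEquiv e
    (M := ModuleCat.of R M) (N := ModuleCat.of R' M) e' n

/-- Hilbert's syzygy theorem. -/
theorem pdLT_mvPolynomial (K : Type) [Field K] (n : ℕ) (M : Type) [AddCommGroup M]
    [Module (PS K n) M] : PdLT (PS K n) M (n + 1) := by
  induction n generalizing M with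
  | zero =>
    exact PdLT.of_ringEquiv (isEmptyRingEquiv K (Fin 0)).symm
      (fun M _ _ => pdLT_one_iff.2 inferInstance) M
  | succ n ih =>
    exact PdLT.of_ringEquiv (finSuccEquiv K n).symm.toRingEquiv
      (fun M _ _ => pdLT_polynomial (fun M _ _ => ih M) M) M

end HilbertSyzygy

section ChangeOfRings

open TensorProduct

variable {S R : Type} [CommRing S] [CommRing R] [Algebra S R] {α : S}

theorem PdLT.ker {N M : Type} [AddCommGroup N] [Module R N] [AddCommGroup M] [Module R M]
    {f : N →ₗ[R] M} (hf : Function.Surjective f) {n : ℕ} (hN : PdLT R N n)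
    (hM : PdLT R M (n + 1)) : PdLT R (LinearMap.ker f) n :=
  PdLT.left (f := (LinearMap.ker f).subtype) Subtype.val_injective hf
    (LinearMap.exact_subtype_ker_map f) hN hM

theorem PdLT.of_ker {N M : Type} [AddCommGroup N] [Module R N] [AddCommGroup M] [Module R M]
    {f : N →ₗ[R] M} (hf : Function.Surjective f) {n : ℕ} (hk : PdLT R (LinearMap.ker f) n)
    (hN : PdLT R N (n + 1)) : PdLT R M (n + 1) :=
  PdLT.right (f := (LinearMap.ker f).subtype) Subtype.val_injective hf
    (LinearMap.exact_subtype_ker_map f) hk hN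

theorem pdLT_two_of_finsupp (hs : Function.Surjective (algebraMap S R))
    (hker : RingHom.ker (algebraMap S R) = Ideal.span {α}) (hα : α ∈ nonZeroDivisors S)
    (ι : Type) : PdLT S (ι →₀ R) 2 := by
  have hinj : Function.Injective (fun s : S => α * s) := fun a b h =>
    (mul_cancel_left_mem_nonZeroDivisors hα).1 h
  refine PdLT.right (f := LinearMap.lsmul S (ι →₀ S) α)
    (g := Finsupp.mapRange.linearMap (Algebra.linearMap S R)) (fun a b h => ?_) ?_ ?_
    pdLT_free (pdLT_free.mono (by omega))
  · ext i
    exact hinj (DFunLike.congr_fun h i)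
  · exact Finsupp.mapRange_surjective _ (map_zero _) hs
  · intro f
    constructor
    · intro hf
      have h0 : Function.invFun (fun s : S => α * s) 0 = 0 := by
        simpa using Function.leftInverse_invFun hinj 0
      refine ⟨f.mapRange _ h0, ?_⟩
      ext i
      have h1 : algebraMap S R (f i) = 0 := DFunLike.congr_fun hf i
      rw [← RingHom.mem_ker, hker, Ideal.mem_span_singleton'] at h1
      obtain ⟨t, ht⟩ := h1
      rw [mul_comm] at ht
      simp only [LinearMap.lsmul_apply, Finsupp.smul_apply, Finsupp.mapRange_apply, smul_eq_mul]
      rw [← ht]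
      exact congrArg (α * ·) (Function.leftInverse_invFun hinj t)
    · rintro ⟨g, rfl⟩
      ext i
      have : algebraMap S R α = 0 := by
        rw [← RingHom.mem_ker, hker]; exact Ideal.mem_span_singleton_self α
      change algebraMap S R (α * g i) = 0
      rw [map_mul, this, zero_mul]

theorem pdLT_two_of_projective (hs : Function.Surjective (algebraMap S R))
    (hker : RingHom.ker (algebraMap S R) = Ideal.span {α}) (hα : α ∈ nonZeroDivisors S)
    {N : Type} [AddCommGroup N] [Module S N] [Module R N] [IsScalarTower S R N]
    [Module.Projective R N] : PdLT S N 2 := by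
  obtain ⟨s, hs'⟩ := Module.projective_def'.1 ‹Module.Projective R N›
  refine PdLT.of_retract (s.restrictScalars S)
    ((Finsupp.linearCombination R (id : N → N)).restrictScalars S) ?_
    (pdLT_two_of_finsupp hs hker hα N)
  ext x
  exact LinearMap.congr_fun hs' x

theorem exists_smul_of_one_tmul_eq_zero
    (hker : RingHom.ker (algebraMap S R) = Ideal.span {α})
    (hs : Function.Surjective (algebraMap S R))
    {Z : Type} [AddCommGroup Z] [Module S Z] (z : Z)
    (h : (1 : R) ⊗ₜ[S] z = 0) : ∃ y, z = α • y := by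
  have hex : Function.Exact (LinearMap.lsmul S S α) (Algebra.linearMap S R) := by
    intro s
    rw [Algebra.linearMap_apply, ← RingHom.mem_ker, hker, Ideal.mem_span_singleton']
    constructor
    · rintro ⟨t, rfl⟩
      exact ⟨t, by simp [mul_comm]⟩
    · rintro ⟨t, rfl⟩
      exact ⟨t, by simp [mul_comm]⟩
  have h1 := rTensor_exact Z hex hs ((1 : S) ⊗ₜ z)
  have h2 : (LinearMap.rTensor Z (Algebra.linearMap S R)) ((1 : S) ⊗ₜ z) = 0 := by
    simpa using h
  obtain ⟨t, ht⟩ := h1.1 h2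
  refine ⟨TensorProduct.lid S Z t, ?_⟩
  have h3 : ∀ t, TensorProduct.lid S Z (LinearMap.rTensor Z (LinearMap.lsmul S S α) t) =
      α • TensorProduct.lid S Z t := by
    intro t
    induction t with
    | zero => simp
    | add a b ha hb => simp only [map_add, ha, hb, smul_add]
    | tmul a b => simp [mul_smul]
  rw [← h3, ht]
  simp

theorem exists_one_tmul (hs : Function.Surjective (algebraMap S R))
    {Z : Type} [AddCommGroup Z] [Module S Z] (t : R ⊗[S] Z) : ∃ z, t = (1 : R) ⊗ₜ z := by
  induction t with
  | zero => exact ⟨0, by simp⟩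
  | add a b ha hb =>
    obtain ⟨x, rfl⟩ := ha
    obtain ⟨y, rfl⟩ := hb
    exact ⟨x + y, by rw [tmul_add]⟩
  | tmul a b =>
    obtain ⟨s, rfl⟩ := hs a
    exact ⟨s • b, by rw [tmul_smul, smul_tmul', Algebra.smul_def, mul_one]⟩

theorem projective_of_pdLT_two (hs : Function.Surjective (algebraMap S R))
    (hker : RingHom.ker (algebraMap S R) = Ideal.span {α}) (hα : α ∈ nonZeroDivisors S)
    {N : Type} [AddCommGroup N] [Module S N] [Module R N] [IsScalarTower S R N]
    (hR : PdLT R N 2) (hS : PdLT S N 2) : Module.Projective R N := by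
  let f : (N →₀ S) →ₗ[S] N := Finsupp.linearCombination S (id : N → N)
  have hf : Function.Surjective f := Finsupp.linearCombination_id_surjective S N
  let Z := LinearMap.ker f
  have hZ : Module.Projective S Z := pdLT_one_iff.1 (PdLT.ker hf pdLT_free hS)
  have hα0 : algebraMap S R α = 0 := by
    rw [← RingHom.mem_ker, hker]; exact Ideal.mem_span_singleton_self α
  have hαN : ∀ x : N, α • x = 0 := fun x => by rw [← algebraMap_smul R, hα0, zero_smul]
  have hinj : Function.Injective (fun g : N →₀ S => α • g) := by
    intro a b h
    ext i
    exact (mul_cancel_left_mem_nonZeroDivisors hα).1 (DFunLike.congr_fun h i)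
  let g : R ⊗[S] (N →₀ S) →ₗ[R] N := LinearMap.liftBaseChange R f
  have hg1 : ∀ x, g (1 ⊗ₜ x) = f x := fun x => by simp [g]
  have hg : Function.Surjective g := fun x => by
    obtain ⟨y, rfl⟩ := hf x
    exact ⟨1 ⊗ₜ y, hg1 y⟩
  let W := LinearMap.ker g
  have hW : Module.Projective R W := pdLT_one_iff.1 (PdLT.ker hg (pdLT_one_iff.2 inferInstance) hR)
  let u : R ⊗[S] Z →ₗ[R] W := (Z.subtype.baseChange R).codRestrict W fun t => by
    obtain ⟨z, rfl⟩ := exists_one_tmul (Z := Z) hs t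
    rw [LinearMap.baseChange_tmul, LinearMap.mem_ker, hg1]
    exact z.2
  have hu1 : ∀ z : Z, (u (1 ⊗ₜ z) : R ⊗[S] (N →₀ S)) = 1 ⊗ₜ (z : N →₀ S) := fun z => rfl
  have hu : Function.Surjective u := by
    rintro ⟨w, hw⟩
    obtain ⟨x, rfl⟩ := exists_one_tmul (Z := N →₀ S) hs w
    refine ⟨1 ⊗ₜ ⟨x, ?_⟩, Subtype.ext (hu1 _)⟩
    rw [LinearMap.mem_ker, ← hg1]
    exact hw
  obtain ⟨v, hv⟩ := Module.projective_lifting_property u LinearMap.id hu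
  have hT : Module.Projective R (LinearMap.ker u) := by
    let r : R ⊗[S] Z →ₗ[R] LinearMap.ker u :=
      (LinearMap.id - v ∘ₗ u).codRestrict _ fun t => by
        have := LinearMap.congr_fun hv (u t)
        simp only [LinearMap.comp_apply, LinearMap.id_apply] at this
        simp [this]
    refine Module.Projective.of_split (LinearMap.ker u).subtype r ?_
    ext t
    have : u t = 0 := t.2
    simp [r, this]
  let w : (N →₀ S) →ₗ[S] R ⊗[S] Z :=
    (TensorProduct.mk S R Z 1) ∘ₗ (LinearMap.lsmul S _ α).codRestrict Z
      (fun x => by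
        rw [LinearMap.lsmul_apply, LinearMap.mem_ker, map_smul, hαN])
  have hw : ∀ x, ∀ hx, w x = 1 ⊗ₜ ⟨α • x, hx⟩ := fun x hx => rfl
  have hker_w : LinearMap.ker w = LinearMap.ker f := by
    ext x
    constructor
    · intro hx
      have hx' := LinearMap.mem_ker.1 hx
      rw [hw x (by rw [LinearMap.mem_ker, map_smul, hαN])] at hx'
      obtain ⟨y, hy⟩ := exists_smul_of_one_tmul_eq_zero (Z := Z) hker hs _ hx'
      have := hinj (congrArg Subtype.val hy : α • x = α • (y : N →₀ S))
      rw [this]; exact y.2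
    · intro hx
      rw [LinearMap.mem_ker, hw x (by rw [LinearMap.mem_ker, map_smul, hαN])]
      have : (⟨α • x, by rw [LinearMap.mem_ker, map_smul, hαN]⟩ : Z) = α • ⟨x, hx⟩ := rfl
      rw [this, tmul_smul, smul_tmul', Algebra.smul_def, hα0, zero_mul, zero_tmul]
  have hrange_w : LinearMap.range w = (LinearMap.ker u).restrictScalars S := by
    ext t
    constructor
    · rintro ⟨x, rfl⟩
      change u (w x) = 0
      apply Subtype.ext
      rw [hw x (by rw [LinearMap.mem_ker, map_smul, hαN]), hu1]
      change (1 : R) ⊗ₜ[S] (α • x) = 0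
      rw [tmul_smul, smul_tmul', Algebra.smul_def, hα0, zero_mul, zero_tmul]
    · intro ht
      have ht : u t = 0 := ht
      obtain ⟨z, rfl⟩ := exists_one_tmul (Z := Z) hs t
      have h1 := congrArg Subtype.val ht
      rw [hu1] at h1
      obtain ⟨y, hy⟩ := exists_smul_of_one_tmul_eq_zero (Z := N →₀ S) hker hs _ h1
      refine ⟨y, ?_⟩
      rw [hw y (by rw [LinearMap.mem_ker, map_smul, hαN])]
      congr 1
      exact Subtype.ext hy.symm
  let e : N ≃ₗ[S] LinearMap.ker u :=
    ((f.quotKerEquivOfSurjective hf).symm ≪≫ₗ Submodule.quotEquivOfEq _ _ hker_w.symm ≪≫ₗ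
      w.quotKerEquivRange ≪≫ₗ LinearEquiv.ofEq _ _ hrange_w)
  exact Module.Projective.of_equiv (e.extendScalarsOfSurjective hs).symm

/-- Change of rings for projective dimension along the quotient by a nonzerodivisor. -/
theorem PdLT.change_of_rings (hs : Function.Surjective (algebraMap S R))
    (hker : RingHom.ker (algebraMap S R) = Ideal.span {α}) (hα : α ∈ nonZeroDivisors S)
    {N : Type} [AddCommGroup N] [Module S N] [Module R N] [IsScalarTower S R N] {d p : ℕ}
    (hR : PdLT R N (d + 1)) (hS : PdLT S N (p + 2)) : PdLT R N (p + 1) := by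
  have main : ∀ d p : ℕ, ∀ (N : Type) [AddCommGroup N] [Module S N] [Module R N]
      [IsScalarTower S R N], PdLT R N (d + 1) → PdLT S N (p + 2) → PdLT R N (p + 1) := by
    intro d
    induction d with
    | zero => intro p N _ _ _ _ h _; exact h.mono (by omega)
    | succ d ih =>
      intro p N _ _ _ _ hR hS
      let f : (N →₀ R) →ₗ[R] N := Finsupp.linearCombination R (id : N → N)
      have hf : Function.Surjective f := Finsupp.linearCombination_id_surjective R N
      have hR' : PdLT R (LinearMap.ker f) (d + 1) :=
        PdLT.ker hf (pdLT_free.mono (by omega)) hR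
      have hS' : ∀ q, PdLT S N (q + 3) → PdLT S (LinearMap.ker f) (q + 2) := fun q hq =>
        PdLT.ker (f := f.restrictScalars S) hf ((pdLT_two_of_finsupp hs hker hα N).mono (by omega)) hq
      have key : ∀ q, PdLT R (LinearMap.ker f) (q + 1) → PdLT R N (q + 2) := fun q hq =>
        PdLT.of_ker hf hq (pdLT_free.mono (by omega))
      cases p with
      | zero =>
        exact pdLT_one_iff.2 <| projective_of_pdLT_two hs hker hα
          (key 0 (ih 0 _ hR' (hS' 0 (hS.mono (by omega))))) hS
      | succ p => exact key p (ih p _ hR' (hS' p hS))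
  exact main d p N hR hS

end ChangeOfRings

/-! ### Divisibility in free modules -/

section FreeDivisibility

variable {S : Type*} [CommRing S] {F : Type*} [AddCommGroup F] [Module S F]

theorem exists_smul_iff_dual [Module.Free S F] (a : S) (x : F) :
    (∃ y, x = a • y) ↔ ∀ f : Module.Dual S F, a ∣ f x := by
  refine ⟨?_, fun h => ?_⟩
  · rintro ⟨y, rfl⟩ f
    exact ⟨f y, by simp⟩
  · let b := Module.Free.chooseBasis S F
    choose c hc using fun i => h (b.coord i)
    refine ⟨∑ i ∈ (b.repr x).support, c i • b i, ?_⟩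
    conv_lhs => rw [← b.linearCombination_repr x]
    rw [Finsupp.linearCombination_apply, Finsupp.sum, Finset.smul_sum]
    refine Finset.sum_congr rfl fun i _ => ?_
    rw [smul_smul, ← hc]; rfl

theorem exists_pow_smul_of_smul [IsDomain S] [Module.Free S F] {p q : S} (hp : Prime p)
    (hq : ¬ p ∣ q) {k : ℕ} {x y : F} (h : q • x = p ^ k • y) : ∃ z, x = p ^ k • z := by
  rw [exists_smul_iff_dual]
  intro f
  have h1 : p ^ k ∣ q * f x := ⟨f y, by
    have := congrArg f h
    simpa using this⟩
  exact hp.pow_dvd_of_dvd_mul_left k hq h1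

theorem exists_prod_smul [IsDomain S] [UniqueFactorizationMonoid S] [Module.Free S F] {ι : Type*}
    (s : Finset ι) (a : ι → S)
    (ha : (s : Set ι).Pairwise (Function.onFun IsRelPrime a)) {x : F}
    (h : ∀ i ∈ s, ∃ y, x = a i • y) : ∃ y, x = (∏ i ∈ s, a i) • y := by
  rw [exists_smul_iff_dual]
  intro f
  exact Finset.prod_dvd_of_isRelPrime ha
    fun i hi => (exists_smul_iff_dual _ _).1 (h i hi) f

end FreeDivisibility

/-! ### Linear forms -/

@[simp] theorem eval_linP (c x : Fin ℓ → K) : eval x (linP c) = ∑ i, c i * x i := by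
  simp [linP]

theorem dotLin_apply (c x : Fin ℓ → K) : dotLin c x = ∑ i, c i * x i := by
  simp [dotLin]

theorem linP_ne_zero {c : Fin ℓ → K} (hc : c ≠ 0) : linP c ≠ 0 := by
  intro h
  apply hc
  ext i
  have := congrArg (eval (Pi.single i 1)) h
  simpa [Pi.single_apply] using this

theorem linP_smul (t : K) (c : Fin ℓ → K) : linP (t • c) = C t * linP c := by
  simp [linP, Finset.mul_sum, mul_assoc]

theorem linP_isHomogeneous (c : Fin ℓ → K) : (linP c).IsHomogeneous 1 := by
  apply MvPolynomial.IsHomogeneous.sum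
  intro i _
  simpa using (isHomogeneous_C (Fin ℓ) (c i)).mul (isHomogeneous_X K i)

theorem prime_linP {c : Fin ℓ → K} (hc : c ≠ 0) : Prime (linP c) := by
  rw [← UniqueFactorizationMonoid.irreducible_iff_prime]
  have hne := linP_ne_zero hc
  refine irreducible_of_totalDegree_eq_one ((linP_isHomogeneous c).totalDegree hne) ?_
  intro x hx
  obtain ⟨i, hi⟩ : ∃ i, c i ≠ 0 := by
    by_contra! h
    exact hc (funext h)
  have h1 := hx (Finsupp.single i 1)
  have h2 : coeff (Finsupp.single i 1) (linP c) = c i := by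
    rw [linP, coeff_sum]
    simp [coeff_C_mul, coeff_X, Finsupp.single_left_inj]
  rw [h2] at h1
  exact (ne_zero_of_dvd_ne_zero hi h1).isUnit

theorem eq_smul_of_linP_dvd {c c' : Fin ℓ → K} (h : linP c ∣ linP c') : ∃ t : K, c' = t • c := by
  obtain ⟨q, hq⟩ := h
  have hk : LinearMap.ker (dotLin c) ≤ LinearMap.ker (dotLin c') := by
    intro x hx
    rw [LinearMap.mem_ker, dotLin_apply] at *
    rw [← eval_linP, hq, map_mul, eval_linP, hx, zero_mul]
  have := (mem_span_of_iInf_ker_le_ker (L := fun _ : Unit => dotLin c) (K := dotLin c')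
    (by simpa using hk))
  rw [Set.range_const, Submodule.mem_span_singleton] at this
  obtain ⟨t, ht⟩ := this
  refine ⟨t, ?_⟩
  ext i
  have := congrArg (fun g => g (Pi.single i 1)) ht
  simpa [dotLin_apply, Pi.single_apply] using this.symm

theorem isRelPrime_linP_pow {c c' : Fin ℓ → K} (hc : c ≠ 0)
    (h : ∀ t : K, c' ≠ t • c) (i j : ℕ) : IsRelPrime (linP c ^ i) (linP c' ^ j) := by
  apply IsRelPrime.pow
  rw [(prime_linP hc).irreducible.isRelPrime_iff_not_dvd]
  intro hd
  obtain ⟨t, ht⟩ := eq_smul_of_linP_dvd hd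
  exact h t ht

theorem Arrangement.not_dvd (A : Arrangement K ℓ) {c c' : Fin ℓ → K} (hc : c ∈ A.hyps)
    (hc' : c' ∈ A.hyps) (hne : c ≠ c') : ¬ linP c ∣ linP c' := by
  intro hd
  obtain ⟨t, ht⟩ := eq_smul_of_linP_dvd hd
  exact A.nonprop c' hc' c hc (Ne.symm hne) t ht

theorem Arrangement.pairwise_isRelPrime (A : Arrangement K ℓ) (m : (Fin ℓ → K) → ℕ) :
    (A.hyps : Set (Fin ℓ → K)).Pairwise (Function.onFun IsRelPrime (fun c => linP c ^ m c)) := by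
  intro c hc c' hc' hne
  exact isRelPrime_linP_pow (A.ne_zero c hc)
    (fun t => A.nonprop c' hc' c hc (Ne.symm hne) t) _ _

theorem Arrangement.not_dvd_prod (A : Arrangement K ℓ) (m : (Fin ℓ → K) → ℕ) {c : Fin ℓ → K}
    (hc : c ∈ A.hyps) {s : Finset (Fin ℓ → K)} (hs : s ⊆ A.hyps) (hcs : c ∉ s) :
    ¬ linP c ∣ ∏ c' ∈ s, linP c' ^ m c' := by
  intro h
  obtain ⟨c', hc', hd⟩ := (prime_linP (A.ne_zero c hc)).exists_mem_finset_dvd h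
  exact A.not_dvd hc (hs hc') (by rintro rfl; exact hcs hc')
    ((prime_linP (A.ne_zero c hc)).dvd_of_dvd_pow hd)

/-! ### Exterior algebra facts -/

section Exterior

variable {S : Type*} [CommRing S] {M : Type*} [AddCommGroup M] [Module S M]

/-- Contraction of a form by a functional. -/
def ctr (d : Module.Dual S M) : ExteriorAlgebra S M →ₗ[S] ExteriorAlgebra S M :=
  CliffordAlgebra.contractLeft d

theorem ctr_ι_mul (d : Module.Dual S M) (v : M) (x : ExteriorAlgebra S M) :
    ctr d (ExteriorAlgebra.ι S v * x) = d v • x - ExteriorAlgebra.ι S v * ctr d x :=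
  CliffordAlgebra.contractLeft_ι_mul d v x

theorem ctr_ι (d : Module.Dual S M) (v : M) :
    ctr d (ExteriorAlgebra.ι S v) = algebraMap S _ (d v) :=
  CliffordAlgebra.contractLeft_ι _ d v

theorem ctr_algebraMap (d : Module.Dual S M) (r : S) :
    ctr d (algebraMap S (ExteriorAlgebra S M) r) = 0 :=
  CliffordAlgebra.contractLeft_algebraMap _ d r

theorem ι_mul_ι_mul (v : M) (x : ExteriorAlgebra S M) :
    ExteriorAlgebra.ι S v * (ExteriorAlgebra.ι S v * x) = 0 := by
  rw [← mul_assoc, ExteriorAlgebra.ι_sq_zero, zero_mul]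

/-- The grading involution of the exterior algebra. -/
def extInv : ExteriorAlgebra S M →ₐ[S] ExteriorAlgebra S M := CliffordAlgebra.involute

theorem extInv_extInv (x : ExteriorAlgebra S M) : extInv (extInv x) = x :=
  CliffordAlgebra.involute_involute x

theorem ι_mul_comm (v : M) (x : ExteriorAlgebra S M) :
    x * ExteriorAlgebra.ι S v = ExteriorAlgebra.ι S v * extInv x := by
  induction x using CliffordAlgebra.left_induction with
  | algebraMap r => simp [extInv, Algebra.commutes]
  | add x y hx hy => rw [add_mul, hx, hy, map_add, mul_add]
  | ι_mul x w hx =>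
    have h := ExteriorAlgebra.ι_add_mul_swap (R := S) w v
    have h2 : extInv (CliffordAlgebra.ι (0 : QuadraticForm S M) w) =
      -(ExteriorAlgebra.ι S w) := CliffordAlgebra.involute_ι w
    rw [mul_assoc, hx, map_mul, h2]
    change ExteriorAlgebra.ι S w * _ = _
    rw [← mul_assoc, eq_neg_of_add_eq_zero_left h]
    simp [mul_assoc]

theorem mul_ι_mul (v : M) (x y : ExteriorAlgebra S M) :
    x * (ExteriorAlgebra.ι S v * y) = ExteriorAlgebra.ι S v * (extInv x * y) := by
  rw [← mul_assoc, ι_mul_comm, mul_assoc]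

theorem ι_mul_mul_ι_mul (v : M) (x y : ExteriorAlgebra S M) :
    ExteriorAlgebra.ι S v * (x * (ExteriorAlgebra.ι S v * y)) = 0 := by
  rw [mul_ι_mul, ι_mul_ι_mul]

theorem ctr_mem_pow (d : Module.Dual S M) (p : ℕ) :
    ∀ x ∈ (LinearMap.range (ExteriorAlgebra.ι S (M := M))) ^ (p + 1),
      ctr d x ∈ (LinearMap.range (ExteriorAlgebra.ι S (M := M))) ^ p := by
  induction p with
  | zero =>
    intro x hx
    rw [zero_add, pow_one] at hx
    obtain ⟨v, rfl⟩ := hx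
    rw [ctr_ι, pow_zero]
    exact Submodule.algebraMap_mem _
  | succ p ih =>
    intro x hx
    rw [pow_succ'] at hx
    induction hx using Submodule.mul_induction_on' with
    | mem_mul_mem a ha b hb =>
      obtain ⟨v, rfl⟩ := ha
      rw [ctr_ι_mul]
      refine Submodule.sub_mem _ (Submodule.smul_mem _ _ hb) ?_
      rw [pow_succ']
      exact Submodule.mul_mem_mul ⟨v, rfl⟩ (ih _ hb)
    | add a _ b _ ha hb => rw [map_add]; exact Submodule.add_mem _ ha hb

end Exterior

/-! ### Polynomial forms -/

instance : GradedAlgebra (formsP K ℓ) := ExteriorAlgebra.gradedAlgebra (PS K ℓ) _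

instance : Module.Free (PS K ℓ) (ExtF K ℓ) :=
  Module.Free.of_basis (Pi.basisFun (PS K ℓ) (Fin ℓ)).ExteriorAlgebra

instance : Module.Finite (PS K ℓ) (ExtF K ℓ) :=
  Module.Finite.of_basis (Pi.basisFun (PS K ℓ) (Fin ℓ)).ExteriorAlgebra

theorem smul_right_inj_extF {a : PS K ℓ} (ha : a ≠ 0) {x y : ExtF K ℓ} (h : a • x = a • y) :
    x = y := by
  exact smul_right_injective _ ha h

theorem smul_eq_zero_extF {a : PS K ℓ} (ha : a ≠ 0) {x : ExtF K ℓ} (h : a • x = 0) : x = 0 :=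
  smul_right_inj_extF ha (by simpa using h)

theorem mem_formsP_of_smul {p : ℕ} {a : PS K ℓ} (ha : a ≠ 0) {x : ExtF K ℓ}
    (h : a • x ∈ formsP K ℓ p) : x ∈ formsP K ℓ p := by
  have key : ∀ j, j ≠ p → GradedAlgebra.proj (formsP K ℓ) j x = 0 := by
    intro j hj
    apply smul_eq_zero_extF ha
    rw [← map_smul, GradedAlgebra.proj_apply]
    exact DirectSum.decompose_of_mem_ne _ h (Ne.symm hj)
  rw [← DirectSum.sum_support_decompose (formsP K ℓ) x]
  refine Submodule.sum_mem _ fun j _ => ?_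
  by_cases hj : j = p
  · subst hj; exact SetLike.coe_mem _
  · have := key j hj
    rw [GradedAlgebra.proj_apply] at this
    rw [this]; exact Submodule.zero_mem _

theorem mul_mem_formsP {p q : ℕ} {x y : ExtF K ℓ} (hx : x ∈ formsP K ℓ p)
    (hy : y ∈ formsP K ℓ q) : x * y ∈ formsP K ℓ (p + q) := by
  rw [formsP, pow_add]; exact Submodule.mul_mem_mul hx hy

theorem ι_mem_formsP (v : Fin ℓ → PS K ℓ) :
    ExteriorAlgebra.ι (PS K ℓ) v ∈ formsP K ℓ 1 := by
  rw [formsP, pow_one]; exact ⟨v, rfl⟩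

theorem mem_formsP_one {x : ExtF K ℓ} (hx : x ∈ formsP K ℓ 1) :
    ∃ v, x = ExteriorAlgebra.ι (PS K ℓ) v := by
  rw [formsP, pow_one] at hx
  obtain ⟨v, rfl⟩ := hx; exact ⟨v, rfl⟩

theorem mem_formsP_zero {x : ExtF K ℓ} : x ∈ formsP K ℓ 0 ↔ ∃ s : PS K ℓ, x = algebraMap _ _ s := by
  rw [formsP, pow_zero, Submodule.mem_one]
  exact ⟨fun ⟨s, h⟩ => ⟨s, h.symm⟩, fun ⟨s, h⟩ => ⟨s, h.symm⟩⟩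

theorem dP_mem_formsP (c : Fin ℓ → K) : dP c ∈ formsP K ℓ 1 := ι_mem_formsP _

theorem ι_mul_mem_formsP (v : Fin ℓ → PS K ℓ) {p : ℕ} {x : ExtF K ℓ} (hx : x ∈ formsP K ℓ p) :
    ExteriorAlgebra.ι (PS K ℓ) v * x ∈ formsP K ℓ (p + 1) := by
  rw [add_comm]; exact mul_mem_formsP (ι_mem_formsP v) hx

theorem ctr_mem_formsP (d : Module.Dual (PS K ℓ) (Fin ℓ → PS K ℓ)) {p : ℕ} {x : ExtF K ℓ}
    (hx : x ∈ formsP K ℓ (p + 1)) : ctr d x ∈ formsP K ℓ p :=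
  ctr_mem_pow d p x hx

theorem projective_formsP (p : ℕ) : Module.Projective (PS K ℓ) (formsP K ℓ p) := by
  refine Module.Projective.of_split (formsP K ℓ p).subtype
    ((GradedAlgebra.proj (formsP K ℓ) p).codRestrict _ fun x => ?_) ?_
  · rw [GradedAlgebra.proj_apply]; exact SetLike.coe_mem _
  · ext x
    simp [GradedAlgebra.proj_apply]

/-! ### Logarithmic forms -/

/-- The coefficient vector of a linear form, as a constant polynomial vector. -/
def cvec (c : Fin ℓ → K) : Fin ℓ → PS K ℓ := fun i => C (c i)

theorem dP_eq (c : Fin ℓ → K) : dP c = ExteriorAlgebra.ι (PS K ℓ) (cvec c) := rfl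

/-- The constant functional (constant vector field) attached to a vector. -/
def constFun (w : Fin ℓ → K) : Module.Dual (PS K ℓ) (Fin ℓ → PS K ℓ) :=
  ∑ i, (C (w i) : PS K ℓ) • LinearMap.proj i

theorem constFun_cvec (w c : Fin ℓ → K) : constFun w (cvec c) = C (∑ i, c i * w i) := by
  simp [constFun, cvec, mul_comm]

theorem exists_dual_vec {c : Fin ℓ → K} (hc : c ≠ 0) : ∃ w : Fin ℓ → K, ∑ i, c i * w i = 1 := by
  obtain ⟨i, hi⟩ : ∃ i, c i ≠ 0 := by
    by_contra! h
    exact hc (funext h)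
  exact ⟨Pi.single i (c i)⁻¹, by simp [Pi.single_apply, hi]⟩

/-- `η` is logarithmic along `(A, m)`. -/
def IsLog (A : Arrangement K ℓ) (m : (Fin ℓ → K) → ℕ) (η : ExtF K ℓ) : Prop :=
  ∀ c ∈ A.hyps, ∃ ζ, dP c * η = linP c ^ m c • ζ

/-- `d` is a logarithmic derivation along `(A, m)`. -/
def IsDer (A : Arrangement K ℓ) (m : (Fin ℓ → K) → ℕ)
    (d : Module.Dual (PS K ℓ) (Fin ℓ → PS K ℓ)) : Prop :=
  ∀ c ∈ A.hyps, linP c ^ m c ∣ d (cvec c)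

theorem mem_Omega {A : Arrangement K ℓ} {m : (Fin ℓ → K) → ℕ} {p : ℕ} {η : ExtF K ℓ} :
    η ∈ Omega A m p ↔ η ∈ formsP K ℓ p ∧ IsLog A m η := by
  rw [Omega, Submodule.mem_inf]
  refine and_congr_right fun hη => ?_
  simp only [Submodule.mem_iInf, Submodule.mem_comap, Submodule.mem_map, LinearMap.mulLeft_apply,
    LinearMap.lsmul_apply, IsLog]
  refine forall₂_congr fun c hc => ?_
  constructor
  · rintro ⟨ζ, _, h⟩; exact ⟨ζ, h.symm⟩
  · rintro ⟨ζ, h⟩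
    refine ⟨ζ, ?_, h.symm⟩
    apply mem_formsP_of_smul (pow_ne_zero (m c) (linP_ne_zero (A.ne_zero c hc)))
    rw [← h]; exact ι_mul_mem_formsP _ hη

theorem Qpoly_ne_zero (A : Arrangement K ℓ) (m : (Fin ℓ → K) → ℕ) : Qpoly A m ≠ 0 :=
  Finset.prod_ne_zero_iff.2 fun c hc => pow_ne_zero _ (linP_ne_zero (A.ne_zero c hc))

section

variable {A A1 : Arrangement K ℓ} {m m' : (Fin ℓ → K) → ℕ} {η η₁ η₂ : ExtF K ℓ}

theorem IsLog.mono (h : IsLog A m η) (hA : A1.hyps ⊆ A.hyps) (hm : ∀ c ∈ A1.hyps, m' c ≤ m c) :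
    IsLog A1 m' η := by
  intro c hc
  obtain ⟨b, hb⟩ := h c (hA hc)
  refine ⟨linP c ^ (m c - m' c) • b, ?_⟩
  rw [hb, smul_smul, ← pow_add, Nat.add_sub_cancel' (hm c hc)]

theorem IsLog.smul_of_dvd (h : IsLog A1 m' η) (f : PS K ℓ)
    (hf : ∀ c ∈ A.hyps, (c ∉ A1.hyps → linP c ^ m c ∣ f) ∧
      (c ∈ A1.hyps → linP c ^ m c ∣ f * linP c ^ m' c)) : IsLog A m (f • η) := by
  intro c hc
  by_cases h1 : c ∈ A1.hyps
  · obtain ⟨ζ, hζ⟩ := h c h1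
    obtain ⟨g, hg⟩ := (hf c hc).2 h1
    refine ⟨g • ζ, ?_⟩
    rw [mul_smul_comm, hζ, smul_smul, hg, smul_smul]
  · obtain ⟨g, hg⟩ := (hf c hc).1 h1
    exact ⟨g • (dP c * η), by rw [mul_smul_comm, hg, smul_smul]⟩

theorem IsLog.ctr {d : Module.Dual (PS K ℓ) (Fin ℓ → PS K ℓ)} (h : IsLog A m η)
    (hd : IsDer A m d) : IsLog A m (ctr d η) := by
  intro c hc
  obtain ⟨ζ, hζ⟩ := h c hc
  obtain ⟨t, ht⟩ := hd c hc
  refine ⟨t • η - _root_.ctr d ζ, ?_⟩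
  have := ctr_ι_mul d (cvec c) η
  rw [← dP_eq, hζ, ht, map_smul] at this
  rw [smul_sub, smul_smul, this]; abel

theorem eq_of_dP_mul {v : Module.Dual (PS K ℓ) (Fin ℓ → PS K ℓ)} {c : Fin ℓ → K}
    (hv : v (cvec c) = 1) {a : PS K ℓ} {ζ : ExtF K ℓ} (h : dP c * η = a • ζ) :
    η = dP c * ctr v η + a • ctr v ζ := by
  have := ctr_ι_mul v (cvec c) η
  rw [← dP_eq, h, hv, one_smul, map_smul] at this
  rw [this]; abel

theorem dP_mul_dP_mul (c : Fin ℓ → K) (x : ExtF K ℓ) : dP c * (dP c * x) = 0 :=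
  ι_mul_ι_mul _ _

theorem dP_mul_mul_dP_mul (c : Fin ℓ → K) (x y : ExtF K ℓ) : dP c * (x * (dP c * y)) = 0 :=
  ι_mul_mul_ι_mul _ _ _

theorem exists_pow_smul_mul {c : Fin ℓ → K} (hc : c ≠ 0) {k : ℕ} {ζ₁ ζ₂ : ExtF K ℓ}
    (h₁ : dP c * η₁ = linP c ^ k • ζ₁) (h₂ : dP c * η₂ = linP c ^ k • ζ₂) :
    ∃ ζ, η₁ * η₂ = linP c ^ k • ζ := by
  obtain ⟨w, hw⟩ := exists_dual_vec hc
  have hv : constFun w (cvec c) = 1 := by rw [constFun_cvec, hw, map_one]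
  refine ⟨extInv (ctr (constFun w) η₁) * ζ₂ + ctr (constFun w) ζ₁ * η₂, ?_⟩
  have h := mul_ι_mul (cvec c) (extInv (ctr (constFun w) η₁)) η₂
  rw [← dP_eq, h₂, extInv_extInv] at h
  conv_lhs => rw [eq_of_dP_mul hv h₁]
  rw [add_mul, mul_assoc, ← h, smul_add, mul_smul_comm, smul_mul_assoc]

theorem IsLog.exists_mul (h₁ : IsLog A m η₁) (h₂ : IsLog A m η₂) :
    ∃ κ, η₁ * η₂ = Qpoly A m • κ ∧ IsLog A m κ := by
  obtain ⟨κ, hκ⟩ := exists_prod_smul A.hyps (fun c => linP c ^ m c) (A.pairwise_isRelPrime m)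
    (x := η₁ * η₂) fun c hc => by
      obtain ⟨ζ₁, hζ₁⟩ := h₁ c hc
      obtain ⟨ζ₂, hζ₂⟩ := h₂ c hc
      exact exists_pow_smul_mul (A.ne_zero c hc) hζ₁ hζ₂
  change η₁ * η₂ = Qpoly A m • κ at hκ
  refine ⟨κ, hκ, fun c hc => ?_⟩
  obtain ⟨ζ₁, hζ₁⟩ := h₁ c hc
  obtain ⟨ζ₂, hζ₂⟩ := h₂ c hc
  have hcne := A.ne_zero c hc
  have hpow : linP c ^ m c ≠ 0 := pow_ne_zero _ (linP_ne_zero hcne)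
  obtain ⟨ζ, hζ⟩ := exists_pow_smul_mul (η₁ := ζ₁) hcne (k := m c) (ζ₁ := 0) (by
    rw [smul_zero]
    apply smul_eq_zero_extF hpow
    rw [← mul_smul_comm, ← hζ₁, dP_mul_dP_mul]) hζ₂
  have hsplit : Qpoly A m = linP c ^ m c * ∏ c' ∈ A.hyps.erase c, linP c' ^ m c' :=
    (Finset.mul_prod_erase _ _ hc).symm
  refine exists_pow_smul_of_smul (prime_linP hcne) (A.not_dvd_prod m hc (Finset.erase_subset _ _)
    (Finset.notMem_erase _ _)) (y := ζ) ?_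
  apply smul_right_inj_extF hpow
  rw [smul_smul, ← hsplit, ← mul_smul_comm, ← hκ, ← mul_assoc, hζ₁, smul_mul_assoc, hζ]

end

theorem IsDer.smul_of_dvd {A A1 : Arrangement K ℓ} {m : (Fin ℓ → K) → ℕ}
    {d : Module.Dual (PS K ℓ) (Fin ℓ → PS K ℓ)} (h : IsDer A1 m d) (f : PS K ℓ)
    (hf : ∀ c ∈ A.hyps, c ∉ A1.hyps → linP c ^ m c ∣ f) : IsDer A m (f • d) := by
  intro c hc
  by_cases h1 : c ∈ A1.hyps
  · exact Dvd.dvd.mul_left (h c h1) _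
  · exact Dvd.dvd.mul_right (hf c hc h1) _

theorem pdLT_Omega (A : Arrangement K ℓ) (m : (Fin ℓ → K) → ℕ) (p : ℕ) :
    PdLT (PS K ℓ) (Omega A m p) (max 1 (ℓ - 1)) := by
  let D : (A.hyps → ExtF K ℓ) →ₗ[PS K ℓ] (A.hyps → ExtF K ℓ) :=
    LinearMap.pi fun c => (linP c.1 ^ m c.1) • LinearMap.proj c
  have hD : Function.Injective D := by
    intro x y h
    ext c
    exact smul_right_inj_extF (pow_ne_zero (m c.1) (linP_ne_zero (A.ne_zero c.1 c.2)))
      (congrFun h c)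
  let ψ : formsP K ℓ p →ₗ[PS K ℓ] ((A.hyps → ExtF K ℓ) ⧸ LinearMap.range D) :=
    (LinearMap.range D).mkQ ∘ₗ (LinearMap.pi fun c => LinearMap.mulLeft (PS K ℓ) (dP c.1)) ∘ₗ
      (formsP K ℓ p).subtype
  have hT : PdLT (PS K ℓ) ((A.hyps → ExtF K ℓ) ⧸ LinearMap.range D) 2 :=
    PdLT.right hD (Submodule.mkQ_surjective _) (LinearMap.exact_map_mkQ_range D)
      (pdLT_one_iff.2 inferInstance) ((pdLT_one_iff.2 inferInstance).mono one_le_two)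
  have hN : PdLT (PS K ℓ) (LinearMap.range ψ) (max 2 ℓ) :=
    PdLT.left (Submodule.injective_subtype (LinearMap.range ψ)) (Submodule.mkQ_surjective _)
      (LinearMap.exact_subtype_mkQ _) (hT.mono (le_max_left _ _))
      ((pdLT_mvPolynomial K ℓ _).mono (by omega))
  have hP := projective_formsP (K := K) (ℓ := ℓ) p
  have hk : PdLT (PS K ℓ) (LinearMap.ker ψ) (max 1 (ℓ - 1)) := by
    have h := PdLT.ker (f := ψ.rangeRestrict) ψ.surjective_rangeRestrict (n := max 1 (ℓ - 1))
      ((pdLT_one_iff.2 hP).mono (le_max_left _ _)) (hN.mono (by omega))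
    rwa [LinearMap.ker_rangeRestrict] at h
  have hmem : ∀ x : formsP K ℓ p, x ∈ LinearMap.ker ψ ↔ IsLog A m x.1 := by
    intro x
    simp only [ψ, LinearMap.mem_ker, LinearMap.comp_apply, Submodule.mkQ_apply,
      Submodule.Quotient.mk_eq_zero, LinearMap.mem_range]
    constructor
    · rintro ⟨y, hy⟩ c hc
      exact ⟨y ⟨c, hc⟩, (congrFun hy ⟨c, hc⟩).symm⟩
    · intro h
      choose y hy using h
      exact ⟨fun c => y c.1 c.2, funext fun c => (hy c.1 c.2).symm⟩
  have he : (LinearMap.ker ψ).map (formsP K ℓ p).subtype = Omega A m p := by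
    ext x
    rw [mem_Omega]
    constructor
    · rintro ⟨y, hy, rfl⟩; exact ⟨y.2, (hmem y).1 hy⟩
    · rintro ⟨h1, h2⟩; exact ⟨⟨x, h1⟩, (hmem ⟨x, h1⟩).2 h2, rfl⟩
  exact hk.of_equiv (((formsP K ℓ p).equivSubtypeMap (LinearMap.ker ψ)).trans
    (LinearEquiv.ofEq _ _ he))

/-! ### Pulling back forms along a linear map -/

section Pullback

variable {n : ℕ}

/-- The pull-back of the linear form `c` along the linear map `e`. -/
def resF (e : (Fin n → K) →ₗ[K] (Fin ℓ → K)) (c : Fin ℓ → K) : Fin n → K :=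
  fun i => ∑ j, c j * e (Pi.single i 1) j

theorem resF_dot (e : (Fin n → K) →ₗ[K] (Fin ℓ → K)) (c : Fin ℓ → K) (x : Fin n → K) :
    ∑ i, resF e c i * x i = ∑ j, c j * e x j := by
  have h : e x = ∑ i, x i • e (Pi.single i 1) := by
    conv_lhs => rw [pi_eq_sum_univ' x]
    simp only [map_sum, map_smul]
  rw [h]
  simp only [resF, Finset.sum_mul, Finset.sum_apply, Finset.mul_sum, Pi.smul_apply, smul_eq_mul]
  rw [Finset.sum_comm]
  exact Finset.sum_congr rfl fun _ _ => Finset.sum_congr rfl fun _ _ => by ring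

theorem ext_dot {c c' : Fin n → K} (h : ∀ x : Fin n → K, ∑ i, c i * x i = ∑ i, c' i * x i) :
    c = c' := by
  ext i
  simpa [Pi.single_apply] using h (Pi.single i 1)

theorem linP_add (c c' : Fin ℓ → K) : linP (c + c') = linP c + linP c' := by
  simp [linP, add_mul, Finset.sum_add_distrib]

theorem cvec_add (c c' : Fin ℓ → K) : cvec (c + c') = cvec c + cvec c' := by
  ext1 i; simp [cvec]

theorem cvec_smul (t : K) (c : Fin ℓ → K) : cvec (t • c) = (C t : PS K ℓ) • cvec c := by
  ext1 i; simp [cvec]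

theorem dP_add (c c' : Fin ℓ → K) : dP (c + c') = dP c + dP c' := by
  rw [dP_eq, cvec_add, map_add]; rfl

theorem dP_smul (t : K) (c : Fin ℓ → K) : dP (t • c) = (C t : PS K ℓ) • dP c := by
  rw [dP_eq, cvec_smul, map_smul]; rfl

theorem linP_single (i : Fin ℓ) : linP (Pi.single i 1 : Fin ℓ → K) = X i := by
  simp [linP, Pi.single_apply]

theorem sum_smul_cvec (v : Fin ℓ → PS K ℓ) : v = ∑ i, v i • cvec (Pi.single i 1) := by
  ext1 j
  simp [cvec, Pi.single_apply, Finset.sum_apply]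

variable [Algebra (PS K ℓ) (PS K n)]

/-- The algebra structure is the pull-back of polynomial functions along `e`. -/
structure IsPull (e : (Fin n → K) →ₗ[K] (Fin ℓ → K)) : Prop where
  algC : ∀ a : K, algebraMap (PS K ℓ) (PS K n) (C a) = C a
  algX : ∀ i, algebraMap (PS K ℓ) (PS K n) (X i) = linP (resF e (Pi.single i 1))

/-- The pull-back of polynomial one-forms along `e`. -/
def pullOne (e : (Fin n → K) →ₗ[K] (Fin ℓ → K)) : (Fin ℓ → PS K ℓ) →ₗ[PS K ℓ] ExtF K n :=
  ((ExteriorAlgebra.ι (PS K n)).restrictScalars (PS K ℓ)) ∘ₗ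
    ∑ i, (LinearMap.toSpanSingleton (PS K ℓ) (Fin n → PS K n)
      (cvec (resF e (Pi.single i 1)))) ∘ₗ LinearMap.proj i

theorem pullOne_apply (e : (Fin n → K) →ₗ[K] (Fin ℓ → K)) (v : Fin ℓ → PS K ℓ) :
    pullOne e v = ExteriorAlgebra.ι (PS K n) (∑ i, v i • cvec (resF e (Pi.single i 1))) := by
  simp only [pullOne, LinearMap.comp_apply, LinearMap.restrictScalars_apply, LinearMap.sum_apply]
  rfl

/-- The pull-back of polynomial differential forms along `e`. -/
def pullF (e : (Fin n → K) →ₗ[K] (Fin ℓ → K)) : ExtF K ℓ →ₐ[PS K ℓ] ExtF K n :=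
  ExteriorAlgebra.lift (PS K ℓ) ⟨pullOne e, fun v => by
    rw [pullOne_apply]; exact ExteriorAlgebra.ι_sq_zero _⟩

theorem pullF_ι (e : (Fin n → K) →ₗ[K] (Fin ℓ → K)) (v : Fin ℓ → PS K ℓ) :
    pullF e (ExteriorAlgebra.ι (PS K ℓ) v) =
      ExteriorAlgebra.ι (PS K n) (∑ i, v i • cvec (resF e (Pi.single i 1))) := by
  rw [pullF, ExteriorAlgebra.lift_ι_apply, pullOne_apply]

variable {e : (Fin n → K) →ₗ[K] (Fin ℓ → K)}

theorem IsPull.linP (h : IsPull e) (c : Fin ℓ → K) :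
    algebraMap (PS K ℓ) (PS K n) (linP c) = linP (resF e c) := by
  simp only [_root_.linP, map_sum, map_mul, h.algC, h.algX, Finset.mul_sum]
  rw [Finset.sum_comm]
  refine Finset.sum_congr rfl fun j _ => ?_
  simp only [← mul_assoc, ← Finset.sum_mul, ← map_mul, ← map_sum]
  congr 2
  simp [resF, Pi.single_apply]

theorem IsPull.dP (h : IsPull e) (c : Fin ℓ → K) : pullF e (dP c) = dP (resF e c) := by
  rw [dP_eq, pullF_ι, dP_eq]
  congr 1
  ext1 j
  rw [Finset.sum_apply]
  have : ∀ i, (cvec c i • cvec (resF e (Pi.single i 1))) j =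
      C (c i * resF e (Pi.single i 1) j) := fun i => by
    rw [Pi.smul_apply, Algebra.smul_def]
    simp only [cvec, h.algC, map_mul]
  rw [Finset.sum_congr rfl fun i _ => this i]
  simp only [← map_sum, cvec]
  congr 1
  simp [resF, Pi.single_apply]

theorem pullF_mem_formsP (e : (Fin n → K) →ₗ[K] (Fin ℓ → K)) (p : ℕ) :
    ∀ x ∈ formsP K ℓ p, pullF e x ∈ formsP K n p := by
  induction p with
  | zero =>
    intro x hx
    obtain ⟨s, rfl⟩ := mem_formsP_zero.1 hx
    rw [mem_formsP_zero]
    exact ⟨algebraMap _ _ s, by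
      rw [AlgHom.commutes, ← IsScalarTower.algebraMap_apply]⟩
  | succ p ih =>
    intro x hx
    rw [formsP, pow_succ'] at hx
    induction hx using Submodule.mul_induction_on' with
    | mem_mul_mem a ha b hb =>
      obtain ⟨v, rfl⟩ := ha
      rw [map_mul, pullF_ι]
      exact ι_mul_mem_formsP _ (ih _ hb)
    | add a _ b _ ha hb => rw [map_add]; exact Submodule.add_mem _ ha hb

end Pullback

/-- The forms `α y + dα ∧ z`, the kernel of the restriction to the hyperplane of `c0`. -/
def kerForms (c0 : Fin ℓ → K) : Submodule (PS K ℓ) (ExtF K ℓ) :=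
  LinearMap.range (LinearMap.lsmul (PS K ℓ) (ExtF K ℓ) (linP c0)) ⊔
    LinearMap.range (LinearMap.mulLeft (PS K ℓ) (dP c0))

theorem mem_kerForms {c0 : Fin ℓ → K} {x : ExtF K ℓ} :
    x ∈ kerForms c0 ↔ ∃ y z, x = linP c0 • y + dP c0 * z := by
  simp only [kerForms, Submodule.mem_sup, LinearMap.mem_range, LinearMap.lsmul_apply,
    LinearMap.mulLeft_apply]
  constructor
  · rintro ⟨_, ⟨y, rfl⟩, _, ⟨z, rfl⟩, rfl⟩; exact ⟨y, z, rfl⟩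
  · rintro ⟨y, z, rfl⟩; exact ⟨_, ⟨y, rfl⟩, _, ⟨z, rfl⟩, rfl⟩

theorem mul_mem_kerForms {c0 : Fin ℓ → K} (a : ExtF K ℓ) {x : ExtF K ℓ} (hx : x ∈ kerForms c0) :
    a * x ∈ kerForms c0 := by
  obtain ⟨y, z, rfl⟩ := mem_kerForms.1 hx
  refine mem_kerForms.2 ⟨a * y, extInv a * z, ?_⟩
  rw [mul_add, mul_smul_comm, dP_eq, mul_ι_mul]

theorem kerForms_mul_mem {c0 : Fin ℓ → K} (a : ExtF K ℓ) {x : ExtF K ℓ} (hx : x ∈ kerForms c0) :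
    x * a ∈ kerForms c0 := by
  obtain ⟨y, z, rfl⟩ := mem_kerForms.1 hx
  exact mem_kerForms.2 ⟨y * a, z * a, by rw [add_mul, smul_mul_assoc, mul_assoc]⟩

theorem eq_resF_add {n : ℕ} {c0 : Fin ℓ → K} {e : (Fin n → K) →ₗ[K] (Fin ℓ → K)} {w : Fin ℓ → K}
    {r : (Fin ℓ → K) →ₗ[K] (Fin n → K)} (her : ∀ x, e (r x) = x - (∑ i, c0 i * x i) • w)
    (c : Fin ℓ → K) : c = resF r (resF e c) + (∑ i, c i * w i) • c0 := by
  refine ext_dot fun x => ?_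
  have h1 : ∑ i, resF r (resF e c) i * x i = ∑ i, c i * e (r x) i := by
    rw [resF_dot, resF_dot]
  simp only [Pi.add_apply, add_mul, Finset.sum_add_distrib, h1, her]
  simp only [Pi.sub_apply, Pi.smul_apply, smul_eq_mul, mul_sub, Finset.sum_sub_distrib]
  have h2 : ∑ i, c i * ((∑ j, c0 j * x j) * w i) = ∑ i, (∑ j, c j * w j) * c0 i * x i := by
    simp only [Finset.mul_sum, Finset.sum_mul]
    rw [Finset.sum_comm]
    exact Finset.sum_congr rfl fun _ _ => Finset.sum_congr rfl fun _ _ => by ring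
  rw [h2]; ring

section Restriction

variable {n : ℕ} [Algebra (PS K ℓ) (PS K n)]

/-- The algebra structure is the restriction of polynomial functions to the hyperplane of `c0`,
parametrized by `e`. -/
structure IsRes (c0 : Fin ℓ → K) (e : (Fin n → K) →ₗ[K] (Fin ℓ → K)) : Prop
    extends IsPull e where
  inj : Function.Injective e
  range : LinearMap.range e = LinearMap.ker (dotLin c0)
  ne_zero : c0 ≠ 0

variable {c0 : Fin ℓ → K} {e : (Fin n → K) →ₗ[K] (Fin ℓ → K)}

theorem IsRes.dot (h : IsRes c0 e) (x : Fin n → K) : ∑ i, c0 i * e x i = 0 := by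
  have : e x ∈ LinearMap.ker (dotLin c0) := h.range ▸ ⟨x, rfl⟩
  simpa [dotLin_apply] using this

theorem IsRes.exists_section (h : IsRes c0 e) : ∃ (w : Fin ℓ → K)
    (r : (Fin ℓ → K) →ₗ[K] (Fin n → K)), ∑ i, c0 i * w i = 1 ∧ (∀ y, r (e y) = y) ∧
    ∀ x, e (r x) = x - (∑ i, c0 i * x i) • w := by
  obtain ⟨w, hw⟩ := exists_dual_vec h.ne_zero
  let P : (Fin ℓ → K) →ₗ[K] (Fin ℓ → K) := LinearMap.id - (dotLin c0).smulRight w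
  have hP : ∀ x, P x ∈ LinearMap.range e := by
    intro x
    rw [h.range, LinearMap.mem_ker]
    have : dotLin c0 w = 1 := by rw [dotLin_apply, hw]
    simp [P, this]
  let r : (Fin ℓ → K) →ₗ[K] (Fin n → K) :=
    (LinearEquiv.ofInjective e h.inj).symm.toLinearMap ∘ₗ P.codRestrict _ hP
  have hr : ∀ x, e (r x) = x - (∑ i, c0 i * x i) • w := by
    intro x
    have := congrArg Subtype.val
      ((LinearEquiv.ofInjective e h.inj).apply_symm_apply ⟨P x, hP x⟩)
    rw [LinearEquiv.ofInjective_apply] at this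
    rw [← dotLin_apply]
    exact this
  refine ⟨w, r, hw, fun y => h.inj ?_, hr⟩
  rw [hr, h.dot, zero_smul, sub_zero]

theorem IsRes.resF_self (h : IsRes c0 e) : resF e c0 = 0 :=
  ext_dot fun x => by rw [resF_dot, h.dot]; simp

theorem IsRes.resF_eq_zero (h : IsRes c0 e) {c : Fin ℓ → K} (hc : resF e c = 0) :
    ∃ t : K, c = t • c0 := by
  obtain ⟨w, r, hw, hr, her⟩ := h.exists_section
  refine ⟨∑ i, c i * w i, ?_⟩
  conv_lhs => rw [eq_resF_add her c, hc]
  have : resF r 0 = 0 := by ext i; simp [resF]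
  rw [this, zero_add]

theorem IsRes.resF_surjective (h : IsRes c0 e) (c' : Fin n → K) : ∃ c, resF e c = c' := by
  obtain ⟨w, r, hw, hr, her⟩ := h.exists_section
  refine ⟨resF r c', ext_dot fun x => ?_⟩
  rw [resF_dot, resF_dot, hr]

theorem IsRes.alg_self (h : IsRes c0 e) : algebraMap (PS K ℓ) (PS K n) (linP c0) = 0 := by
  rw [h.linP, h.resF_self]; simp [linP]

theorem IsRes.pull_self (h : IsRes c0 e) : pullF e (dP c0) = 0 := by
  rw [h.dP, h.resF_self, dP_eq]
  have : cvec (0 : Fin n → K) = 0 := by ext1 i; simp [cvec]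
  rw [this, map_zero]

theorem IsRes.alg_surjective (h : IsRes c0 e) :
    Function.Surjective (algebraMap (PS K ℓ) (PS K n)) := by
  intro f
  induction f using MvPolynomial.induction_on with
  | C a => exact ⟨C a, h.algC a⟩
  | add f g hf hg =>
    obtain ⟨a, rfl⟩ := hf; obtain ⟨b, rfl⟩ := hg
    exact ⟨a + b, map_add _ _ _⟩
  | mul_X f i hf =>
    obtain ⟨a, rfl⟩ := hf
    obtain ⟨c, hc⟩ := h.resF_surjective (Pi.single i 1)
    exact ⟨a * linP c, by rw [map_mul, h.linP, hc, linP_single]⟩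

theorem sub_section_mem [Algebra (PS K n) (PS K ℓ)] (h : IsRes c0 e) {w : Fin ℓ → K}
    {r : (Fin ℓ → K) →ₗ[K] (Fin n → K)} (her : ∀ x, e (r x) = x - (∑ i, c0 i * x i) • w)
    (hpr : IsPull r) (f : PS K ℓ) :
    f - algebraMap (PS K n) (PS K ℓ) (algebraMap (PS K ℓ) (PS K n) f) ∈
      Ideal.span {linP c0} := by
  induction f using MvPolynomial.induction_on with
  | C a => rw [h.algC, hpr.algC, sub_self]; exact Submodule.zero_mem _
  | add f g hf hg =>
    rw [map_add, map_add, add_sub_add_comm]; exact Ideal.add_mem _ hf hg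
  | mul_X f i hf =>
    have hX : (X i : PS K ℓ) - algebraMap (PS K n) (PS K ℓ)
        (algebraMap (PS K ℓ) (PS K n) (X i)) ∈ Ideal.span {linP c0} := by
      have := congrArg linP (eq_resF_add her (Pi.single i 1))
      rw [linP_add, linP_smul, linP_single] at this
      rw [h.algX, hpr.linP]
      rw [sub_eq_of_eq_add' this]
      exact Ideal.mul_mem_left _ _ (Ideal.mem_span_singleton_self _)
    have := Ideal.add_mem _ (Ideal.mul_mem_right (X i) _ hf) (Ideal.mul_mem_left _
      (algebraMap (PS K n) (PS K ℓ) (algebraMap (PS K ℓ) (PS K n) f)) hX)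
    convert this using 1
    rw [map_mul, map_mul]; ring

theorem IsRes.exists_algebra_section (h : IsRes c0 e) : ∃ (_ : Algebra (PS K n) (PS K ℓ))
    (w : Fin ℓ → K) (r : (Fin ℓ → K) →ₗ[K] (Fin n → K)), IsPull r ∧
    ∀ x, e (r x) = x - (∑ i, c0 i * x i) • w := by
  obtain ⟨w, r, -, -, her⟩ := h.exists_section
  let σ : PS K n →ₐ[K] PS K ℓ := aeval fun j => _root_.linP (resF r (Pi.single j 1))
  exact ⟨σ.toRingHom.toAlgebra, w, r,
    letI := σ.toRingHom.toAlgebra; ⟨fun a => σ.commutes a, fun i => aeval_X _ i⟩, her⟩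

theorem IsRes.ker (h : IsRes c0 e) :
    RingHom.ker (algebraMap (PS K ℓ) (PS K n)) = Ideal.span {_root_.linP c0} := by
  obtain ⟨_, w, r, hpr, her⟩ := h.exists_algebra_section
  apply le_antisymm
  · intro f hf
    have := sub_section_mem h her hpr f
    rwa [(RingHom.mem_ker).1 hf, map_zero, sub_zero] at this
  · rw [Ideal.span_singleton_le_iff_mem, RingHom.mem_ker, h.alg_self]

theorem IsRes.pullF_eq_zero_iff (h : IsRes c0 e) {x : ExtF K ℓ} :
    pullF e x = 0 ↔ x ∈ kerForms c0 := by
  constructor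
  · intro hx
    obtain ⟨_, w, r, hpr, her⟩ := h.exists_algebra_section
    have hsmul : ∀ (a : PS K ℓ) (y : ExtF K ℓ), pullF r (pullF e (a • y)) =
        algebraMap (PS K n) (PS K ℓ) (algebraMap (PS K ℓ) (PS K n) a) •
          pullF r (pullF e y) := by
      intro a y
      rw [map_smul, ← algebraMap_smul (PS K n) a, map_smul, ← algebraMap_smul (PS K ℓ)]
    have hα : ∀ (a : PS K ℓ) (y : ExtF K ℓ), y - pullF r (pullF e y) ∈ kerForms c0 →
        a • y - pullF r (pullF e (a • y)) ∈ kerForms c0 := by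
      intro a y hy
      obtain ⟨b, hb⟩ := Ideal.mem_span_singleton.1 (sub_section_mem h her hpr a)
      rw [hsmul, show a • y - algebraMap (PS K n) (PS K ℓ) (algebraMap (PS K ℓ) (PS K n) a) •
          pullF r (pullF e y) = a • (y - pullF r (pullF e y)) +
          (a - algebraMap (PS K n) (PS K ℓ) (algebraMap (PS K ℓ) (PS K n) a)) •
          pullF r (pullF e y) by rw [smul_sub, sub_smul]; abel, hb, mul_smul]
      exact Submodule.add_mem _ (Submodule.smul_mem _ _ hy)
        (mem_kerForms.2 ⟨_, 0, by rw [mul_zero, add_zero]⟩)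
    have hι : ∀ v, ExteriorAlgebra.ι (PS K ℓ) v -
        pullF r (pullF e (ExteriorAlgebra.ι (PS K ℓ) v)) ∈ kerForms c0 := by
      intro v
      rw [sum_smul_cvec v]
      simp only [map_sum]
      rw [← Finset.sum_sub_distrib]
      refine Submodule.sum_mem _ fun i _ => ?_
      rw [map_smul]
      refine hα _ _ ?_
      rw [← dP_eq, h.dP, hpr.dP]
      have := congrArg dP (eq_resF_add her (Pi.single i 1))
      rw [dP_add, dP_smul] at this
      refine mem_kerForms.2 ⟨0, algebraMap (PS K ℓ) _ (C (∑ j, (Pi.single i 1 : Fin ℓ → K) j * w j)), ?_⟩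
      rw [smul_zero, zero_add, ← Algebra.commutes, ← Algebra.smul_def]
      exact sub_eq_of_eq_add' this
    have key : ∀ y : ExtF K ℓ, y - pullF r (pullF e y) ∈ kerForms c0 := by
      intro y
      induction y using CliffordAlgebra.left_induction with
      | algebraMap a =>
        rw [Algebra.algebraMap_eq_smul_one]
        refine hα _ _ ?_
        rw [map_one, map_one, sub_self]; exact Submodule.zero_mem _
      | add x y hx hy =>
        rw [map_add, map_add, add_sub_add_comm]; exact Submodule.add_mem _ hx hy
      | ι_mul x v hx =>
        rw [map_mul, map_mul]
        have := Submodule.add_mem _ (kerForms_mul_mem x (hι v))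
          (mul_mem_kerForms (pullF r (pullF e (ExteriorAlgebra.ι (PS K ℓ) v))) hx)
        convert this using 1
        rw [sub_mul, mul_sub]
        change ExteriorAlgebra.ι (PS K ℓ) v * x - _ = _
        abel
    have := key x
    rwa [hx, map_zero, sub_zero] at this
  · intro hx
    obtain ⟨y, z, rfl⟩ := mem_kerForms.1 hx
    rw [map_add, map_mul, h.pull_self, zero_mul, add_zero, map_smul, ← algebraMap_smul (PS K n),
      h.alg_self, zero_smul]

end Restriction

/-! ### Residues along a hyperplane -/

/-- A constant functional taking the value `1` on `dα`. -/
def nrm (c0 : Fin ℓ → K) : Module.Dual (PS K ℓ) (Fin ℓ → PS K ℓ) :=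
  if h : ∃ w : Fin ℓ → K, ∑ i, c0 i * w i = 1 then constFun h.choose else 0

theorem nrm_self {c0 : Fin ℓ → K} (hc : c0 ≠ 0) : nrm c0 (cvec c0) = 1 := by
  have h := exists_dual_vec hc
  rw [nrm, dif_pos h, constFun_cvec, h.choose_spec, map_one]

omit [Field K] in
theorem mdel_self (m : (Fin ℓ → K) → ℕ) (c0 : Fin ℓ → K) : mdel m c0 c0 = m c0 - 1 := by
  simp [mdel]

omit [Field K] in
theorem mdel_of_ne (m : (Fin ℓ → K) → ℕ) {c c0 : Fin ℓ → K} (h : c ≠ c0) :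
    mdel m c0 c = m c := by
  simp [mdel, h]

omit [Field K] in
theorem mdel_le (m : (Fin ℓ → K) → ℕ) (c c0 : Fin ℓ → K) : mdel m c0 c ≤ m c := by
  rw [mdel]; split_ifs <;> omega

theorem Qpoly_mdel {A : Arrangement K ℓ} (m : (Fin ℓ → K) → ℕ) {c0 : Fin ℓ → K}
    (hc0 : c0 ∈ A.hyps) :
    Qpoly A (mdel m c0) = linP c0 ^ (m c0 - 1) * Qpoly (delArr A c0) m := by
  rw [Qpoly, ← Finset.mul_prod_erase _ _ hc0, mdel_self]
  congr 1
  exact Finset.prod_congr rfl fun c hc => by rw [mdel_of_ne _ (Finset.ne_of_mem_erase hc)]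

theorem not_dvd_Qpoly_delArr {A : Arrangement K ℓ} (m : (Fin ℓ → K) → ℕ) {c0 : Fin ℓ → K}
    (hc0 : c0 ∈ A.hyps) : ¬ linP c0 ∣ Qpoly (delArr A c0) m :=
  A.not_dvd_prod m hc0 (Finset.erase_subset _ _) (Finset.notMem_erase _ _)

theorem eq_dP_mul_ctr {c0 : Fin ℓ → K} (hc : c0 ≠ 0) {θ : ExtF K ℓ} (h : dP c0 * θ = 0) :
    θ = dP c0 * ctr (nrm c0) θ := by
  have := eq_of_dP_mul (nrm_self hc) (a := 0) (ζ := 0) (η := θ) (by rw [h, zero_smul])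
  rwa [zero_smul, add_zero] at this

section Residue

variable {n : ℕ} [Algebra (PS K ℓ) (PS K n)]

/-- Contraction followed by restriction to the hyperplane. -/
def resid (c0 : Fin ℓ → K) (e : (Fin n → K) →ₗ[K] (Fin ℓ → K)) :
    ExtF K ℓ →ₗ[PS K ℓ] ExtF K n :=
  (pullF e).toLinearMap ∘ₗ ctr (nrm c0)

theorem resid_apply (c0 : Fin ℓ → K) (e : (Fin n → K) →ₗ[K] (Fin ℓ → K)) (x : ExtF K ℓ) :
    resid c0 e x = pullF e (ctr (nrm c0) x) := rfl

theorem resid_mem_formsP (c0 : Fin ℓ → K) (e : (Fin n → K) →ₗ[K] (Fin ℓ → K)) {p : ℕ}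
    {x : ExtF K ℓ} (hx : x ∈ formsP K ℓ (p + 1)) : resid c0 e x ∈ formsP K n p :=
  pullF_mem_formsP e p _ (ctr_mem_formsP _ hx)

/-- The image of `Ω^p(A,m)` under the residue map. -/
def Jmod (A : Arrangement K ℓ) (m : (Fin ℓ → K) → ℕ) (c0 : Fin ℓ → K)
    (e : (Fin n → K) →ₗ[K] (Fin ℓ → K)) (p : ℕ) : Submodule (PS K ℓ) (ExtF K n) :=
  (Omega A m p).map (resid c0 e)

/-- The image of `Ω^p(A,m-δ_H)` under the normalized residue map. -/
def Imod (A : Arrangement K ℓ) (m : (Fin ℓ → K) → ℕ) (c0 : Fin ℓ → K)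
    (e : (Fin n → K) →ₗ[K] (Fin ℓ → K)) (p : ℕ) : Submodule (PS K ℓ) (ExtF K n) where
  carrier := {x | ∃ η ∈ Omega A (mdel m c0) p, ∃ θ, dP c0 * η = linP c0 ^ (m c0 - 1) • θ ∧
    x = resid c0 e θ}
  add_mem' := by
    rintro _ _ ⟨η₁, h₁, θ₁, e₁, rfl⟩ ⟨η₂, h₂, θ₂, e₂, rfl⟩
    exact ⟨η₁ + η₂, add_mem h₁ h₂, θ₁ + θ₂, by rw [mul_add, e₁, e₂, smul_add],
      (map_add _ _ _).symm⟩
  zero_mem' := ⟨0, zero_mem _, 0, by simp, (map_zero _).symm⟩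
  smul_mem' := by
    rintro a _ ⟨η₁, h₁, θ₁, e₁, rfl⟩
    exact ⟨a • η₁, Submodule.smul_mem _ _ h₁, a • θ₁, by rw [mul_smul_comm, e₁, smul_comm],
      (map_smul _ _ _).symm⟩

theorem mem_Jmod {A : Arrangement K ℓ} {m : (Fin ℓ → K) → ℕ} {c0 : Fin ℓ → K}
    {e : (Fin n → K) →ₗ[K] (Fin ℓ → K)} {p : ℕ} {x : ExtF K n} :
    x ∈ Jmod A m c0 e p ↔ ∃ θ ∈ Omega A m p, x = resid c0 e θ := by
  simp only [Jmod, Submodule.mem_map, eq_comm]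

theorem mem_Imod {A : Arrangement K ℓ} {m : (Fin ℓ → K) → ℕ} {c0 : Fin ℓ → K}
    {e : (Fin n → K) →ₗ[K] (Fin ℓ → K)} {p : ℕ} {x : ExtF K n} :
    x ∈ Imod A m c0 e p ↔ ∃ η ∈ Omega A (mdel m c0) p, ∃ θ,
      dP c0 * η = linP c0 ^ (m c0 - 1) • θ ∧ x = resid c0 e θ := Iff.rfl

variable {c0 : Fin ℓ → K} {e : (Fin n → K) →ₗ[K] (Fin ℓ → K)}

theorem IsRes.smul_resid (h : IsRes c0 e) (x : ExtF K n) : linP c0 • x = 0 := by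
  rw [← algebraMap_smul (PS K n), h.alg_self, zero_smul]

theorem IsRes.smul_mem (h : IsRes c0 e) (N : Submodule (PS K ℓ) (ExtF K n)) (a : PS K n)
    {x : ExtF K n} (hx : x ∈ N) : a • x ∈ N := by
  obtain ⟨s, rfl⟩ := h.alg_surjective a
  rw [algebraMap_smul]; exact N.smul_mem s hx

theorem IsRes.resid_dP_mul (h : IsRes c0 e) (x : ExtF K ℓ) :
    resid c0 e (dP c0 * x) = pullF e x := by
  have := ctr_ι_mul (nrm c0) (cvec c0) x
  rw [← dP_eq, nrm_self h.ne_zero, one_smul] at this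
  rw [resid_apply, this, map_sub, map_mul, h.pull_self, zero_mul, sub_zero]

section

variable {A A1 : Arrangement K ℓ} {m : (Fin ℓ → K) → ℕ} {p q : ℕ}

theorem Imod_le_formsP (hc0 : c0 ∈ A.hyps) : ∀ x ∈ Imod A m c0 e p, x ∈ formsP K n p := by
  rintro _ ⟨η, hη, θ, hθ, rfl⟩
  apply resid_mem_formsP
  apply mem_formsP_of_smul (pow_ne_zero (m c0 - 1) (linP_ne_zero (A.ne_zero c0 hc0)))
  rw [← hθ]; exact ι_mul_mem_formsP _ (mem_Omega.1 hη).1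

theorem IsLog.of_mdel {κ : ExtF K ℓ} (hκ : IsLog A (mdel m c0) κ)
    (h0 : ∃ ζ, dP c0 * κ = linP c0 ^ m c0 • ζ) : IsLog A m κ := by
  intro c hc
  by_cases hcc : c = c0
  · subst hcc; exact h0
  · obtain ⟨ζ, hζ⟩ := hκ c hc
    rw [mdel_of_ne _ hcc] at hζ
    exact ⟨ζ, hζ⟩

theorem Omega_le_mdel : Omega A m p ≤ Omega A (mdel m c0) p := by
  intro x hx
  rw [mem_Omega] at *
  exact ⟨hx.1, hx.2.mono subset_rfl fun c _ => mdel_le m c c0⟩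

theorem smul_mem_Omega (hc0 : 1 ≤ m c0) {x : ExtF K ℓ} (hx : x ∈ Omega A (mdel m c0) p) :
    linP c0 • x ∈ Omega A m p := by
  rw [mem_Omega] at *
  refine ⟨Submodule.smul_mem _ _ hx.1, hx.2.smul_of_dvd _ fun c hc => ⟨fun h => absurd hc h,
    fun _ => ?_⟩⟩
  by_cases hcc : c = c0
  · subst hcc
    rw [mdel_self, ← pow_succ', Nat.sub_add_cancel hc0]
  · rw [mdel_of_ne _ hcc]; exact Dvd.intro_left _ rfl

theorem IsRes.resid_eq_zero_iff (h : IsRes c0 e) (hc0 : c0 ∈ A.hyps) (hm : 1 ≤ m c0)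
    {θ : ExtF K ℓ} (hθ : θ ∈ Omega A m p) :
    resid c0 e θ = 0 ↔ ∃ κ ∈ Omega A (mdel m c0) p, θ = linP c0 • κ := by
  have hα := linP_ne_zero (A.ne_zero c0 hc0)
  constructor
  · intro h0
    rw [resid_apply, h.pullF_eq_zero_iff, mem_kerForms] at h0
    obtain ⟨y, z, hyz⟩ := h0
    obtain ⟨hf, hl⟩ := mem_Omega.1 hθ
    obtain ⟨ζ, hζ⟩ := hl c0 hc0
    have hμ : linP c0 ^ m c0 = linP c0 * linP c0 ^ (m c0 - 1) := by
      rw [← pow_succ', Nat.sub_add_cancel hm]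
    have h1 : θ = linP c0 • (dP c0 * y + linP c0 ^ (m c0 - 1) • ctr (nrm c0) ζ) := by
      conv_lhs => rw [eq_of_dP_mul (nrm_self h.ne_zero) hζ]
      rw [hyz, mul_add, dP_mul_dP_mul, add_zero, mul_smul_comm, smul_add, smul_smul, ← hμ]
    refine ⟨_, mem_Omega.2 ⟨mem_formsP_of_smul hα (h1 ▸ hf), fun c hc => ?_⟩, h1⟩
    by_cases hcc : c = c0
    · subst hcc
      rw [mdel_self]
      refine ⟨ζ, smul_right_inj_extF hα ?_⟩
      rw [← mul_smul_comm, ← h1, hζ, smul_smul, hμ]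
    · rw [mdel_of_ne _ hcc]
      obtain ⟨ξ, hξ⟩ := hl c hc
      refine exists_pow_smul_of_smul (prime_linP (A.ne_zero c hc)) (A.not_dvd hc hc0 hcc)
        (y := ξ) ?_
      rw [← mul_smul_comm, ← h1, hξ]
  · rintro ⟨κ, -, rfl⟩
    rw [map_smul, h.smul_resid]

theorem dP_mul_eq_zero (hc0 : c0 ∈ A.hyps) {k : ℕ} {η θ : ExtF K ℓ}
    (hθ : dP c0 * η = linP c0 ^ k • θ) : dP c0 * θ = 0 := by
  apply smul_eq_zero_extF (pow_ne_zero k (linP_ne_zero (A.ne_zero c0 hc0)))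
  rw [← mul_smul_comm, ← hθ, dP_mul_dP_mul]

theorem IsRes.resid_eq_zero_iff' (h : IsRes c0 e) (hc0 : c0 ∈ A.hyps) (hm : 1 ≤ m c0)
    {η θ : ExtF K ℓ} (hη : η ∈ Omega A (mdel m c0) p)
    (hθ : dP c0 * η = linP c0 ^ (m c0 - 1) • θ) :
    resid c0 e θ = 0 ↔ η ∈ Omega A m p := by
  have hα := linP_ne_zero (A.ne_zero c0 hc0)
  have hμ : linP c0 ^ m c0 = linP c0 ^ (m c0 - 1) * linP c0 := by
    rw [← pow_succ, Nat.sub_add_cancel hm]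
  constructor
  · intro h0
    rw [resid_apply, h.pullF_eq_zero_iff, mem_kerForms] at h0
    obtain ⟨y, z, hyz⟩ := h0
    rw [mem_Omega] at *
    refine ⟨hη.1, hη.2.of_mdel ⟨dP c0 * y, ?_⟩⟩
    rw [hθ, eq_dP_mul_ctr h.ne_zero (dP_mul_eq_zero hc0 hθ), hyz, mul_add, dP_mul_dP_mul,
      add_zero, mul_smul_comm, smul_smul, hμ]
  · intro hη'
    obtain ⟨ζ, hζ⟩ := (mem_Omega.1 hη').2 c0 hc0
    have : θ = linP c0 • ζ := by
      apply smul_right_inj_extF (pow_ne_zero (m c0 - 1) hα)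
      rw [← hθ, hζ, smul_smul, hμ]
    rw [this, map_smul, h.smul_resid]

theorem IsRes.mul_mem_Imod (h : IsRes c0 e) (hc0 : c0 ∈ A.hyps) {x₁ x₂ : ExtF K n}
    (h₁ : x₁ ∈ Imod A m c0 e p) (h₂ : x₂ ∈ Imod A m c0 e q) :
    ∃ y ∈ Imod A m c0 e (p + q), x₁ * x₂ = Qpoly (delArr A c0) m • y := by
  have hα : linP c0 ^ (m c0 - 1) ≠ 0 := pow_ne_zero _ (linP_ne_zero (A.ne_zero c0 hc0))
  obtain ⟨η₁, hη₁, θ₁, hθ₁, rfl⟩ := h₁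
  obtain ⟨η₂, hη₂, θ₂, hθ₂, rfl⟩ := h₂
  rw [mem_Omega] at hη₁ hη₂
  obtain ⟨κ, hκ, hlog⟩ := hη₁.2.exists_mul hη₂.2
  have hdeg : κ ∈ formsP K ℓ (p + q) := by
    apply mem_formsP_of_smul (Qpoly_ne_zero A (mdel m c0))
    rw [← hκ]; exact mul_mem_formsP hη₁.1 hη₂.1
  obtain ⟨θ, hθ⟩ := hlog c0 hc0
  rw [mdel_self] at hθ
  refine ⟨_, ⟨κ, mem_Omega.2 ⟨hdeg, hlog⟩, θ, hθ, rfl⟩, ?_⟩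
  set a₁ := ctr (nrm c0) θ₁ with ha₁
  set a₂ := ctr (nrm c0) θ₂ with ha₂
  have e₁ : θ₁ = dP c0 * a₁ := eq_dP_mul_ctr h.ne_zero (dP_mul_eq_zero hc0 hθ₁)
  have e₂ : θ₂ = dP c0 * a₂ := eq_dP_mul_ctr h.ne_zero (dP_mul_eq_zero hc0 hθ₂)
  have key : Qpoly (delArr A c0) m • θ = dP c0 * (a₁ * a₂) := by
    apply smul_right_inj_extF hα
    apply smul_right_inj_extF hα
    have i1 : dP c0 * (a₁ * η₂) = linP c0 ^ (m c0 - 1) • (dP c0 * (a₁ * a₂)) := by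
      have hx := mul_ι_mul (cvec c0) (extInv a₁) η₂
      have hy := mul_ι_mul (cvec c0) (extInv a₁) a₂
      rw [extInv_extInv, ← dP_eq] at hx hy
      rw [← hx, hθ₂, e₂, mul_smul_comm, hy]
    rw [← i1, ← mul_assoc (dP c0), ← e₁, ← smul_mul_assoc, ← hθ₁, mul_assoc, hκ,
      Qpoly_mdel m hc0, mul_smul_comm, hθ, smul_smul, smul_smul, smul_smul]
    congr 1; ring
  rw [← map_smul, key, h.resid_dP_mul, map_mul, resid_apply, resid_apply]

end

end Residue

section ResidueIdeals

variable {n : ℕ} [Algebra (PS K ℓ) (PS K n)]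

/-- The ideal of coefficients of residues of logarithmic one-forms. -/
def idJ (A : Arrangement K ℓ) (m : (Fin ℓ → K) → ℕ) (c0 : Fin ℓ → K) (n : ℕ)
    [Algebra (PS K ℓ) (PS K n)] : Ideal (PS K n) :=
  Ideal.map (algebraMap (PS K ℓ) (PS K n))
    (((Omega A m 1).map (ctr (nrm c0))).comap (Algebra.linearMap (PS K ℓ) (ExtF K ℓ)))

/-- The ideal of normalized values on `α_H` of the derivations tangent to `(A,m-δ_H)`. -/
def idB (A : Arrangement K ℓ) (m : (Fin ℓ → K) → ℕ) (c0 : Fin ℓ → K) (n : ℕ)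
    [Algebra (PS K ℓ) (PS K n)] : Ideal (PS K n) :=
  Ideal.map (algebraMap (PS K ℓ) (PS K n))
    { carrier := {t | ∃ d, IsDer A (mdel m c0) d ∧ d (cvec c0) = linP c0 ^ (m c0 - 1) * t}
      add_mem' := by
        rintro _ _ ⟨d₁, h₁, e₁⟩ ⟨d₂, h₂, e₂⟩
        exact ⟨d₁ + d₂, fun c hc => by
          rw [LinearMap.add_apply]; exact dvd_add (h₁ c hc) (h₂ c hc),
          by rw [LinearMap.add_apply, e₁, e₂, mul_add]⟩
      zero_mem' := ⟨0, fun c _ => dvd_zero _, by simp⟩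
      smul_mem' := by
        rintro a _ ⟨d₁, h₁, e₁⟩
        exact ⟨a • d₁, fun c hc => by
          rw [LinearMap.smul_apply]; exact Dvd.dvd.mul_left (h₁ c hc) _,
          by rw [LinearMap.smul_apply, e₁, smul_eq_mul, smul_eq_mul]; ring⟩ }

variable {A A1 : Arrangement K ℓ} {m : (Fin ℓ → K) → ℕ} {c0 : Fin ℓ → K}
  {e : (Fin n → K) →ₗ[K] (Fin ℓ → K)} {p : ℕ}

theorem IsRes.mem_idJ (h : IsRes c0 e) {g : PS K n} :
    g ∈ idJ A m c0 n ↔ ∃ ω ∈ Omega A m 1, ∃ s : PS K ℓ,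
      ctr (nrm c0) ω = algebraMap _ _ s ∧ algebraMap _ _ s = g := by
  rw [idJ, Ideal.mem_map_iff_of_surjective _ h.alg_surjective]
  constructor
  · rintro ⟨s, ⟨ω, hω, hs⟩, rfl⟩
    exact ⟨ω, hω, s, hs, rfl⟩
  · rintro ⟨ω, hω, s, hs, rfl⟩
    exact ⟨s, ⟨ω, hω, hs⟩, rfl⟩

theorem IsRes.mem_idB (h : IsRes c0 e) {b : PS K n} :
    b ∈ idB A m c0 n ↔ ∃ d, IsDer A (mdel m c0) d ∧ ∃ t : PS K ℓ,
      d (cvec c0) = linP c0 ^ (m c0 - 1) * t ∧ algebraMap _ _ t = b := by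
  rw [idB, Ideal.mem_map_iff_of_surjective _ h.alg_surjective]
  constructor
  · rintro ⟨t, ⟨d, hd, ht⟩, rfl⟩
    exact ⟨d, hd, t, ht, rfl⟩
  · rintro ⟨d, hd, t, ht, rfl⟩
    exact ⟨t, ⟨d, hd, ht⟩, rfl⟩

theorem exists_ctr_eq {ω : ExtF K ℓ} (c0 : Fin ℓ → K) (hω : ω ∈ formsP K ℓ 1) :
    ∃ s : PS K ℓ, ctr (nrm c0) ω = algebraMap _ _ s := by
  obtain ⟨v, rfl⟩ := mem_formsP_one hω
  exact ⟨nrm c0 v, ctr_ι _ _⟩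

theorem resid_eq_algebraMap {ω : ExtF K ℓ} {s : PS K ℓ}
    (hs : ctr (nrm c0) ω = algebraMap _ _ s) :
    resid c0 e ω = algebraMap (PS K n) _ (algebraMap _ _ s) := by
  rw [resid_apply, hs, AlgHom.commutes]
  exact IsScalarTower.algebraMap_apply _ _ _ _

theorem IsRes.mem_idJ_iff (h : IsRes c0 e) {g : PS K n} :
    g ∈ idJ A m c0 n ↔ algebraMap (PS K n) (ExtF K n) g ∈ Jmod A m c0 e 1 := by
  rw [h.mem_idJ]
  constructor
  · rintro ⟨ω, hω, s, hs, rfl⟩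
    exact mem_Jmod.2 ⟨ω, hω, (resid_eq_algebraMap hs).symm⟩
  · intro hg
    obtain ⟨ω, hω, hg⟩ := mem_Jmod.1 hg
    obtain ⟨s, hs⟩ := exists_ctr_eq c0 (mem_Omega.1 hω).1
    refine ⟨ω, hω, s, hs, ?_⟩
    rw [resid_eq_algebraMap hs] at hg
    exact (ExteriorAlgebra.algebraMap_leftInverse (R := PS K n) (Fin n → PS K n)).injective hg.symm

theorem IsRes.idB_smul_mem (h : IsRes c0 e) (hc0 : c0 ∈ A.hyps) (hm : 1 ≤ m c0) {b : PS K n}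
    (hb : b ∈ idB A m c0 n) {x : ExtF K n} (hx : x ∈ Jmod A m c0 e (p + 1)) :
    b • x ∈ Imod A m c0 e p := by
  obtain ⟨d, hd, t, ht, rfl⟩ := h.mem_idB.1 hb
  obtain ⟨θ, hθ, rfl⟩ := mem_Jmod.1 hx
  obtain ⟨ζ, hζ⟩ := (mem_Omega.1 hθ).2 c0 hc0
  refine ⟨ctr d θ, mem_Omega.2 ⟨ctr_mem_formsP _ (mem_Omega.1 hθ).1,
    (mem_Omega.1 (Omega_le_mdel (c0 := c0) hθ)).2.ctr hd⟩, t • θ - linP c0 • ctr d ζ, ?_, ?_⟩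
  · have h1 := ctr_ι_mul d (cvec c0) θ
    rw [← dP_eq, hζ, ht, map_smul] at h1
    rw [smul_sub, smul_smul, smul_smul, ← pow_succ, Nat.sub_add_cancel hm, h1]
    abel
  · rw [map_sub, map_smul, map_smul, h.smul_resid, sub_zero, algebraMap_smul]

theorem IsRes.idJ_smul_mem (h : IsRes c0 e) (hc0 : c0 ∈ A.hyps) (hm : 1 ≤ m c0) {g : PS K n}
    (hg : g ∈ idJ A m c0 n) {x : ExtF K n} (hx : x ∈ Imod A m c0 e p) :
    ∃ y ∈ Jmod A m c0 e (p + 1), g • x = Qpoly (delArr A c0) m • y := by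
  have hμ : linP c0 ^ m c0 = linP c0 ^ (m c0 - 1) * linP c0 := by
    rw [← pow_succ, Nat.sub_add_cancel hm]
  have hα := linP_ne_zero (A.ne_zero c0 hc0)
  obtain ⟨ω, hω, s, hs, rfl⟩ := h.mem_idJ.1 hg
  obtain ⟨η, hη, θ, hθ, rfl⟩ := hx
  obtain ⟨ζ, hζ⟩ := (mem_Omega.1 hω).2 c0 hc0
  have hω' := Omega_le_mdel (c0 := c0) hω
  rw [mem_Omega] at hω' hη
  obtain ⟨κ, hκ, hlog⟩ := hω'.2.exists_mul hη.2
  have hdeg : κ ∈ formsP K ℓ (p + 1) := by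
    apply mem_formsP_of_smul (Qpoly_ne_zero A (mdel m c0))
    rw [← hκ, add_comm]; exact mul_mem_formsP hω'.1 hη.1
  set a := ctr (nrm c0) ζ with ha
  have hζa : ζ = dP c0 * a := eq_dP_mul_ctr h.ne_zero (dP_mul_eq_zero hc0 hζ)
  have key : Qpoly (delArr A c0) m • κ = s • θ + linP c0 • (a * η) := by
    apply smul_right_inj_extF (pow_ne_zero (m c0 - 1) hα)
    rw [smul_smul, ← Qpoly_mdel m hc0, ← hκ, eq_of_dP_mul (nrm_self h.ne_zero) hζ, hs,
      ← Algebra.commutes, ← Algebra.smul_def, add_mul, smul_mul_assoc, hθ, smul_add, smul_smul,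
      smul_smul, smul_smul, smul_mul_assoc, hμ, mul_comm s]
  have h0 : ∃ ζ, dP c0 * κ = linP c0 ^ m c0 • ζ := by
    refine exists_pow_smul_of_smul (prime_linP (A.ne_zero c0 hc0)) (not_dvd_Qpoly_delArr m hc0)
      (y := extInv a * θ) ?_
    have hx := mul_ι_mul (cvec c0) (extInv a) η
    rw [extInv_extInv, ← dP_eq] at hx
    rw [← mul_smul_comm, key, mul_add, mul_smul_comm, dP_mul_eq_zero hc0 hθ, smul_zero, zero_add,
      mul_smul_comm, ← hx, hθ, mul_smul_comm, smul_smul, hμ, mul_comm]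
  refine ⟨_, mem_Jmod.2 ⟨κ, mem_Omega.2 ⟨hdeg, hlog.of_mdel h0⟩, rfl⟩, ?_⟩
  rw [← map_smul (resid c0 e) (Qpoly (delArr A c0) m) κ, key, map_add, map_smul, map_smul,
    h.smul_resid, add_zero, algebraMap_smul]

/-! Passing to subarrangements -/

variable (hA : A1.hyps ⊆ A.hyps)
include hA

theorem Omega_mono : Omega A m p ≤ Omega A1 m p := fun x hx => by
  rw [mem_Omega] at *
  exact ⟨hx.1, hx.2.mono hA fun _ _ => le_rfl⟩

theorem Imod_mono : Imod A m c0 e p ≤ Imod A1 m c0 e p := by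
  rintro _ ⟨η, hη, θ, hθ, rfl⟩
  exact ⟨η, Omega_mono hA hη, θ, hθ, rfl⟩

omit hA

variable {f : PS K ℓ} (hf : ∀ c ∈ A.hyps, c ∉ A1.hyps → linP c ^ m c ∣ f)
include hf

theorem smul_mem_Omega_of_dvd {x : ExtF K ℓ} (hx : x ∈ Omega A1 m p) : f • x ∈ Omega A m p := by
  rw [mem_Omega] at *
  exact ⟨Submodule.smul_mem _ _ hx.1, hx.2.smul_of_dvd f fun c hc =>
    ⟨hf c hc, fun _ => Dvd.intro_left _ rfl⟩⟩

theorem smul_mem_Jmod {x : ExtF K n} (hx : x ∈ Jmod A1 m c0 e p) :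
    f • x ∈ Jmod A m c0 e p := by
  obtain ⟨θ, hθ, rfl⟩ := mem_Jmod.1 hx
  exact mem_Jmod.2 ⟨f • θ, smul_mem_Omega_of_dvd hf hθ, (map_smul _ _ _).symm⟩

variable (h0 : c0 ∈ A1.hyps)
include h0

omit hf in
theorem dvd_mdel (hf : ∀ c ∈ A.hyps, c ∉ A1.hyps → linP c ^ m c ∣ f) :
    ∀ c ∈ A.hyps, c ∉ A1.hyps → linP c ^ mdel m c0 c ∣ f := by
  intro c hc hc'
  rw [mdel_of_ne]
  · exact hf c hc hc'
  · rintro rfl; exact hc' h0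

theorem smul_mem_Imod {x : ExtF K n} (hx : x ∈ Imod A1 m c0 e p) :
    f • x ∈ Imod A m c0 e p := by
  obtain ⟨η, hη, θ, hθ, rfl⟩ := hx
  exact ⟨f • η, smul_mem_Omega_of_dvd (dvd_mdel h0 hf) hη, f • θ,
    by rw [mul_smul_comm, hθ, smul_comm], (map_smul _ _ _).symm⟩

theorem mul_mem_idB (h : IsRes c0 e) {b : PS K n} (hb : b ∈ idB A1 m c0 n) :
    algebraMap _ _ f * b ∈ idB A m c0 n := by
  obtain ⟨d, hd, t, ht, rfl⟩ := h.mem_idB.1 hb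
  refine h.mem_idB.2 ⟨f • d, hd.smul_of_dvd f (dvd_mdel h0 hf), f * t, ?_, map_mul _ _ _⟩
  rw [LinearMap.smul_apply, ht, smul_eq_mul]; ring

omit h0 in
theorem mul_mem_idJ (h : IsRes c0 e) {g : PS K n} (hg : g ∈ idJ A1 m c0 n) :
    algebraMap _ _ f * g ∈ idJ A m c0 n := by
  rw [h.mem_idJ_iff] at *
  rw [map_mul, ← IsScalarTower.algebraMap_apply, ← Algebra.smul_def]
  exact smul_mem_Jmod hf hg

end ResidueIdeals

/-! ### Projective dimensions of the residue modules -/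

theorem exact_inclusion {R M P : Type} [CommRing R] [AddCommGroup M] [Module R M] [AddCommGroup P]
    [Module R P] {N N' : Submodule R M} (hle : N ≤ N') (f : N' →ₗ[R] P)
    (hf : ∀ x, f x = 0 ↔ x.1 ∈ N) : Function.Exact (Submodule.inclusion hle) f := by
  intro x
  rw [hf]
  exact ⟨fun hx => ⟨⟨x.1, hx⟩, rfl⟩, fun ⟨y, hy⟩ => hy ▸ y.2⟩

section ResiduePd

variable {n : ℕ} [Algebra (PS K ℓ) (PS K n)] {A : Arrangement K ℓ} {m : (Fin ℓ → K) → ℕ}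
  {c0 : Fin ℓ → K} {e : (Fin n → K) →ₗ[K] (Fin ℓ → K)}

theorem IsRes.linP_mem (h : IsRes c0 e) : _root_.linP c0 ∈ nonZeroDivisors (PS K ℓ) :=
  mem_nonZeroDivisors_of_ne_zero (linP_ne_zero h.ne_zero)

/-- A submodule over the coordinate ring of the ambient space, seen over that of the
hyperplane. -/
def IsRes.toRestr (h : IsRes c0 e) (N : Submodule (PS K ℓ) (ExtF K n)) :
    Submodule (PS K n) (ExtF K n) where
  carrier := N
  add_mem' := N.add_mem
  zero_mem' := N.zero_mem
  smul_mem' a _ hx := h.smul_mem N a hx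

theorem IsRes.pdLT_restr (h : IsRes c0 e) (N : Submodule (PS K n) (ExtF K n)) {p : ℕ}
    (hN : PdLT (PS K ℓ) N (p + 2)) : PdLT (PS K n) N (p + 1) :=
  PdLT.change_of_rings h.alg_surjective h.ker h.linP_mem (pdLT_mvPolynomial K n N) hN

theorem IsRes.pdLT_toRestr (h : IsRes c0 e) (N : Submodule (PS K ℓ) (ExtF K n)) {p : ℕ}
    (hN : PdLT (PS K ℓ) N (p + 2)) : PdLT (PS K n) (h.toRestr N) (p + 1) := by
  refine h.pdLT_restr _ (PdLT.of_equiv (M₁ := N) ?_ hN)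
  exact
    { toFun := fun x => ⟨x.1, x.2⟩
      invFun := fun x => ⟨x.1, x.2⟩
      map_add' := fun _ _ => rfl
      map_smul' := fun _ _ => rfl
      left_inv := fun _ => rfl
      right_inv := fun _ => rfl }

theorem IsRes.pdLT_submodule (h : IsRes c0 e) (N : Submodule (PS K ℓ) (ExtF K n)) :
    PdLT (PS K ℓ) N (max 2 ℓ) := by
  have hF : PdLT (PS K ℓ) (ExtF K n) 2 := pdLT_two_of_projective h.alg_surjective h.ker h.linP_mem
  exact PdLT.left N.injective_subtype N.mkQ_surjective (LinearMap.exact_subtype_mkQ N)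
    (hF.mono (le_max_left _ _)) ((pdLT_mvPolynomial K ℓ _).mono (by omega))

theorem IsRes.finite_submodule (h : IsRes c0 e) (N : Submodule (PS K ℓ) (ExtF K n)) :
    Module.Finite (PS K ℓ) N := by
  have : Module.Finite (PS K ℓ) (PS K n) :=
    Module.Finite.of_surjective (Algebra.linearMap (PS K ℓ) (PS K n)) h.alg_surjective
  have : Module.Finite (PS K ℓ) (ExtF K n) := Module.Finite.trans (PS K n) _
  have : IsNoetherian (PS K ℓ) (ExtF K n) := isNoetherian_of_isNoetherianRing_of_finite _ _
  exact Module.IsNoetherian.finite _ _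

/-- Multiplication by the linear form, `Ω^p(A,m-δ_H) → Ω^p(A,m)`. -/
def mulLinP (hm : 1 ≤ m c0) (p : ℕ) : Omega A (mdel m c0) p →ₗ[PS K ℓ] Omega A m p :=
  (LinearMap.lsmul (PS K ℓ) (ExtF K ℓ) (linP c0)).restrict fun _ hx => smul_mem_Omega hm hx

theorem mulLinP_injective (hc : c0 ≠ 0) (hm : 1 ≤ m c0) (p : ℕ) :
    Function.Injective (mulLinP (A := A) hm p) := fun _ _ hxy =>
  Subtype.ext (smul_right_inj_extF (linP_ne_zero hc) (congrArg Subtype.val hxy))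

/-- The residue map onto its image. -/
def toJmod (A : Arrangement K ℓ) (m : (Fin ℓ → K) → ℕ) (c0 : Fin ℓ → K)
    (e : (Fin n → K) →ₗ[K] (Fin ℓ → K)) (p : ℕ) :
    Omega A m p →ₗ[PS K ℓ] Jmod A m c0 e p :=
  (resid c0 e).restrict fun x hx => mem_Jmod.2 ⟨x, hx, rfl⟩

theorem toJmod_surjective (p : ℕ) : Function.Surjective (toJmod A m c0 e p) := by
  rintro ⟨x, hx⟩
  obtain ⟨θ, hθ, rfl⟩ := mem_Jmod.1 hx
  exact ⟨⟨θ, hθ⟩, rfl⟩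

theorem IsRes.exact_toJmod (h : IsRes c0 e) (hc0 : c0 ∈ A.hyps) (hm : 1 ≤ m c0) (p : ℕ) :
    Function.Exact (mulLinP (A := A) hm p) (toJmod A m c0 e p) := by
  rintro ⟨θ, hθ⟩
  rw [← Submodule.coe_eq_zero]
  refine (h.resid_eq_zero_iff hc0 hm hθ).trans ⟨?_, ?_⟩
  · rintro ⟨κ, hκ, hh⟩
    exact ⟨⟨κ, hκ⟩, Subtype.ext hh.symm⟩
  · rintro ⟨κ, hh⟩
    exact ⟨κ.1, κ.2, (congrArg Subtype.val hh).symm⟩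

theorem exists_dP_mul_eq (hc0 : c0 ∈ A.hyps) {p : ℕ} (x : Omega A (mdel m c0) p) :
    ∃ θ, dP c0 * x.1 = linP c0 ^ (m c0 - 1) • θ := by
  have := (mem_Omega.1 x.2).2 c0 hc0
  rwa [mdel_self] at this

/-- The normalized residue map. -/
def toImod (hc0 : c0 ∈ A.hyps) (m : (Fin ℓ → K) → ℕ) (e : (Fin n → K) →ₗ[K] (Fin ℓ → K))
    (p : ℕ) : Omega A (mdel m c0) p →ₗ[PS K ℓ] Imod A m c0 e p where
  toFun x := ⟨resid c0 e (exists_dP_mul_eq hc0 x).choose,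
    x.1, x.2, _, (exists_dP_mul_eq hc0 x).choose_spec, rfl⟩
  map_add' x y := by
    refine Subtype.ext ?_
    refine Eq.trans ?_ (map_add (resid c0 e) _ _)
    refine congrArg (resid c0 e) (smul_right_inj_extF
      (pow_ne_zero (m c0 - 1) (linP_ne_zero (A.ne_zero c0 hc0))) ?_)
    rw [← (exists_dP_mul_eq hc0 (x + y)).choose_spec, smul_add,
      ← (exists_dP_mul_eq hc0 x).choose_spec, ← (exists_dP_mul_eq hc0 y).choose_spec,
      ← mul_add]
    rfl
  map_smul' a x := by
    refine Subtype.ext ?_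
    refine Eq.trans ?_ (map_smul (resid c0 e) a _)
    refine congrArg (resid c0 e) (smul_right_inj_extF
      (pow_ne_zero (m c0 - 1) (linP_ne_zero (A.ne_zero c0 hc0))) ?_)
    rw [← (exists_dP_mul_eq hc0 (a • x)).choose_spec, smul_comm,
      ← (exists_dP_mul_eq hc0 x).choose_spec, ← mul_smul_comm]
    rfl

theorem coe_toImod (hc0 : c0 ∈ A.hyps) {p : ℕ} (x : Omega A (mdel m c0) p) {θ : ExtF K ℓ}
    (hθ : dP c0 * x.1 = linP c0 ^ (m c0 - 1) • θ) : (toImod hc0 m e p x).1 = resid c0 e θ := by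
  refine congrArg (resid c0 e) (smul_right_inj_extF
    (pow_ne_zero (m c0 - 1) (linP_ne_zero (A.ne_zero c0 hc0))) ?_)
  rw [← (exists_dP_mul_eq hc0 x).choose_spec, hθ]

theorem toImod_surjective (hc0 : c0 ∈ A.hyps) (p : ℕ) :
    Function.Surjective (toImod hc0 m e p) := by
  rintro ⟨x, η, hη, θ, hθ, rfl⟩
  exact ⟨⟨η, hη⟩, Subtype.ext (coe_toImod hc0 _ hθ)⟩

theorem IsRes.toImod_eq_zero_iff (h : IsRes c0 e) (hc0 : c0 ∈ A.hyps) (hm : 1 ≤ m c0) {p : ℕ}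
    (x : Omega A (mdel m c0) p) : toImod hc0 m e p x = 0 ↔ x.1 ∈ Omega A m p := by
  obtain ⟨θ, hθ⟩ := exists_dP_mul_eq hc0 x
  rw [← Submodule.coe_eq_zero, coe_toImod hc0 x hθ]
  exact h.resid_eq_zero_iff' hc0 hm x.2 hθ

theorem IsRes.pdLT_Jmod (h : IsRes c0 e) (hc0 : c0 ∈ A.hyps) (hm : 1 ≤ m c0) {p q : ℕ}
    (h₁ : PdLT (PS K ℓ) (Omega A (mdel m c0) p) q) (h₂ : PdLT (PS K ℓ) (Omega A m p) (q + 1)) :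
    PdLT (PS K ℓ) (Jmod A m c0 e p) (q + 1) :=
  PdLT.right (mulLinP_injective h.ne_zero hm p) (toJmod_surjective p) (h.exact_toJmod hc0 hm p)
    h₁ h₂

theorem IsRes.pdLT_Imod (h : IsRes c0 e) (hc0 : c0 ∈ A.hyps) (hm : 1 ≤ m c0) {p q : ℕ}
    (h₁ : PdLT (PS K ℓ) (Omega A m p) q) (h₂ : PdLT (PS K ℓ) (Omega A (mdel m c0) p) (q + 1)) :
    PdLT (PS K ℓ) (Imod A m c0 e p) (q + 1) :=
  PdLT.right (Submodule.inclusion_injective _) (toImod_surjective hc0 p)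
    (exact_inclusion Omega_le_mdel _ (h.toImod_eq_zero_iff hc0 hm)) h₁ h₂

end ResiduePd

/-! ### Ideals of codimension at least two -/

theorem exists_X_pow_mem {n : ℕ} (𝔞 : Ideal (PS K n))
    (h : ∀ x : Fin n → K, x ≠ 0 → ∃ a ∈ 𝔞, ∀ P : Ideal (PS K n), P.IsPrime → a ∈ P →
      ∃ c : Fin n → K, linP c ∈ P ∧ ∑ i, c i * x i ≠ 0) :
    ∃ k, ∀ i, (X i : PS K n) ^ k ∈ 𝔞 := by
  have hX : ∀ i, (X i : PS K n) ∈ 𝔞.radical := by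
    intro i
    rw [Ideal.radical_eq_sInf, Submodule.mem_sInf]
    rintro P ⟨hP, hprime⟩
    let U : Submodule K (Fin n → K) :=
      { carrier := {c | linP c ∈ P}
        add_mem' := fun {a b} ha hb => by
          rw [Set.mem_ofPred_eq, linP_add]; exact P.add_mem ha hb
        zero_mem' := by simp [linP]
        smul_mem' := fun t c hc => by
          rw [Set.mem_ofPred_eq, linP_smul]; exact Ideal.mul_mem_left P _ hc }
    have hU : U = ⊤ := by
      by_contra hU
      obtain ⟨f, hf, hfU⟩ := Submodule.exists_le_ker_of_lt_top U (lt_top_iff_ne_top.2 hU)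
      have hdot : ∀ c, ∑ i, c i * f (Pi.single i 1) = f c := by
        intro c
        conv_rhs => rw [pi_eq_sum_univ' c, map_sum]
        exact Finset.sum_congr rfl fun i _ => by
          rw [map_smul, smul_eq_mul]
      obtain ⟨a, ha, hc⟩ := h (fun i => f (Pi.single i 1)) (by
        rintro h0
        apply hf
        ext i
        simpa using congrFun h0 i)
      obtain ⟨c, hc, hne⟩ := hc P hprime (hP ha)
      exact hne ((hdot c).trans (hfU hc))
    have : Pi.single i 1 ∈ U := hU ▸ Submodule.mem_top
    have h1 : linP (Pi.single i 1 : Fin n → K) ∈ P := this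
    rwa [linP_single] at h1
  choose k hk using hX
  exact ⟨∑ i, k i, fun i => Ideal.mem_of_dvd _ (pow_dvd_pow _ <|
    Finset.single_le_sum (f := k) (fun _ _ => Nat.zero_le _) (Finset.mem_univ i)) (hk i)⟩

/-- The elements of an ideal have no common divisor. -/
def IsPrimitiveIdeal {R : Type} [CommRing R] (𝔞 : Ideal R) : Prop :=
  ∀ q, (∀ x ∈ 𝔞, q ∣ x) → IsUnit q

section

variable {R : Type} [CommRing R] [IsDomain R]

theorem IsPrimitiveIdeal.ne_zero {𝔞 : Ideal R} (h : IsPrimitiveIdeal 𝔞) : ∃ x ∈ 𝔞, x ≠ 0 := by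
  by_contra! h0
  exact not_isUnit_zero (h 0 fun x hx => by rw [h0 x hx])

theorem IsPrimitiveIdeal.dvd [UniqueFactorizationMonoid R] {𝔞 : Ideal R}
    (h : IsPrimitiveIdeal 𝔞) {q y : R} (hq : ∀ x ∈ 𝔞, q ∣ y * x) : q ∣ y := by
  induction q using UniqueFactorizationMonoid.induction_on_prime generalizing y with
  | h₁ =>
    obtain ⟨x, hx, hx0⟩ := h.ne_zero
    rw [(mul_eq_zero.1 (zero_dvd_iff.1 (hq x hx))).resolve_right hx0]
  | h₂ q hu => exact hu.dvd
  | h₃ q p _ hp ih =>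
    have hpy : p ∣ y := by
      by_contra hpy
      exact hp.not_isUnit (h p fun x hx =>
        (hp.dvd_or_dvd ((dvd_mul_right p q).trans (hq x hx))).resolve_left hpy)
    obtain ⟨z, rfl⟩ := hpy
    refine mul_dvd_mul_left p (ih fun x hx => ?_)
    have := hq x hx
    rwa [mul_assoc, mul_dvd_mul_iff_left hp.ne_zero] at this

theorem exists_primitive_factor [WfDvdMonoid R] (a : R) : ∀ 𝔞 : Ideal R, a ∈ 𝔞 → a ≠ 0 →
    ∃ b : R, ∃ 𝔟 : Ideal R, b ≠ 0 ∧ IsPrimitiveIdeal 𝔟 ∧ (∀ x ∈ 𝔞, b ∣ x) ∧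
      ∀ x ∈ 𝔟, b * x ∈ 𝔞 := by
  induction a using (wellFounded_dvdNotUnit (α := R)).induction with
  | _ a ih =>
    intro 𝔞 ha ha0
    by_cases hp : IsPrimitiveIdeal 𝔞
    · exact ⟨1, 𝔞, one_ne_zero, hp, fun x _ => one_dvd x, fun x hx => by rwa [one_mul]⟩
    · unfold IsPrimitiveIdeal at hp
      push Not at hp
      obtain ⟨q, hq, hu⟩ := hp
      obtain ⟨a', rfl⟩ := hq a ha
      have hq0 : q ≠ 0 := left_ne_zero_of_mul ha0
      have ha' : a' ≠ 0 := right_ne_zero_of_mul ha0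
      obtain ⟨b, 𝔟, hb, h𝔟, h1, h2⟩ := ih a' ⟨ha', q, hu, mul_comm _ _⟩
        (Submodule.comap (LinearMap.mulLeft R q) 𝔞) ha ha'
      refine ⟨q * b, 𝔟, mul_ne_zero hq0 hb, h𝔟, fun x hx => ?_, fun x hx => ?_⟩
      · obtain ⟨y, rfl⟩ := hq x hx
        exact mul_dvd_mul_left q (h1 y hx)
      · rw [mul_assoc]; exact h2 x hx

omit [IsDomain R] in
theorem mul_mem_of_mul_le {𝔟 𝔧 : Ideal R} {g x : R} (hg : ∀ x ∈ 𝔧, g ∣ x) (hx : x ∈ 𝔟 * 𝔧) :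
    ∃ w ∈ 𝔟, x = g * w := by
  induction hx using Submodule.mul_induction_on' with
  | mem_mul_mem b hb y hy =>
    obtain ⟨z, rfl⟩ := hg y hy
    exact ⟨b * z, 𝔟.mul_mem_right _ hb, by ring⟩
  | add x _ y _ hx hy =>
    obtain ⟨w, hw, rfl⟩ := hx
    obtain ⟨v, hv, rfl⟩ := hy
    exact ⟨w + v, 𝔟.add_mem hw hv, by ring⟩

theorem exists_factorization [UniqueFactorizationMonoid R] {𝔟 𝔧 : Ideal R} {q : R} (hq : q ≠ 0)
    (h : ∀ x ∈ 𝔟 * 𝔧, q ∣ x)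
    (hp : IsPrimitiveIdeal (Submodule.comap (LinearMap.mulRight R q) (𝔟 * 𝔧))) :
    ∃ b g : R, b * g = q ∧ (∀ x ∈ 𝔟, b ∣ x) ∧ (∀ x ∈ 𝔧, g ∣ x) ∧
      ∀ a, a * q ∈ 𝔟 * 𝔧 → a * b ∈ 𝔟 ∧ a * g ∈ 𝔧 := by
  obtain ⟨a₀, ha₀, h0⟩ := hp.ne_zero
  have hne : 𝔟 * 𝔧 ≠ ⊥ := fun h' =>
    mul_ne_zero h0 hq ((Submodule.mem_bot R).1 (h' ▸ ha₀))
  obtain ⟨x, hx, hx0⟩ := Submodule.exists_mem_ne_zero_of_ne_bot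
    (fun hb : 𝔟 = ⊥ => hne (by rw [hb, Ideal.bot_mul]))
  obtain ⟨y, hy, hy0⟩ := Submodule.exists_mem_ne_zero_of_ne_bot
    (fun hb : 𝔧 = ⊥ => hne (by rw [hb, Ideal.mul_bot]))
  obtain ⟨b, 𝔟', hb0, h𝔟, hb, hb'⟩ := exists_primitive_factor x 𝔟 hx hx0
  obtain ⟨g, 𝔧', hg0, h𝔧, hg, hg'⟩ := exists_primitive_factor y 𝔧 hy hy0
  have h1 : q ∣ b * g := h𝔟.dvd fun x hx => h𝔧.dvd fun y hy => by
    have := h _ (Ideal.mul_mem_mul (hb' x hx) (hg' y hy))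
    rwa [show b * x * (g * y) = b * g * x * y by ring] at this
  have h2 : b * g ∣ q := hp.dvd fun a ha => by
    obtain ⟨w, hw, e⟩ := mul_mem_of_mul_le hg ha
    obtain ⟨v, rfl⟩ := hb w hw
    exact ⟨v, by rw [mul_comm q, show a * q = g * (b * v) from e]; ring⟩
  obtain ⟨u, hu⟩ := associated_of_dvd_dvd h2 h1
  have hgu : ∀ x ∈ 𝔧, g * u ∣ x := fun x hx => (Units.mul_right_dvd).2 (hg x hx)
  refine ⟨b, g * u, by rw [← mul_assoc, hu], hb, hgu, fun a ha => ⟨?_, ?_⟩⟩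
  · obtain ⟨w, hw, e⟩ := mul_mem_of_mul_le hgu ha
    have : a * b = w := by
      apply mul_left_cancel₀ (mul_ne_zero hg0 u.ne_zero)
      rw [← e, ← hu]; ring
    rwa [this]
  · rw [mul_comm 𝔟] at ha
    obtain ⟨w, hw, e⟩ := mul_mem_of_mul_le hb ha
    have : a * (g * u) = w := by
      apply mul_left_cancel₀ hb0
      rw [← e, ← hu]; ring
    rwa [this]

end

theorem prime_X' {n : ℕ} (i : Fin n) : Prime (X i : PS K n) := by
  rw [← linP_single]
  exact prime_linP (by simp)

theorem isPrimitiveIdeal_of_X_pow_mem {n : ℕ} (hn : 2 ≤ n) {𝔞 : Ideal (PS K n)} {k : ℕ}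
    (h : ∀ i, (X i : PS K n) ^ k ∈ 𝔞) : IsPrimitiveIdeal 𝔞 := by
  intro q hq
  have hne : (⟨0, by omega⟩ : Fin n) ≠ ⟨1, by omega⟩ := by simp
  have h0 := hq _ (h ⟨0, by omega⟩)
  have h1 := hq _ (h ⟨1, by omega⟩)
  obtain ⟨i, -, hi⟩ := (dvd_prime_pow (prime_X' (K := K) (⟨0, by omega⟩ : Fin n)) k).1 h0
  obtain ⟨j, -, hj⟩ := (dvd_prime_pow (prime_X' (K := K) (⟨1, by omega⟩ : Fin n)) k).1 h1
  rcases i.eq_zero_or_pos with rfl | hi0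
  · rw [pow_zero] at hi; exact hi.isUnit_iff.2 isUnit_one
  · exfalso
    have hd : (X ⟨0, by omega⟩ : PS K n) ∣ X ⟨1, by omega⟩ ^ j :=
      (dvd_pow_self _ hi0.ne').trans (hi.symm.trans hj).dvd
    have := (prime_X' (K := K) (⟨0, by omega⟩ : Fin n)).dvd_of_dvd_pow hd
    simp at this

/-! ### The free case -/

section FreeCase

variable {n : ℕ} [Algebra (PS K ℓ) (PS K n)] {A : Arrangement K ℓ} {m : (Fin ℓ → K) → ℕ}
  {c0 : Fin ℓ → K} {e : (Fin n → K) →ₗ[K] (Fin ℓ → K)}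

theorem Qpoly_eq_mul (m : (Fin ℓ → K) → ℕ) {c : Fin ℓ → K} (hc : c ∈ A.hyps) :
    Qpoly A m = linP c ^ m c * Qpoly (delArr A c) m :=
  (Finset.mul_prod_erase A.hyps (fun c => linP c ^ m c) hc).symm

theorem smul_dP_mem_Omega (A : Arrangement K ℓ) (m : (Fin ℓ → K) → ℕ) (c : Fin ℓ → K) :
    Qpoly (delArr A c) m • dP c ∈ Omega A m 1 := by
  refine mem_Omega.2 ⟨Submodule.smul_mem _ _ (dP_mem_formsP _), fun c' hc' => ?_⟩
  by_cases hcc : c' = c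
  · subst hcc
    exact ⟨0, by rw [mul_smul_comm]; simp [dP_eq]⟩
  · obtain ⟨r, hr⟩ : linP c' ^ m c' ∣ Qpoly (delArr A c) m :=
      Finset.dvd_prod_of_mem _ (Finset.mem_erase.2 ⟨hcc, hc'⟩)
    exact ⟨r • (dP c' * dP c), by rw [hr, mul_smul_comm, smul_smul]⟩

theorem Qpoly_smul_mem_Omega (A : Arrangement K ℓ) (m : (Fin ℓ → K) → ℕ) {p : ℕ} {x : ExtF K ℓ}
    (hx : x ∈ formsP K ℓ p) : Qpoly A m • x ∈ Omega A m p := by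
  refine mem_Omega.2 ⟨Submodule.smul_mem _ _ hx, fun c hc => ?_⟩
  obtain ⟨r, hr⟩ : linP c ^ m c ∣ Qpoly A m := Finset.dvd_prod_of_mem _ hc
  exact ⟨r • (dP c * x), by rw [hr, mul_smul_comm, smul_smul]⟩

theorem exists_eq_smul_of_dvd {a : PS K ℓ} {d : Module.Dual (PS K ℓ) (Fin ℓ → PS K ℓ)}
    (h : ∀ w, a ∣ d w) : ∃ d', d = a • d' := by
  choose g hg using h
  refine ⟨∑ i, g (Pi.single i 1) • LinearMap.proj i, (Pi.basisFun (PS K ℓ) (Fin ℓ)).ext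
    fun j => ?_⟩
  simp [hg, Pi.single_apply]

/-- The functional `w ↦ φ(Q·dw)`. -/
theorem exists_isDer_of_dual (φ : Module.Dual (PS K ℓ) (Omega A m 1)) :
    ∃ d : Module.Dual (PS K ℓ) (Fin ℓ → PS K ℓ),
      (∀ w, d w = φ ⟨_, Qpoly_smul_mem_Omega A m (ι_mem_formsP w)⟩) ∧
      ∀ c ∈ A.hyps, d (cvec c) = linP c ^ m c * φ ⟨_, smul_dP_mem_Omega A m c⟩ := by
  let T : (Fin ℓ → PS K ℓ) →ₗ[PS K ℓ] Omega A m 1 :=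
    (Qpoly A m • ExteriorAlgebra.ι (PS K ℓ)).codRestrict _
      fun w => Qpoly_smul_mem_Omega A m (ι_mem_formsP w)
  refine ⟨φ ∘ₗ T, fun w => rfl, fun c hc => ?_⟩
  rw [← smul_eq_mul, ← map_smul, LinearMap.comp_apply]
  refine congrArg φ (Subtype.ext ?_)
  change Qpoly A m • ExteriorAlgebra.ι (PS K ℓ) (cvec c) = linP c ^ m c • _
  rw [smul_smul, ← Qpoly_eq_mul m hc, dP_eq]

theorem IsRes.dual_apply_mem_idB (h : IsRes c0 e) (hc0 : c0 ∈ A.hyps) (hm : 1 ≤ m c0)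
    (hfree : Module.Projective (PS K ℓ) (Omega A m 1))
    (f : Jmod A m c0 e 1 →ₗ[PS K ℓ] PS K n) :
    f (toJmod A m c0 e 1 ⟨_, smul_dP_mem_Omega A m c0⟩) ∈ idB A m c0 n := by
  obtain ⟨φ, hφ⟩ := Module.projective_lifting_property (Algebra.linearMap (PS K ℓ) (PS K n))
    (f ∘ₗ toJmod A m c0 e 1) h.alg_surjective
  have hφ' : ∀ x, algebraMap (PS K ℓ) (PS K n) (φ x) = f (toJmod A m c0 e 1 x) :=
    fun x => LinearMap.congr_fun hφ x
  obtain ⟨d, hd, hdc⟩ := exists_isDer_of_dual φ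
  obtain ⟨d', rfl⟩ : ∃ d', d = _root_.linP c0 • d' := by
    refine exists_eq_smul_of_dvd fun w => ?_
    rw [← Ideal.mem_span_singleton, ← h.ker, RingHom.mem_ker, hd, hφ']
    have : toJmod A m c0 e 1 ⟨_, Qpoly_smul_mem_Omega A m (ι_mem_formsP w)⟩ = 0 := by
      refine Subtype.ext ?_
      change resid c0 e (Qpoly A m • _) = 0
      rw [Qpoly_eq_mul m hc0, ← Nat.sub_add_cancel hm, pow_succ', mul_assoc, ← smul_smul, map_smul,
        h.smul_resid]
    rw [this, map_zero]
  have hα := linP_ne_zero (A.ne_zero c0 hc0)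
  have h0 : d' (cvec c0) = _root_.linP c0 ^ (m c0 - 1) * φ ⟨_, smul_dP_mem_Omega A m c0⟩ := by
    apply mul_left_cancel₀ hα
    rw [← mul_assoc, ← pow_succ', Nat.sub_add_cancel hm, ← hdc c0 hc0]; rfl
  refine h.mem_idB.2 ⟨d', fun c hc => ?_, _, h0, hφ' _⟩
  by_cases hcc : c = c0
  · subst hcc
    rw [mdel_self, h0]; exact dvd_mul_right _ _
  · rw [mdel_of_ne _ hcc]
    have h1 : _root_.linP c ^ m c ∣ _root_.linP c0 * d' (cvec c) :=
      ⟨_, hdc c hc⟩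
    exact (prime_linP (A.ne_zero c hc)).pow_dvd_of_dvd_mul_left _ (A.not_dvd hc hc0 hcc) h1

theorem IsRes.Qpoly_mem_idB_mul_idJ (h : IsRes c0 e) (hc0 : c0 ∈ A.hyps) (hm : 1 ≤ m c0)
    (h1 : Module.Projective (PS K ℓ) (Omega A m 1))
    (h2 : Module.Projective (PS K ℓ) (Omega A (mdel m c0) 1)) :
    algebraMap (PS K ℓ) (PS K n) (Qpoly (delArr A c0) m) ∈ idB A m c0 n * idJ A m c0 n := by
  have hP : Module.Projective (PS K n) (h.toRestr (Jmod A m c0 e 1)) :=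
    pdLT_one_iff.1 (h.pdLT_toRestr _ (h.pdLT_Jmod hc0 hm (pdLT_one_iff.2 h2)
      ((pdLT_one_iff.2 h1).mono one_le_two)))
  obtain ⟨s, hs⟩ := Module.projective_def'.1 hP
  set x0 : h.toRestr (Jmod A m c0 e 1) :=
    ⟨_, (toJmod A m c0 e 1 ⟨_, smul_dP_mem_Omega A m c0⟩).2⟩ with hx0
  have hx0' : x0.1 = algebraMap (PS K n) (ExtF K n)
      (algebraMap (PS K ℓ) (PS K n) (Qpoly (delArr A c0) m)) := by
    refine resid_eq_algebraMap ?_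
    change ctr (nrm c0) (Qpoly (delArr A c0) m • dP c0) = _
    rw [map_smul, dP_eq, ctr_ι, nrm_self h.ne_zero, map_one, Algebra.smul_def, mul_one]
  have hinj : Function.Injective (algebraMap (PS K n) (ExtF K n)) :=
    (ExteriorAlgebra.algebraMap_leftInverse (R := PS K n) (Fin n → PS K n)).injective
  have hy : ∀ y : h.toRestr (Jmod A m c0 e 1), ∃ g ∈ idJ A m c0 n, algebraMap _ _ g = y.1 := by
    intro y
    obtain ⟨θ, hθ, hy⟩ := mem_Jmod.1 y.2
    obtain ⟨r, hr⟩ := exists_ctr_eq c0 (mem_Omega.1 hθ).1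
    refine ⟨_, h.mem_idJ.2 ⟨θ, hθ, r, hr, rfl⟩, ?_⟩
    rw [hy, resid_eq_algebraMap hr]
  choose g hg hgy using hy
  have hsum := LinearMap.congr_fun hs x0
  rw [LinearMap.comp_apply, Finsupp.linearCombination_apply, Finsupp.sum, LinearMap.id_apply]
    at hsum
  have : algebraMap (PS K ℓ) (PS K n) (Qpoly (delArr A c0) m)
      = ∑ y ∈ (s x0).support, s x0 y * g y := by
    apply hinj
    rw [← hx0', map_sum]
    conv_lhs => rw [← hsum]
    rw [AddSubmonoidClass.coe_finsetSum]
    refine Finset.sum_congr rfl fun y _ => ?_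
    rw [map_mul, hgy, ← Algebra.smul_def]; rfl
  rw [this]
  refine Ideal.sum_mem _ fun y _ => Ideal.mul_mem_mul ?_ (hg y)
  let f : Jmod A m c0 e 1 →ₗ[PS K ℓ] PS K n :=
    { toFun := fun x => s ⟨x.1, x.2⟩ y
      map_add' := fun a b => DFunLike.congr_fun (map_add s ⟨a.1, a.2⟩ ⟨b.1, b.2⟩) y
      map_smul' := fun r a => by
        have e1 : (⟨(r • a).1, (r • a).2⟩ : h.toRestr (Jmod A m c0 e 1)) =
            algebraMap (PS K ℓ) (PS K n) r • ⟨a.1, a.2⟩ :=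
          Subtype.ext (algebraMap_smul (PS K n) r a.1).symm
        have h2 := DFunLike.congr_fun ((congrArg s e1).trans (map_smul s _ _)) y
        rw [Finsupp.smul_apply] at h2
        exact h2.trans (algebraMap_smul (PS K n) r _) }
  exact h.dual_apply_mem_idB hc0 hm h1 f

end FreeCase

/-! ### The factorization of the residue ideals -/

theorem dvd_of_dP_mul_algebraMap {c : Fin ℓ → K} (hc : c ≠ 0) {s a : PS K ℓ} {ζ : ExtF K ℓ}
    (h : dP c * algebraMap _ (ExtF K ℓ) s = a • ζ) : a ∣ s := by
  obtain ⟨w, hw⟩ := exists_dual_vec hc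
  have hv : constFun w (cvec c) = 1 := by rw [constFun_cvec, hw, map_one]
  have h1 := congrArg (ctr (constFun w)) h
  rw [dP_eq, ctr_ι_mul, hv, one_smul, ctr_algebraMap, mul_zero, sub_zero, map_smul] at h1
  have h2 := congrArg ExteriorAlgebra.algebraMapInv h1
  rw [(ExteriorAlgebra.algebraMap_leftInverse (R := PS K ℓ) (Fin ℓ → PS K ℓ)) s, map_smul,
    smul_eq_mul] at h2
  exact ⟨_, h2⟩

theorem Qpoly_dvd (A : Arrangement K ℓ) (m : (Fin ℓ → K) → ℕ) {s : PS K ℓ}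
    (h : ∀ c ∈ A.hyps, linP c ^ m c ∣ s) : Qpoly A m ∣ s := by
  obtain ⟨t, ht⟩ := exists_prod_smul A.hyps (fun c => linP c ^ m c) (A.pairwise_isRelPrime m)
    (x := s) fun c hc => h c hc
  exact ⟨t, ht⟩

theorem mem_Omega_zero {A : Arrangement K ℓ} {m : (Fin ℓ → K) → ℕ} {x : ExtF K ℓ} :
    x ∈ Omega A m 0 ↔ ∃ t : PS K ℓ, x = algebraMap _ _ (Qpoly A m * t) := by
  constructor
  · intro hx
    obtain ⟨⟨s, rfl⟩, h⟩ := (mem_Omega.1 hx).imp_left mem_formsP_zero.1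
    obtain ⟨t, rfl⟩ := Qpoly_dvd A m fun c hc => by
      obtain ⟨ζ, hζ⟩ := h c hc
      exact dvd_of_dP_mul_algebraMap (A.ne_zero c hc) hζ
    exact ⟨t, rfl⟩
  · rintro ⟨t, rfl⟩
    rw [map_mul, ← Algebra.smul_def]
    exact Qpoly_smul_mem_Omega A m (mem_formsP_zero.2 ⟨t, rfl⟩)

/-- The contribution to the defining polynomial of the hyperplanes outside a subarrangement. -/
def coQ (A A1 : Arrangement K ℓ) (m : (Fin ℓ → K) → ℕ) : PS K ℓ :=
  ∏ c ∈ A.hyps \ A1.hyps, linP c ^ m c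

theorem dvd_coQ (A A1 : Arrangement K ℓ) (m : (Fin ℓ → K) → ℕ) :
    ∀ c ∈ A.hyps, c ∉ A1.hyps → linP c ^ m c ∣ coQ A A1 m := fun _ hc hc' =>
  Finset.dvd_prod_of_mem _ (Finset.mem_sdiff.2 ⟨hc, hc'⟩)

theorem coQ_mul_Qpoly {A A1 : Arrangement K ℓ} (hA : A1.hyps ⊆ A.hyps) (m : (Fin ℓ → K) → ℕ)
    {c0 : Fin ℓ → K} (h0 : c0 ∈ A1.hyps) :
    coQ A A1 m * Qpoly (delArr A1 c0) m = Qpoly (delArr A c0) m := by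
  have h1 : A.hyps \ A1.hyps = A.hyps.erase c0 \ A1.hyps.erase c0 := by
    ext c
    simp only [Finset.mem_sdiff, Finset.mem_erase]
    by_cases hc : c = c0
    · subst hc; simp [h0]
    · simp [hc]
  rw [coQ, h1]
  exact Finset.prod_sdiff (Finset.erase_subset_erase c0 hA)

theorem locArr_subset (A : Arrangement K ℓ) (x : Fin ℓ → K) : (locArr A x).hyps ⊆ A.hyps :=
  Finset.filter_subset _ _

section

variable {n : ℕ} [Algebra (PS K ℓ) (PS K n)] {A : Arrangement K ℓ} {m : (Fin ℓ → K) → ℕ}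
  {c0 : Fin ℓ → K} {e : (Fin n → K) →ₗ[K] (Fin ℓ → K)}

theorem IsRes.mem_locArr (h : IsRes c0 e) (hc0 : c0 ∈ A.hyps) (x : Fin n → K) :
    c0 ∈ (locArr A (e x)).hyps :=
  Finset.mem_filter.2 ⟨hc0, h.dot x⟩

theorem IsRes.exists_linP_mem_of_coQ_mem (h : IsRes c0 e) (x : Fin n → K) {P : Ideal (PS K n)}
    (hP : P.IsPrime) (hx : algebraMap (PS K ℓ) (PS K n) (coQ A (locArr A (e x)) m) ∈ P) :
    ∃ c ∈ A.hyps, c ∉ (locArr A (e x)).hyps ∧ _root_.linP (resF e c) ∈ P ∧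
      ∑ i, resF e c i * x i ≠ 0 := by
  rw [coQ, map_prod, hP.prod_mem_iff] at hx
  obtain ⟨c, hc, hcP⟩ := hx
  rw [Finset.mem_sdiff] at hc
  rw [map_pow, h.linP] at hcP
  refine ⟨c, hc.1, hc.2, hP.mem_of_pow_mem _ hcP, fun h0 => hc.2 (Finset.mem_filter.2 ⟨hc.1, ?_⟩)⟩
  rwa [← resF_dot]

theorem IsRes.alg_Qpoly_ne_zero (h : IsRes c0 e) (hc0 : c0 ∈ A.hyps) :
    algebraMap (PS K ℓ) (PS K n) (Qpoly (delArr A c0) m) ≠ 0 := by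
  rw [Ne, ← RingHom.mem_ker, h.ker, Ideal.mem_span_singleton]
  exact not_dvd_Qpoly_delArr m hc0

theorem IsRes.mem_Imod_zero (h : IsRes c0 e) (hc0 : c0 ∈ A.hyps) {x : ExtF K n}
    (hx : x ∈ Imod A m c0 e 0) : ∃ t : PS K n, x = algebraMap (PS K n) _
      (algebraMap (PS K ℓ) (PS K n) (Qpoly (delArr A c0) m) * t) := by
  obtain ⟨η, hη, θ, hθ, rfl⟩ := hx
  obtain ⟨t, rfl⟩ := mem_Omega_zero.1 hη
  refine ⟨algebraMap _ _ t, ?_⟩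
  have : θ = dP c0 * algebraMap _ _ (Qpoly (delArr A c0) m * t) := by
    apply smul_right_inj_extF (pow_ne_zero (m c0 - 1) (linP_ne_zero (A.ne_zero c0 hc0)))
    rw [← hθ, Qpoly_mdel m hc0, mul_assoc, map_mul _ (_root_.linP c0 ^ _), ← Algebra.smul_def,
      mul_smul_comm]
  rw [this, h.resid_dP_mul, AlgHom.commutes, ← map_mul]
  exact IsScalarTower.algebraMap_apply _ _ _ _

theorem IsRes.Qpoly_dvd_of_mem (h : IsRes c0 e) (hc0 : c0 ∈ A.hyps) (hm : 1 ≤ m c0) {x : PS K n}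
    (hx : x ∈ idB A m c0 n * idJ A m c0 n) :
    algebraMap (PS K ℓ) (PS K n) (Qpoly (delArr A c0) m) ∣ x := by
  induction hx using Submodule.mul_induction_on' with
  | mem_mul_mem b hb g hg =>
    obtain ⟨t, ht⟩ := h.mem_Imod_zero hc0 (h.idB_smul_mem hc0 hm hb (h.mem_idJ_iff.1 hg))
    refine ⟨t, (ExteriorAlgebra.algebraMap_leftInverse (R := PS K n)
      (Fin n → PS K n)).injective ?_⟩
    rw [map_mul, ← Algebra.smul_def]
    exact ht
  | add x _ y _ hx hy => exact dvd_add hx hy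

theorem IsRes.mul_sq_mem (h : IsRes c0 e) {A1 : Arrangement K ℓ} {f : PS K ℓ}
    (hf : ∀ c ∈ A.hyps, c ∉ A1.hyps → _root_.linP c ^ m c ∣ f) (h0 : c0 ∈ A1.hyps) {y : PS K n}
    (hy : y ∈ idB A1 m c0 n * idJ A1 m c0 n) :
    algebraMap (PS K ℓ) (PS K n) f ^ 2 * y ∈ idB A m c0 n * idJ A m c0 n := by
  induction hy using Submodule.mul_induction_on' with
  | mem_mul_mem b hb g hg =>
    rw [show algebraMap (PS K ℓ) (PS K n) f ^ 2 * (b * g) =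
      algebraMap (PS K ℓ) (PS K n) f * b * (algebraMap (PS K ℓ) (PS K n) f * g) by ring]
    exact Ideal.mul_mem_mul (mul_mem_idB hf h0 h hb) (mul_mem_idJ hf h hg)
  | add x _ y _ hx hy => rw [mul_add]; exact add_mem hx hy

theorem IsRes.exists_X_pow_mul_mem (h : IsRes c0 e) (hc0 : c0 ∈ A.hyps) (hm : 1 ≤ m c0)
    (hlf : LocallyFreeAlong A m c0) (hlf' : LocallyFreeAlong A (mdel m c0) c0) :
    ∃ k, ∀ i, (X i : PS K n) ^ k ∈ Submodule.comap (LinearMap.mulRight (PS K n)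
      (algebraMap (PS K ℓ) (PS K n) (Qpoly (delArr A c0) m))) (idB A m c0 n * idJ A m c0 n) := by
  refine exists_X_pow_mem _ fun x hx => ?_
  have hx' : e x ≠ 0 := fun h0 => hx (h.inj (h0.trans (map_zero e).symm))
  refine ⟨algebraMap _ _ (coQ A (locArr A (e x)) m), ?_, fun P hP hPx => ?_⟩
  · have h1 : Module.Free (PS K ℓ) (Omega (locArr A (e x)) m 1) := hlf _ hx' (h.dot x)
    have h2 : Module.Free (PS K ℓ) (Omega (locArr A (e x)) (mdel m c0) 1) := hlf' _ hx' (h.dot x)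
    have := h.mul_sq_mem (dvd_coQ A (locArr A (e x)) m) (h.mem_locArr hc0 x)
      (h.Qpoly_mem_idB_mul_idJ (h.mem_locArr hc0 x) hm inferInstance inferInstance)
    rw [pow_two, mul_assoc, ← map_mul _ _ (Qpoly _ _),
      coQ_mul_Qpoly (locArr_subset A _) m (h.mem_locArr hc0 x)] at this
    exact this
  · obtain ⟨c, -, -, hc⟩ := h.exists_linP_mem_of_coQ_mem x hP hPx
    exact ⟨_, hc⟩

theorem IsPull.exists_X_pow_mem (h : IsPull e) {𝔞 : Ideal (PS K n)} {k : ℕ}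
    (hk : ∀ i, (X i : PS K n) ^ k ∈ 𝔞) :
    ∃ k, ∀ i, algebraMap (PS K ℓ) (PS K n) (X i) ^ k ∈ 𝔞 := by
  have : ∀ i, algebraMap (PS K ℓ) (PS K n) (X i) ∈ 𝔞.radical := fun i => by
    rw [h.algX, _root_.linP]
    exact Ideal.sum_mem _ fun j _ => Ideal.mul_mem_left _ _ ⟨k, hk j⟩
  choose k hk using this
  exact ⟨∑ i, k i, fun i => Ideal.mem_of_dvd _ (pow_dvd_pow _ <|
    Finset.single_le_sum (f := k) (fun _ _ => Nat.zero_le _) (Finset.mem_univ i)) (hk i)⟩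

/-- The residue ideals agree with principal ideals with complementary generators up to a finite
length quotient, and so do the residue modules. -/
theorem IsRes.exists_generators (h : IsRes c0 e) (hn : 2 ≤ n) (hc0 : c0 ∈ A.hyps) (hm : 1 ≤ m c0)
    (hlf : LocallyFreeAlong A m c0) (hlf' : LocallyFreeAlong A (mdel m c0) c0) :
    ∃ b : PS K n, b ≠ 0 ∧ ∃ k, ∀ i p,
      (∀ x ∈ Jmod A m c0 e (p + 1), (X i : PS K ℓ) ^ k • b • x ∈ Imod A m c0 e p) ∧
      ∀ x ∈ Imod A m c0 e p, ∃ y ∈ Jmod A m c0 e (p + 1), (X i : PS K ℓ) ^ k • x = b • y := by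
  obtain ⟨k, hk⟩ := h.exists_X_pow_mul_mem hc0 hm hlf hlf'
  have hq := h.alg_Qpoly_ne_zero (m := m) hc0
  obtain ⟨b, g, hbg, -, -, hmul⟩ := exists_factorization hq (fun x => h.Qpoly_dvd_of_mem hc0 hm)
    (isPrimitiveIdeal_of_X_pow_mem hn hk)
  obtain ⟨k, hk⟩ := h.toIsPull.exists_X_pow_mem hk
  rw [← hbg] at hq
  refine ⟨b, left_ne_zero_of_mul hq, k, fun i p => ⟨fun x hx => ?_, fun x hx => ?_⟩⟩
  · rw [← algebraMap_smul (PS K n), smul_smul, map_pow]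
    exact h.idB_smul_mem hc0 hm (hmul _ (hk i)).1 hx
  · obtain ⟨y, hy, hxy⟩ := h.idJ_smul_mem hc0 hm (hmul _ (hk i)).2 hx
    refine ⟨y, hy, smul_right_inj_extF (right_ne_zero_of_mul hq) ?_⟩
    rw [← algebraMap_smul (PS K n) (Qpoly _ _), ← hbg] at hxy
    rw [← algebraMap_smul (PS K n) ((X i : PS K ℓ) ^ k), smul_smul, map_pow, mul_comm g, hxy,
      smul_smul, mul_comm g]

end

/-! ### Tameness of the multiarrangement -/

theorem exists_isPull {n : ℕ} (e : (Fin n → K) →ₗ[K] (Fin ℓ → K)) :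
    ∃ _ : Algebra (PS K ℓ) (PS K n), IsPull e := by
  let σ : PS K ℓ →ₐ[K] PS K n := aeval fun i => linP (resF e (Pi.single i 1))
  let _ : Algebra (PS K ℓ) (PS K n) := σ.toRingHom.toAlgebra
  exact ⟨inferInstance, ⟨σ.commutes, fun i => aeval_X _ i⟩⟩

theorem exists_isHypEmbedding {c0 : Fin ℓ → K} (hc : c0 ≠ 0) :
    ∃ e : (Fin (ℓ - 1) → K) →ₗ[K] (Fin ℓ → K), IsHypEmbedding c0 e := by
  have h1 : Module.finrank K (LinearMap.ker (dotLin c0)) = ℓ - 1 := by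
    have hr : LinearMap.range (dotLin c0) = ⊤ := by
      obtain ⟨w, hw⟩ := exists_dual_vec hc
      refine LinearMap.range_eq_top.2 fun a => ⟨a • w, ?_⟩
      rw [map_smul, dotLin_apply, hw, smul_eq_mul, mul_one]
    have := LinearMap.finrank_range_add_finrank_ker (dotLin c0)
    rw [hr, finrank_top, Module.finrank_self, Module.finrank_fin_fun] at this
    omega
  let φ : (Fin (ℓ - 1) → K) ≃ₗ[K] LinearMap.ker (dotLin c0) :=
    LinearEquiv.ofFinrankEq _ _ (by rw [h1, Module.finrank_fin_fun])
  refine ⟨(LinearMap.ker (dotLin c0)).subtype ∘ₗ φ.toLinearMap,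
    Subtype.val_injective.comp φ.injective, ?_⟩
  rw [LinearMap.range_comp, LinearEquiv.range, Submodule.map_top, Submodule.range_subtype]

section

variable {n : ℕ} [Algebra (PS K ℓ) (PS K n)] {A : Arrangement K ℓ} {m : (Fin ℓ → K) → ℕ}
  {c0 : Fin ℓ → K} {e : (Fin n → K) →ₗ[K] (Fin ℓ → K)}

theorem PdLT.of_cofinite_le {M : Type} [AddCommGroup M] [Module (PS K ℓ) M]
    {I N : Submodule (PS K ℓ) M} [Module.Finite (PS K ℓ) N] (hle : I ≤ N) (k : ℕ)
    (hk : ∀ i, ∀ x ∈ N, (X i : PS K ℓ) ^ k • x ∈ I) {q : ℕ}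
    (hI : PdLT (PS K ℓ) I q) (hN : PdLT (PS K ℓ) N ℓ) : PdLT (PS K ℓ) N q :=
  PdLT.of_cofinite (Submodule.inclusion hle) (Submodule.inclusion_injective hle) k
    (fun i x => ⟨⟨_, hk i x.1 x.2⟩, rfl⟩) hI hN

theorem PdLT.of_exact_of_cofinite_map {M M' F : Type} [AddCommGroup M] [Module (PS K ℓ) M]
    [AddCommGroup M'] [Module (PS K ℓ) M'] [AddCommGroup F] [Module (PS K ℓ) F]
    {J N : Submodule (PS K ℓ) F} [Module.Finite (PS K ℓ) N] [Module.Finite (PS K ℓ) M]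
    (μ : F →ₗ[PS K ℓ] F) (hμ : Function.Injective μ) (hle : J.map μ ≤ N) (k : ℕ)
    (hk : ∀ i, ∀ x ∈ N, (X i : PS K ℓ) ^ k • x ∈ J.map μ) {q : ℕ}
    (hN : PdLT (PS K ℓ) N q) (f : M' →ₗ[PS K ℓ] M) (g : M →ₗ[PS K ℓ] J)
    (hf : Function.Injective f) (hg : Function.Surjective g) (hfg : Function.Exact f g)
    (hM' : PdLT (PS K ℓ) M' q) (hM : PdLT (PS K ℓ) M (ℓ - 1)) : PdLT (PS K ℓ) M q := by
  refine PdLT.of_exact_of_cofinite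
    (μ.restrict fun x hx => hle (Submodule.mem_map_of_mem hx))
    (fun x y hxy => Subtype.ext (hμ (congrArg Subtype.val hxy))) k (fun i x => ?_) hN f g hf hg
    hfg hM' hM
  obtain ⟨y, hy, hyx⟩ := hk i x.1 x.2
  exact ⟨⟨y, hy⟩, Subtype.ext hyx⟩

theorem finite_Omega (A : Arrangement K ℓ) (m : (Fin ℓ → K) → ℕ) (p : ℕ) :
    Module.Finite (PS K ℓ) (Omega A m p) := by
  have : IsNoetherian (PS K ℓ) (ExtF K ℓ) := isNoetherian_of_isNoetherianRing_of_finite _ _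
  exact Module.IsNoetherian.finite _ _

theorem IsRes.pdLT_Omega_succ (h : IsRes c0 e) (hn : 2 ≤ n) (hℓ : 2 ≤ ℓ) (hc0 : c0 ∈ A.hyps)
    (hm : 1 ≤ m c0) (hlf : LocallyFreeAlong A m c0) (hlf' : LocallyFreeAlong A (mdel m c0) c0)
    {p : ℕ} (h₁ : PdLT (PS K ℓ) (Omega A (mdel m c0) p) (p + 2))
    (h₂ : PdLT (PS K ℓ) (Omega A (mdel m c0) (p + 1)) (p + 2))
    (h₃ : PdLT (PS K ℓ) (Omega A m p) (p + 1)) :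
    PdLT (PS K ℓ) (Omega A m (p + 1)) (p + 2) := by
  obtain ⟨b, hb, k, hk⟩ := h.exists_generators hn hc0 hm hlf hlf'
  let μ : ExtF K n →ₗ[PS K ℓ] ExtF K n :=
    (LinearMap.lsmul (PS K n) (ExtF K n) b).restrictScalars (PS K ℓ)
  have hμ : Function.Injective μ := fun x y hxy => smul_right_inj_extF hb hxy
  set N := Imod A m c0 e p ⊔ (Jmod A m c0 e (p + 1)).map μ with hN
  have hI : ∀ i, ∀ x ∈ N, (X i : PS K ℓ) ^ k • x ∈ Imod A m c0 e p := by
    intro i x hx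
    obtain ⟨y, hy, _, ⟨z, hz, rfl⟩, rfl⟩ := Submodule.mem_sup.1 hx
    rw [smul_add]
    exact add_mem (Submodule.smul_mem _ _ hy) ((hk i p).1 z hz)
  have hJ : ∀ i, ∀ x ∈ N, (X i : PS K ℓ) ^ k • x ∈ (Jmod A m c0 e (p + 1)).map μ := by
    intro i x hx
    obtain ⟨y, hy, z, hz, rfl⟩ := Submodule.mem_sup.1 hx
    rw [smul_add]
    refine add_mem ?_ (Submodule.smul_mem _ _ hz)
    obtain ⟨w, hw, e1⟩ := (hk i p).2 y hy
    exact ⟨w, hw, e1.symm⟩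
  have := h.finite_submodule N
  have := finite_Omega A m (p + 1)
  have hNp : PdLT (PS K ℓ) N (p + 2) := PdLT.of_cofinite_le le_sup_left k hI
    (h.pdLT_Imod hc0 hm h₃ h₁) ((h.pdLT_submodule N).mono (max_le hℓ le_rfl))
  exact PdLT.of_exact_of_cofinite_map μ hμ le_sup_right k hJ hNp _ _
    (mulLinP_injective h.ne_zero hm (p + 1)) (toJmod_surjective (p + 1))
    (h.exact_toJmod hc0 hm (p + 1)) h₂ ((pdLT_Omega A m (p + 1)).mono (by omega))

end

theorem pdLT_Omega_zero (A : Arrangement K ℓ) (m : (Fin ℓ → K) → ℕ) :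
    PdLT (PS K ℓ) (Omega A m 0) 1 := by
  have hinj : Function.Injective (algebraMap (PS K ℓ) (ExtF K ℓ)) :=
    (ExteriorAlgebra.algebraMap_leftInverse (R := PS K ℓ) (Fin ℓ → PS K ℓ)).injective
  let f : PS K ℓ →ₗ[PS K ℓ] Omega A m 0 :=
    (Algebra.linearMap (PS K ℓ) (ExtF K ℓ) ∘ₗ LinearMap.mulLeft (PS K ℓ) (Qpoly A m)).codRestrict _
      fun t => mem_Omega_zero.2 ⟨t, rfl⟩
  have hf : Function.Bijective f := by
    refine ⟨fun x y hxy => mul_left_cancel₀ (Qpoly_ne_zero A m)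
      (hinj (congrArg Subtype.val hxy)), ?_⟩
    rintro ⟨x, hx⟩
    obtain ⟨t, rfl⟩ := mem_Omega_zero.1 hx
    exact ⟨t, rfl⟩
  exact PdLT.of_equiv (LinearEquiv.ofBijective f hf) (pdLT_one_iff.2 inferInstance)

theorem tameM_of_deletion {A : Arrangement K ℓ} {m : (Fin ℓ → K) → ℕ} {c0 : Fin ℓ → K}
    (hc0 : c0 ∈ A.hyps) (hm : 1 ≤ m c0) (hdel : TameM A (mdel m c0))
    (hlf : LocallyFreeAlong A m c0) (hlf' : LocallyFreeAlong A (mdel m c0) c0) : TameM A m := by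
  intro p
  rw [pdLE_iff]
  induction p with
  | zero => exact fun _ => pdLT_Omega_zero A m
  | succ p ih =>
    intro hp
    rcases le_or_gt ℓ 2 with hℓ | hℓ
    · exact (pdLT_Omega A m (p + 1)).mono (by omega)
    · obtain ⟨e, he⟩ := exists_isHypEmbedding (A.ne_zero c0 hc0)
      obtain ⟨_, h⟩ := exists_isPull e
      have h' : IsRes c0 e := ⟨h, he.1, he.2, A.ne_zero c0 hc0⟩
      exact h'.pdLT_Omega_succ (by omega) hℓ.le hc0 hm hlf hlf'
        ((pdLE_iff.1 (hdel p (by omega))).mono (by omega)) (pdLE_iff.1 (hdel (p + 1) hp))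
        (ih (by omega))

/-! ### Homogeneous vectors -/

section HomogeneousVectors

theorem homogeneousComponent_map_of_shift {n : ℕ} (T : PS K ℓ →+ PS K n) {D : ℕ}
    (hT : ∀ i a, a.IsHomogeneous i → (T a).IsHomogeneous (i + D)) (a : PS K ℓ) (d : ℕ) :
    homogeneousComponent d (T a) = if D ≤ d then T (homogeneousComponent (d - D) a) else 0 := by
  have hi : ∀ i, homogeneousComponent d (T (homogeneousComponent i a)) =
      if d = i + D then T (homogeneousComponent i a) else 0 := fun i =>
    homogeneousComponent_of_mem ((mem_homogeneousSubmodule _ _).2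
      (hT _ _ (homogeneousComponent_isHomogeneous _ _)))
  conv_lhs => rw [← sum_homogeneousComponent a]
  rw [map_sum, map_sum]
  simp only [hi]
  split_ifs with hle
  · by_cases hd : a.totalDegree < d - D
    · rw [homogeneousComponent_eq_zero _ _ hd, map_zero]
      refine Finset.sum_eq_zero fun i hi => if_neg ?_
      have := Finset.mem_range.1 hi
      omega
    · rw [Finset.sum_eq_single (d - D), if_pos (Nat.sub_add_cancel hle).symm]
      · intro i _ hne
        exact if_neg (by omega)
      · intro h
        exact absurd (Finset.mem_range.2 (by omega)) h
  · exact Finset.sum_eq_zero fun i _ => if_neg (by omega)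

theorem homogeneousComponent_mul_right {a b : PS K ℓ} {D : ℕ} (hb : b.IsHomogeneous D) (d : ℕ) :
    homogeneousComponent d (a * b) =
      if D ≤ d then homogeneousComponent (d - D) a * b else 0 :=
  homogeneousComponent_map_of_shift (AddMonoidHom.mulRight b) (fun _ _ ha => ha.mul hb) a d

theorem homogeneousComponent_of_isHomogeneous {a : PS K ℓ} {d : ℕ} (ha : a.IsHomogeneous d) :
    homogeneousComponent d a = a := by
  rw [homogeneousComponent_of_mem ((mem_homogeneousSubmodule d a).2 ha), if_pos rfl]

/-- A vector whose coordinates are all homogeneous of degree `d`. -/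
def IsHomogVec (d : ℕ) (v : Fin ℓ → PS K ℓ) : Prop := ∀ j, (v j).IsHomogeneous d

theorem IsHomogVec.coeff_isHomogeneous {ι : Type} [Fintype ι] {b : ι → Fin ℓ → PS K ℓ} {D : ι → ℕ}
    (hb : ∀ k, IsHomogVec (D k) (b k)) (hli : LinearIndependent (PS K ℓ) b) {d : ℕ}
    {y : Fin ℓ → PS K ℓ} (hy : IsHomogVec d y) {f : ι → PS K ℓ} (hf : y = ∑ k, f k • b k) (k : ι) :
    f k = if D k ≤ d then homogeneousComponent (d - D k) (f k) else 0 := by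
  have h : ∑ k, (if D k ≤ d then homogeneousComponent (d - D k) (f k) else 0) • b k = y := by
    funext j
    rw [← homogeneousComponent_of_isHomogeneous (hy j), hf, Finset.sum_apply, Finset.sum_apply,
      map_sum]
    refine Finset.sum_congr rfl fun k _ => ?_
    rw [Pi.smul_apply, Pi.smul_apply, smul_eq_mul, smul_eq_mul,
      homogeneousComponent_mul_right (hb k j)]
    split_ifs <;> simp
  have h0 : ∑ k, (f k - if D k ≤ d then homogeneousComponent (d - D k) (f k) else 0) • b k = 0 := by
    simp only [sub_smul, Finset.sum_sub_distrib]
    rw [h, ← hf, sub_self]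
  exact sub_eq_zero.1 (Fintype.linearIndependent_iff.1 hli _ h0 k)

theorem IsHomogVec.degree_eq_of_constantCoeff_ne_zero {ι : Type} [Fintype ι]
    {b : ι → Fin ℓ → PS K ℓ} {D : ι → ℕ}
    (hb : ∀ k, IsHomogVec (D k) (b k)) (hli : LinearIndependent (PS K ℓ) b) {d : ℕ}
    {y : Fin ℓ → PS K ℓ} (hy : IsHomogVec d y) {f : ι → PS K ℓ} (hf : y = ∑ k, f k • b k) (k : ι)
    (hk : constantCoeff (f k) ≠ 0) : D k = d := by
  have h := IsHomogVec.coeff_isHomogeneous hb hli hy hf k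
  by_contra hne
  split_ifs at h with hle
  · apply hk
    rw [h, constantCoeff_eq]
    refine (homogeneousComponent_isHomogeneous _ _).coeff_eq_zero ?_
    simp only [map_zero]
    omega
  · exact hk (by rw [h, map_zero])

/-- Two homogeneous bases of the same module have the same degrees. -/
theorem exists_perm_degree {u w : Fin ℓ → Fin ℓ → PS K ℓ} {E D : Fin ℓ → ℕ}
    (hu : ∀ k, IsHomogVec (E k) (u k)) (hw : ∀ k, IsHomogVec (D k) (w k))
    (hli : LinearIndependent (PS K ℓ) u)
    (huw : ∀ k, u k ∈ Submodule.span (PS K ℓ) (Set.range w))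
    (hwu : ∀ k, w k ∈ Submodule.span (PS K ℓ) (Set.range u)) :
    ∃ σ : Equiv.Perm (Fin ℓ), ∀ k, E k = D (σ k) := by
  simp only [Submodule.mem_span_range_iff_exists_fun] at huw hwu
  choose P hP using huw
  choose Q hQ using hwu
  have hPQ : Matrix.of P * Matrix.of Q = 1 := by
    ext1 k k'
    have h : ∑ k', (∑ i, P k i * Q i k' - (1 : Matrix (Fin ℓ) (Fin ℓ) (PS K ℓ)) k k') • u k' = 0 := by
      simp only [sub_smul, Finset.sum_sub_distrib, Finset.sum_smul, mul_smul]
      rw [Finset.sum_comm]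
      simp only [← Finset.smul_sum, hQ, hP, Matrix.one_apply, ite_smul, one_smul, zero_smul]
      simp
    exact sub_eq_zero.1 (Fintype.linearIndependent_iff.1 hli _ h k')
  have hdet : (((Matrix.of Q).map constantCoeff).det : K) ≠ 0 := by
    intro h0
    have := congrArg (fun M : Matrix (Fin ℓ) (Fin ℓ) (PS K ℓ) => constantCoeff M.det) hPQ
    simp only [Matrix.det_mul, map_mul, Matrix.det_one, map_one, RingHom.map_det,
      RingHom.mapMatrix_apply] at this
    rw [h0, mul_zero] at this
    exact zero_ne_one this
  rw [Matrix.det_apply] at hdet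
  obtain ⟨σ, -, hσ⟩ := Finset.exists_ne_zero_of_sum_ne_zero hdet
  refine ⟨σ, fun k => ?_⟩
  refine IsHomogVec.degree_eq_of_constantCoeff_ne_zero hu hli (hw (σ k)) (hQ (σ k)).symm k
    fun h0 => hσ ?_
  rw [Finset.prod_eq_zero (Finset.mem_univ k) (by simpa using h0), smul_zero]

theorem det_isHomogeneous {v : Fin ℓ → Fin ℓ → PS K ℓ} {D : Fin ℓ → ℕ}
    (hv : ∀ k, IsHomogVec (D k) (v k)) : (Matrix.of v).det.IsHomogeneous (∑ k, D k) := by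
  rw [← Matrix.det_transpose, Matrix.det_apply]
  refine IsHomogeneous.sum _ _ _ fun σ _ => ?_
  have : (∏ i, (Matrix.of v).transpose (σ i) i).IsHomogeneous (∑ k, D k) :=
    IsHomogeneous.prod _ _ _ fun i _ => hv i (σ i)
  rw [Units.smul_def, ← mem_homogeneousSubmodule]
  exact Submodule.smul_of_tower_mem _ _ ((mem_homogeneousSubmodule _ _).2 this)

theorem IsHomogForm.exists_vec {d : ℕ} {η : ExtF K ℓ} (h : IsHomogForm 1 d η) :
    ∃ v, IsHomogVec d v ∧ η = ExteriorAlgebra.ι (PS K ℓ) v := by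
  refine AddSubgroup.closure_induction (p := fun η _ => ∃ v, IsHomogVec d v ∧
    η = ExteriorAlgebra.ι (PS K ℓ) v) ?_ ?_ ?_ ?_ h
  · rintro _ ⟨f, l, hf, hl, rfl⟩
    obtain ⟨i, rfl⟩ := List.length_eq_one_iff.1 hl
    refine ⟨f • Pi.single i 1, fun j => ?_, ?_⟩
    · rw [Pi.smul_apply, Pi.single_apply]
      split_ifs
      · simpa using hf
      · rw [smul_zero]; exact isHomogeneous_zero _ _ _
    · rw [map_smul]; simp [wedgeList]
  · exact ⟨0, fun j => isHomogeneous_zero _ _ _, (map_zero _).symm⟩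
  · rintro _ _ _ _ ⟨v, hv, rfl⟩ ⟨w, hw, rfl⟩
    exact ⟨v + w, fun j => (hv j).add (hw j), (map_add _ _ _).symm⟩
  · rintro _ _ ⟨v, hv, rfl⟩
    exact ⟨-v, fun j => (hv j).neg, (map_neg _ _).symm⟩

end HomogeneousVectors

section HomogeneousRestriction

variable {n : ℕ} [Algebra (PS K ℓ) (PS K n)] {e : (Fin n → K) →ₗ[K] (Fin ℓ → K)}

theorem IsPull.isHomogeneous_map (h : IsPull e) {s : PS K ℓ} {d : ℕ} (hs : s.IsHomogeneous d) :
    (algebraMap (PS K ℓ) (PS K n) s).IsHomogeneous d := by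
  have hs' : algebraMap (PS K ℓ) (PS K n) =
      eval₂Hom C (fun i => _root_.linP (resF e (Pi.single i 1))) :=
    MvPolynomial.ringHom_ext (fun a => by simp [h.algC]) (fun i => by simp [h.algX])
  rw [hs', ← one_mul d]
  exact hs.eval₂ _ _ (fun _ => isHomogeneous_C _ _) fun i => linP_isHomogeneous _

theorem IsPull.homogeneousComponent_map (h : IsPull e) (s : PS K ℓ) (d : ℕ) :
    homogeneousComponent d (algebraMap (PS K ℓ) (PS K n) s) =
      algebraMap (PS K ℓ) (PS K n) (homogeneousComponent d s) := by
  simpa using homogeneousComponent_map_of_shift (algebraMap (PS K ℓ) (PS K n)).toAddMonoidHom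
    (D := 0) (fun i a ha => h.isHomogeneous_map ha) s d

end HomogeneousRestriction

/-! ### Saito's criterion -/

section Saito

variable {A : Arrangement K ℓ} {m : (Fin ℓ → K) → ℕ}

theorem ι_injective : Function.Injective
    (ExteriorAlgebra.ι (PS K ℓ) : (Fin ℓ → PS K ℓ) →ₗ[PS K ℓ] ExtF K ℓ) :=
  (ExteriorAlgebra.ι_leftInverse (R := PS K ℓ) (M := Fin ℓ → PS K ℓ)).injective

theorem ι_mem_Omega {v : Fin ℓ → PS K ℓ} : ExteriorAlgebra.ι (PS K ℓ) v ∈ Omega A m 1 ↔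
    ∀ c ∈ A.hyps, ∃ (s : PS K ℓ) (z : Fin ℓ → PS K ℓ), v = s • cvec c + linP c ^ m c • z := by
  rw [mem_Omega]
  constructor
  · rintro ⟨-, h⟩ c hc
    obtain ⟨ζ, hζ⟩ := h c hc
    obtain ⟨w, hw⟩ := exists_dual_vec (A.ne_zero c hc)
    have hv : constFun w (cvec c) = 1 := by rw [constFun_cvec, hw, map_one]
    have h1 := eq_of_dP_mul hv hζ
    rw [ctr_ι, dP_eq, ← Algebra.commutes, ← Algebra.smul_def, ← map_smul, ← sub_eq_iff_eq_add',
      ← map_sub] at h1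
    have h2 := mem_formsP_of_smul (p := 1) (pow_ne_zero (m c) (linP_ne_zero (A.ne_zero c hc)))
      (h1 ▸ ι_mem_formsP _)
    obtain ⟨z, hz⟩ := mem_formsP_one h2
    refine ⟨constFun w v, z, sub_eq_iff_eq_add'.1 (ι_injective ?_)⟩
    rw [h1, hz, map_smul]
  · intro h
    refine ⟨ι_mem_formsP v, fun c hc => ?_⟩
    obtain ⟨s, z, rfl⟩ := h c hc
    refine ⟨dP c * ExteriorAlgebra.ι _ z, ?_⟩
    rw [map_add, map_smul, map_smul, mul_add, mul_smul_comm, mul_smul_comm, dP_eq,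
      ExteriorAlgebra.ι_sq_zero, smul_zero, zero_add]

theorem pow_dvd_det {v : Fin ℓ → Fin ℓ → PS K ℓ} {c : Fin ℓ → K} (hc : c ≠ 0) {a : PS K ℓ}
    (h : ∀ i, ∃ (s : PS K ℓ) (z : Fin ℓ → PS K ℓ), v i = s • cvec c + a • z) : a ^ (ℓ - 1) ∣ (Matrix.of v).det := by
  obtain ⟨k, hk⟩ : ∃ k, c k ≠ 0 := by
    by_contra! h
    exact hc (funext h)
  choose s z hz using h
  have hcol : (Matrix.of v).det = (Matrix.of (fun i j => if j = k then v i k else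
      v i j - C (c j / c k) * v i k)).det := by
    rw [← Matrix.det_transpose, ← Matrix.det_transpose (Matrix.of fun i j => _)]
    refine Matrix.det_eq_of_forall_row_eq_smul_add_const
      (fun j => if j = k then 0 else C (c j / c k)) k (if_pos rfl) fun j i => ?_
    by_cases hj : j = k
    · subst hj; simp
    · simp [hj]
  have hfac : Matrix.of (fun i j => if j = k then v i k else v i j - C (c j / c k) * v i k) =
      Matrix.of (fun i j => if j = k then v i k else z i j - C (c j / c k) * z i k) *
        Matrix.diagonal (fun j => if j = k then 1 else a) := by
    ext1 i j
    rw [Matrix.mul_diagonal]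
    by_cases hj : j = k
    · simp [hj]
    · have hck : (C (c j) : PS K ℓ) = C (c j / c k) * C (c k) := by
        rw [← map_mul, div_mul_cancel₀ _ hk]
      simp only [Matrix.of_apply, if_neg hj, hz i, Pi.add_apply, Pi.smul_apply, smul_eq_mul, cvec,
        hck]
      ring
  rw [hcol, hfac, Matrix.det_mul, Matrix.det_diagonal]
  refine Dvd.dvd.mul_left (dvd_of_eq ?_) _
  rw [Finset.prod_ite, Finset.prod_const_one, one_mul, Finset.prod_const, Finset.filter_ne',
    Finset.card_erase_of_mem (Finset.mem_univ k), Finset.card_univ, Fintype.card_fin]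

theorem Qpoly_isHomogeneous (A : Arrangement K ℓ) (m : (Fin ℓ → K) → ℕ) :
    (Qpoly A m).IsHomogeneous (msum A m) := by
  refine IsHomogeneous.prod _ _ _ fun c _ => ?_
  simpa using (linP_isHomogeneous c).pow (m c)

/-- Saito's criterion: the degrees of a homogeneous basis of `Ω¹(A,m)` add up to
`(ℓ - 1)|m|`. -/
theorem sum_degree_eq (hℓ : 1 ≤ ℓ) {v : Fin ℓ → Fin ℓ → PS K ℓ} {D : Fin ℓ → ℕ}
    (hv : ∀ i, ExteriorAlgebra.ι (PS K ℓ) (v i) ∈ Omega A m 1) (hD : ∀ i, IsHomogVec (D i) (v i))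
    (hli : LinearIndependent (PS K ℓ) v)
    (hspan : ∀ y, ExteriorAlgebra.ι (PS K ℓ) y ∈ Omega A m 1 →
      y ∈ Submodule.span (PS K ℓ) (Set.range v)) :
    ∑ i, D i = (ℓ - 1) * msum A m := by
  have hmem : ∀ j : Fin ℓ, ExteriorAlgebra.ι (PS K ℓ)
      (Qpoly A m • (Pi.single j 1 : Fin ℓ → PS K ℓ)) ∈ Omega A m 1 := fun j => by
    rw [map_smul]; exact Qpoly_smul_mem_Omega A m (ι_mem_formsP _)
  have hT := fun j => (Submodule.mem_span_range_iff_exists_fun _).1 (hspan _ (hmem j))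
  choose T hT using hT
  have hTV : Matrix.of T * Matrix.of v = Qpoly A m • (1 : Matrix (Fin ℓ) (Fin ℓ) (PS K ℓ)) := by
    ext1 i j
    have := congrFun (hT i) j
    simpa [Matrix.mul_apply, Matrix.one_apply, Pi.single_apply, eq_comm] using this
  have hdet : (Matrix.of T).det * (Matrix.of v).det = Qpoly A m ^ ℓ := by
    rw [← Matrix.det_mul, hTV, Matrix.det_smul, Matrix.det_one, mul_one, Fintype.card_fin]
  have hdT : Qpoly A m ∣ (Matrix.of T).det := by
    refine Qpoly_dvd A m fun c hc => ?_
    have hc' : ExteriorAlgebra.ι (PS K ℓ) (Qpoly (delArr A c) m • cvec c) ∈ Omega A m 1 := by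
      rw [map_smul]; exact smul_dP_mem_Omega A m c
    obtain ⟨t, ht⟩ := (Submodule.mem_span_range_iff_exists_fun _).1 (hspan _ hc')
    have hvec : Matrix.vecMul (cvec c) (Matrix.of T) = linP c ^ m c • t := by
      have h0 : ∑ k, (Matrix.vecMul (cvec c) (Matrix.of T) - linP c ^ m c • t) k • v k = 0 := by
        simp only [Pi.sub_apply, Pi.smul_apply, sub_smul, Finset.sum_sub_distrib, smul_assoc]
        rw [← Finset.smul_sum, ht, smul_smul, ← Qpoly_eq_mul m hc]
        simp only [Matrix.vecMul, dotProduct, Finset.sum_smul, mul_smul, Matrix.of_apply]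
        rw [Finset.sum_comm]
        simp only [← Finset.smul_sum, hT]
        rw [sub_eq_zero]
        simp only [smul_comm _ (Qpoly A m), ← Finset.smul_sum]
        congr 1
        funext j
        simp [Finset.sum_apply, Pi.single_apply]
      funext k
      exact sub_eq_zero.1 (Fintype.linearIndependent_iff.1 hli _ h0 k)
    obtain ⟨k, hk⟩ : ∃ k, c k ≠ 0 := by
      by_contra! h
      exact A.ne_zero c hc (funext h)
    have h1 := congrArg (fun w => Matrix.vecMul w (Matrix.of T).adjugate k) hvec
    simp only [Matrix.vecMul_vecMul, Matrix.mul_adjugate, Matrix.vecMul_smul, Matrix.vecMul_one,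
      Matrix.smul_vecMul, Pi.smul_apply, smul_eq_mul] at h1
    have h2 : (Matrix.of T).det = C (c k)⁻¹ * ((Matrix.of T).det * cvec c k) := by
      rw [cvec, mul_left_comm, ← map_mul, inv_mul_cancel₀ hk, map_one, mul_one]
    rw [h2, h1]
    exact Dvd.dvd.mul_left (dvd_mul_right _ _) _
  have hdV : Qpoly A m ^ (ℓ - 1) ∣ (Matrix.of v).det := by
    have hpow : Qpoly A m ^ (ℓ - 1) = Qpoly A (fun c => m c * (ℓ - 1)) := by
      simp only [Qpoly, pow_mul, Finset.prod_pow]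
    rw [hpow]
    refine Qpoly_dvd A _ fun c hc => ?_
    rw [pow_mul]
    exact pow_dvd_det (A.ne_zero c hc) fun i => ι_mem_Omega.1 (hv i) c hc
  obtain ⟨t, ht⟩ := hdT
  obtain ⟨b, hb⟩ := hdV
  have hQ := Qpoly_ne_zero A m
  have htb : t * b = 1 := by
    apply mul_left_cancel₀ (pow_ne_zero ℓ hQ)
    have hpow : Qpoly A m ^ ℓ = Qpoly A m ^ (ℓ - 1) * Qpoly A m := by
      rw [← pow_succ, Nat.sub_add_cancel hℓ]
    rw [mul_one, ← mul_one (Qpoly A m ^ ℓ)]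
    conv_rhs => rw [mul_one, ← hdet, ht, hb]
    rw [hpow]
    ring
  have ht0 : t ≠ 0 := left_ne_zero_of_mul_eq_one htb
  have hb0 : b ≠ 0 := right_ne_zero_of_mul_eq_one htb
  have hdeg := totalDegree_mul_of_isDomain ht0 hb0
  rw [htb, totalDegree_one] at hdeg
  have hdV0 : (Matrix.of v).det ≠ 0 := by rw [hb]; exact mul_ne_zero (pow_ne_zero _ hQ) hb0
  rw [← (det_isHomogeneous hD).totalDegree hdV0, hb,
    totalDegree_mul_of_isDomain (pow_ne_zero _ hQ) hb0,
    ((Qpoly_isHomogeneous A m).pow (ℓ - 1)).totalDegree (pow_ne_zero _ hQ), mul_comm]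
  omega

end Saito

/-! ### Exponents of rank two localizations -/

section Exponents

variable {A : Arrangement K ℓ} {m : (Fin ℓ → K) → ℕ}

theorem FreeWithExp.exists_vec {d : Fin ℓ → ℕ} (h : FreeWithExp A m d) :
    ∃ v : Fin ℓ → Fin ℓ → PS K ℓ, (∀ i, ExteriorAlgebra.ι (PS K ℓ) (v i) ∈ Omega A m 1) ∧
      (∀ i, IsHomogVec (msum A m - d i) (v i)) ∧ LinearIndependent (PS K ℓ) v ∧
      ∀ y, ExteriorAlgebra.ι (PS K ℓ) y ∈ Omega A m 1 →
        y ∈ Submodule.span (PS K ℓ) (Set.range v) := by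
  obtain ⟨b, hb, hd, hli, hsp⟩ := h
  choose v hv hbv using fun i => (hd i).exists_vec
  obtain rfl : b = fun i => ExteriorAlgebra.ι (PS K ℓ) (v i) := funext hbv
  refine ⟨v, hb, hv, LinearIndependent.of_comp (ExteriorAlgebra.ι (PS K ℓ)) hli, fun y hy => ?_⟩
  obtain ⟨f, hf⟩ := (Submodule.mem_span_range_iff_exists_fun _).1 (hsp hy)
  refine (Submodule.mem_span_range_iff_exists_fun _).2 ⟨f, ι_injective ?_⟩
  rw [← hf, map_sum]
  simp only [map_smul]

theorem FreeWithExp.projective {d : Fin ℓ → ℕ} (h : FreeWithExp A m d) :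
    Module.Projective (PS K ℓ) (Omega A m 1) := by
  obtain ⟨b, hb, -, hli, hsp⟩ := h
  let b' : Fin ℓ → Omega A m 1 := fun i => ⟨b i, hb i⟩
  have hli' : LinearIndependent (PS K ℓ) b' :=
    LinearIndependent.of_comp (Omega A m 1).subtype hli
  have hsp' : ⊤ ≤ Submodule.span (PS K ℓ) (Set.range b') := fun y _ => by
    obtain ⟨f, hf⟩ := (Submodule.mem_span_range_iff_exists_fun _).1 (hsp y.2)
    refine (Submodule.mem_span_range_iff_exists_fun _).2 ⟨f, Subtype.ext ?_⟩
    rw [← hf, AddSubmonoidClass.coe_finsetSum]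
    rfl
  exact Module.Projective.of_basis (Module.Basis.mk hli' hsp')

theorem eq_zero_of_isHomogVec_zero (hm : ∀ c ∈ A.hyps, 0 < m c) {c c0 : Fin ℓ → K}
    (hc : c ∈ A.hyps) (hc0 : c0 ∈ A.hyps) (hne : c ≠ c0) {v : Fin ℓ → PS K ℓ}
    (hv : IsHomogVec 0 v) (hmem : ExteriorAlgebra.ι (PS K ℓ) v ∈ Omega A m 1) : v = 0 := by
  have key : ∀ c ∈ A.hyps, ∃ s : K, ∀ j, constantCoeff (v j) = s * c j := by
    intro c hc
    obtain ⟨s, z, hs⟩ := ι_mem_Omega.1 hmem c hc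
    refine ⟨constantCoeff s, fun j => ?_⟩
    have h0 : constantCoeff (linP c) = 0 := by simp [linP]
    rw [hs]
    simp [cvec, h0, (hm c hc).ne']
  obtain ⟨s, hs⟩ := key c hc
  obtain ⟨s0, hs0⟩ := key c0 hc0
  have hs' : s = 0 := by
    by_contra hs'
    refine A.nonprop c hc c0 hc0 hne (s⁻¹ * s0) (funext fun j => ?_)
    rw [Pi.smul_apply, smul_eq_mul, mul_assoc, ← hs0 j, hs j, inv_mul_cancel_left₀ hs']
  funext j
  rw [← homogeneousComponent_of_isHomogeneous (hv j), homogeneousComponent_zero,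
    ← constantCoeff_eq, hs j, hs']
  simp

variable {n : ℕ} [Algebra (PS K ℓ) (PS K n)] {c0 : Fin ℓ → K} {e : (Fin n → K) →ₗ[K] (Fin ℓ → K)}

theorem IsPull.exists_homogeneous_lift (h : IsPull e)
    (hsurj : Function.Surjective (algebraMap (PS K ℓ) (PS K n))) {g x : PS K n} {j D : ℕ}
    (hg : g.IsHomogeneous j) (hx : x.IsHomogeneous D) (hgx : g ∣ x) :
    ∃ s : PS K ℓ, x = g * algebraMap (PS K ℓ) (PS K n) s ∧
      (s = 0 ∨ j ≤ D ∧ s.IsHomogeneous (D - j)) := by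
  obtain ⟨r, hr⟩ := hgx
  obtain ⟨s, rfl⟩ := hsurj r
  have h1 := homogeneousComponent_mul_right (a := algebraMap (PS K ℓ) (PS K n) s) hg D
  rw [mul_comm, ← hr, homogeneousComponent_of_isHomogeneous hx, h.homogeneousComponent_map] at h1
  split_ifs at h1 with hle
  · exact ⟨_, by rw [h1, mul_comm], Or.inr ⟨hle, homogeneousComponent_isHomogeneous _ _⟩⟩
  · exact ⟨0, by rw [h1, map_zero, mul_zero], Or.inl rfl⟩

theorem IsRes.exists_perm_degree (h : IsRes c0 e) {v u : Fin ℓ → Fin ℓ → PS K ℓ} {D E : Fin ℓ → ℕ}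
    (hv : ∀ i, IsHomogVec (D i) (v i)) (hu : ∀ i, IsHomogVec (E i) (u i))
    (hli : LinearIndependent (PS K ℓ) u)
    (ρ : (Fin ℓ → PS K ℓ) →ₗ[PS K ℓ] PS K n)
    (hρ : ∀ d y, IsHomogVec d y → (ρ y).IsHomogeneous d)
    {g : PS K n} {j : ℕ} (hg0 : g ≠ 0) (hg : g.IsHomogeneous j) (hgv : ∀ i, g ∣ ρ (v i))
    (hgmem : ∃ y ∈ Submodule.span (PS K ℓ) (Set.range v), ρ y = g)
    (huv : ∀ k, u k ∈ Submodule.span (PS K ℓ) (Set.range v)) (hu0 : ∀ k, ρ (u k) = 0)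
    (hvu : ∀ y ∈ Submodule.span (PS K ℓ) (Set.range v), ρ y = 0 →
      y ∈ Submodule.span (PS K ℓ) (Set.range u)) :
    ∃ i₀, D i₀ = j ∧ ∃ σ : Equiv.Perm (Fin ℓ), ∀ k,
      E k = Function.update D i₀ (D i₀ + 1) (σ k) := by
  choose s hs hs' using fun i => h.toIsPull.exists_homogeneous_lift h.alg_surjective hg
    (hρ _ _ (hv i)) (hgv i)
  have hsmul : ∀ (a : PS K ℓ) (x : PS K n), a • x = algebraMap (PS K ℓ) (PS K n) a * x :=
    fun a x => Algebra.smul_def a x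
  have hcc : ∀ a : PS K ℓ, constantCoeff (algebraMap (PS K ℓ) (PS K n) a) = constantCoeff a := by
    intro a
    have := h.toIsPull.homogeneousComponent_map a 0
    rw [homogeneousComponent_zero, homogeneousComponent_zero, h.algC] at this
    exact C_injective _ _ this
  obtain ⟨i₀, hi₀⟩ : ∃ i, constantCoeff (s i) ≠ 0 := by
    by_contra! h0
    obtain ⟨y, hy, hyg⟩ := hgmem
    obtain ⟨f, rfl⟩ := (Submodule.mem_span_range_iff_exists_fun _).1 hy
    have h1 : g * ∑ i, algebraMap (PS K ℓ) (PS K n) (f i) * algebraMap (PS K ℓ) (PS K n) (s i)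
        = g * 1 := by
      refine (Eq.trans ?_ hyg).trans (mul_one g).symm
      rw [map_sum, Finset.mul_sum]
      refine Finset.sum_congr rfl fun i _ => ?_
      rw [map_smul, hs, hsmul]; ring
    have h2 := congrArg constantCoeff (mul_left_cancel₀ hg0 h1)
    simp [hcc, h0] at h2
  have hj : D i₀ = j ∧ ∃ a : K, a ≠ 0 ∧ s i₀ = C a := by
    rcases hs' i₀ with h0 | ⟨hle, h0⟩
    · rw [h0, map_zero] at hi₀
      exact absurd rfl hi₀
    · have hD : D i₀ - j = 0 := by
        by_contra hne
        refine hi₀ ?_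
        rw [constantCoeff_eq]
        exact h0.coeff_eq_zero (by simpa using Ne.symm hne)
      refine ⟨by omega, _, hi₀, ?_⟩
      rw [hD] at h0
      conv_lhs => rw [← homogeneousComponent_of_isHomogeneous h0, homogeneousComponent_zero]
      rfl
  obtain ⟨hDj, a, ha, hsa⟩ := hj
  set α := _root_.linP c0 with hα
  have hα0 : algebraMap (PS K ℓ) (PS K n) α = 0 := h.alg_self
  let w : Fin ℓ → Fin ℓ → PS K ℓ := fun i =>
    if i = i₀ then α • v i₀ else (C a : PS K ℓ) • v i - s i • v i₀
  have hw : ∀ i, w i ∈ Submodule.span (PS K ℓ) (Set.range v) := by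
    intro i
    have hv' := fun i => Submodule.subset_span (R := PS K ℓ) (Set.mem_range_self (f := v) i)
    by_cases hi : i = i₀
    · simp only [w, if_pos hi]
      exact Submodule.smul_mem _ _ (hv' _)
    · simp only [w, if_neg hi]
      exact sub_mem (Submodule.smul_mem _ _ (hv' _)) (Submodule.smul_mem _ _ (hv' _))
  refine ⟨i₀, hDj, _root_.exists_perm_degree (w := w) hu (fun i => ?_) hli (fun k => ?_) fun i => ?_⟩
  · by_cases hi : i = i₀
    · subst hi
      simp only [w, if_true, Function.update_self]
      intro k
      rw [add_comm]
      exact (linP_isHomogeneous c0).mul (hv i k)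
    · simp only [w, if_neg hi, Function.update_of_ne hi]
      intro k
      refine IsHomogeneous.sub ?_ ?_
      · have := (isHomogeneous_C (Fin ℓ) a).mul (hv i k)
        rwa [zero_add] at this
      · rcases hs' i with h0 | ⟨hle, h0⟩
        · rw [h0, zero_smul]; exact isHomogeneous_zero _ _ _
        · have := h0.mul (hv i₀ k)
          rwa [hDj, Nat.sub_add_cancel hle] at this
  · obtain ⟨f, hf⟩ := (Submodule.mem_span_range_iff_exists_fun _).1 (huv k)
    have hfs : α ∣ ∑ i, f i * s i := by
      rw [← Ideal.mem_span_singleton, ← h.ker, RingHom.mem_ker]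
      apply mul_left_cancel₀ hg0
      rw [mul_zero, ← hu0 k, ← hf, map_sum, map_sum, Finset.mul_sum]
      refine Finset.sum_congr rfl fun i _ => ?_
      rw [map_smul, hs, hsmul, map_mul]; ring
    obtain ⟨t, ht⟩ := hfs
    have hw' := fun i => Submodule.subset_span (R := PS K ℓ) (Set.mem_range_self (f := w) i)
    have hsum : (C a : PS K ℓ) • u k =
        ∑ i, (if i = i₀ then t else f i) • w i := by
      rw [← Finset.add_sum_erase _ _ (Finset.mem_univ i₀)]
      have h1 : ∑ i ∈ Finset.univ.erase i₀, (if i = i₀ then t else f i) • w i =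
          ∑ i ∈ Finset.univ.erase i₀, f i • ((C a : PS K ℓ) • v i - s i • v i₀) := by
        refine Finset.sum_congr rfl fun i hi => ?_
        have := Finset.ne_of_mem_erase hi
        simp only [w, if_neg this]
      have h2 : ∑ i, f i • ((C a : PS K ℓ) • v i - s i • v i₀) =
          (C a : PS K ℓ) • u k - (∑ i, f i * s i) • v i₀ := by
        simp only [smul_sub, Finset.sum_sub_distrib, Finset.sum_smul, mul_smul]
        rw [← hf, Finset.smul_sum]
        simp only [smul_comm (C a : PS K ℓ)]
      rw [h1, ← add_right_inj (f i₀ • ((C a : PS K ℓ) • v i₀ - s i₀ • v i₀)), add_left_comm,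
        Finset.add_sum_erase _ (fun i => f i • ((C a : PS K ℓ) • v i - s i • v i₀))
          (Finset.mem_univ i₀), h2, ht, hsa]
      simp only [w, if_true, sub_self, smul_zero, zero_add, smul_smul]
      rw [mul_comm α t]; abel
    have h3 : u k = (C a⁻¹ : PS K ℓ) • (C a : PS K ℓ) • u k := by
      rw [smul_smul, ← map_mul, inv_mul_cancel₀ ha, map_one, one_smul]
    rw [h3, hsum]
    exact Submodule.smul_mem _ _ (Submodule.sum_mem _ fun i _ => Submodule.smul_mem _ _ (hw' i))
  · refine hvu _ (hw i) ?_
    by_cases hi : i = i₀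
    · simp only [w, if_pos hi]
      rw [map_smul, hsmul, hα0, zero_mul]
    · simp only [w, if_neg hi]
      rw [map_sub, map_smul, map_smul, hs, hs, hsmul, hsmul, hsa, h.algC]
      ring

end Exponents

section ExponentsOfRankTwo

theorem sum_update_add {ι : Type} [Fintype ι] [DecidableEq ι] (F : ℕ → ℕ) (D : ι → ℕ) (i : ι) (x : ℕ) :
    ∑ k, F (Function.update D i x k) + F (D i) = ∑ k, F (D k) + F x := by
  rw [← Finset.add_sum_erase _ _ (Finset.mem_univ i),
    ← Finset.add_sum_erase (Finset.univ) (fun k => F (D k)) (Finset.mem_univ i)]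
  rw [Finset.sum_congr rfl fun k hk => by
    rw [Function.update_of_ne (Finset.ne_of_mem_erase hk)], Function.update_self]
  omega

theorem exponent_eq (hℓ : 2 ≤ ℓ) {N d1 d2 : ℕ} {D E : Fin ℓ → ℕ}
    (hD : ∀ i, D i = N - expVec d1 d2 i) (hE : ∀ i, E i = N - 1 - expVec (d1 - 1) d2 i + 1)
    (hpos : ∀ i, 1 ≤ D i) (hsum : ∑ i, D i = (ℓ - 1) * N) (i₀ : Fin ℓ)
    (hperm : ∃ σ : Equiv.Perm (Fin ℓ), ∀ k, E k = Function.update D i₀ (D i₀ + 1) (σ k)) :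
    D i₀ = d2 ∧ d1 + d2 = N := by
  obtain ⟨k, rfl⟩ : ∃ k, ℓ = k + 2 := ⟨ℓ - 2, by omega⟩
  obtain ⟨σ, hσ⟩ := hperm
  have hsumE : ∀ F : ℕ → ℕ, ∑ i, F (E i) = ∑ i, F (Function.update D i₀ (D i₀ + 1) i) := fun F =>
    (Finset.sum_congr rfl fun i _ => by rw [hσ]).trans
      (Equiv.sum_comp σ fun i => F (Function.update D i₀ (D i₀ + 1) i))
  have h0 : D 0 = N - d1 := by simpa [expVec] using hD 0
  have h1 : D 1 = N - d2 := by simpa [expVec] using hD 1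
  have h2 : ∀ i : Fin k, D i.succ.succ = N := fun i => by simpa [expVec] using hD i.succ.succ
  have p0 := hpos 0
  have p1 := hpos 1
  have hN : d1 + d2 = N := by
    rw [Fin.sum_univ_succ, Fin.sum_univ_succ] at hsum
    simp only [h2, Finset.sum_const, Finset.card_univ, Fintype.card_fin, smul_eq_mul,
      Fin.succ_zero_eq_one] at hsum
    have : (k + 2 - 1) * N = k * N + N := by rw [show k + 2 - 1 = k + 1 from rfl]; ring
    omega
  refine ⟨?_, hN⟩
  by_cases hd1 : d1 = 0
  · have hED : E = D := by
      funext i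
      rw [hE, hD]
      have := hpos i
      rw [hD] at this
      subst hd1
      omega
    have e1 := hsumE id
    have e2 := sum_update_add id D i₀ (D i₀ + 1)
    rw [hED] at e1
    simp only [id] at e1 e2
    omega
  · have hED : E = Function.update D 0 (D 0 + 1) := by
      funext i
      by_cases hi : i = 0
      · subst hi
        rw [Function.update_self, hE, h0]
        simp only [expVec, Fin.val_zero, if_true]
        omega
      · rw [Function.update_of_ne hi, hE, hD]
        have := hpos i
        rw [hD] at this
        have h3 : (expVec (d1 - 1) d2 i : ℕ) = expVec d1 d2 i := by
          have hi' : (i : ℕ) ≠ 0 := fun h => hi (Fin.ext h)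
          simp only [expVec, if_neg hi']
        omega
    have e1 := hsumE (· ^ 2)
    have e2 := sum_update_add (· ^ 2) D i₀ (D i₀ + 1)
    have e3 := sum_update_add (· ^ 2) D 0 (D 0 + 1)
    rw [hED] at e1
    have : D i₀ = D 0 := by
      beta_reduce at e1 e2 e3
      nlinarith
    omega

variable {A : Arrangement K ℓ} {m : (Fin ℓ → K) → ℕ} {n : ℕ} [Algebra (PS K ℓ) (PS K n)]
  {c0 : Fin ℓ → K} {e : (Fin n → K) →ₗ[K] (Fin ℓ → K)}

theorem nrm_isHomogeneous (c0 : Fin ℓ → K) {d : ℕ} {y : Fin ℓ → PS K ℓ} (hy : IsHomogVec d y) :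
    (nrm c0 y).IsHomogeneous d := by
  rw [nrm]
  split_ifs with h
  · simp only [constFun, LinearMap.sum_apply, LinearMap.smul_apply, LinearMap.proj_apply,
      smul_eq_mul]
    refine IsHomogeneous.sum _ _ _ fun i _ => ?_
    simpa using (isHomogeneous_C (Fin ℓ) _).mul (hy i)
  · exact isHomogeneous_zero _ _ _

theorem msum_mdel (hc0 : c0 ∈ A.hyps) (hm : 1 ≤ m c0) : msum A (mdel m c0) = msum A m - 1 := by
  have h1 : msum A m = m c0 + ∑ c ∈ A.hyps.erase c0, m c :=
    (Finset.add_sum_erase A.hyps m hc0).symm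
  have h2 : msum A (mdel m c0) = mdel m c0 c0 + ∑ c ∈ A.hyps.erase c0, mdel m c0 c :=
    (Finset.add_sum_erase A.hyps _ hc0).symm
  rw [h1, h2, mdel_self, Finset.sum_congr rfl fun c hc =>
    mdel_of_ne m (Finset.ne_of_mem_erase hc)]
  omega

theorem IsRes.associated_Qpoly (h : IsRes c0 e) (hc0 : c0 ∈ A.hyps) {c' : Fin n → K}
    (hX : ∀ c ∈ A.hyps, ∃ t : K, resF e c = t • c') :
    Associated (algebraMap (PS K ℓ) (PS K n) (Qpoly (delArr A c0) m))
      (_root_.linP c' ^ msum (delArr A c0) m) := by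
  rw [Qpoly, map_prod, msum, ← Finset.prod_pow_eq_pow_sum]
  refine Associated.prod _ _ _ fun c hc => ?_
  obtain ⟨t, ht⟩ := hX c (Finset.mem_of_mem_erase hc)
  have ht0 : t ≠ 0 := by
    rintro rfl
    rw [zero_smul] at ht
    obtain ⟨s, hs⟩ := h.resF_eq_zero ht
    exact A.nonprop c (Finset.mem_of_mem_erase hc) c0 hc0 (Finset.ne_of_mem_erase hc) s hs
  rw [map_pow]
  refine Associated.pow_pow ?_
  rw [h.toIsPull.linP, ht, linP_smul]
  exact associated_unit_mul_left _ _ ((ht0.isUnit).map C)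

/-- The second exponent of a rank two localization determines the ideals `idJ` and `idB`. -/
theorem IsRes.pow_mem_of_freeWithExp (h : IsRes c0 e) (hℓ : 2 ≤ ℓ) (hc0 : c0 ∈ A.hyps)
    (hm : ∀ c ∈ A.hyps, 0 < m c) {c' : Fin n → K} (hc' : c' ≠ 0)
    (hX : ∀ c ∈ A.hyps, ∃ t : K, resF e c = t • c') (hex : ∃ c ∈ A.hyps, c ≠ c0) {d1 d2 : ℕ}
    (h1 : FreeWithExp A m (expVec d1 d2)) (h2 : FreeWithExp A (mdel m c0) (expVec (d1 - 1) d2)) :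
    d2 ≤ msum (delArr A c0) m ∧ _root_.linP c' ^ d2 ∈ idJ A m c0 n ∧
      _root_.linP c' ^ (msum (delArr A c0) m - d2) ∈ idB A m c0 n := by
  have hm0 : 1 ≤ m c0 := hm c0 hc0
  set q := algebraMap (PS K ℓ) (PS K n) (Qpoly (delArr A c0) m) with hq
  set M := msum (delArr A c0) m with hM
  have hq0 : q ≠ 0 := h.alg_Qpoly_ne_zero hc0
  have hqmem := h.Qpoly_mem_idB_mul_idJ hc0 hm0 h1.projective h2.projective
  obtain ⟨b, g, hbg, hb, hg, hmem⟩ := exists_factorization hq0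
    (fun x hx => h.Qpoly_dvd_of_mem hc0 hm0 hx) fun r hr => isUnit_of_dvd_one
      (hr 1 (by simpa using hqmem))
  obtain ⟨hbm, hgm⟩ := hmem 1 (by simpa using hqmem)
  rw [one_mul] at hbm hgm
  have hp := prime_linP hc'
  have hqX : Associated q (_root_.linP c' ^ M) := h.associated_Qpoly hc0 hX
  obtain ⟨j, hj, hgj⟩ := (dvd_prime_pow hp M).1 ((Dvd.intro_left b hbg).trans hqX.dvd)
  have hbj : Associated b (_root_.linP c' ^ (M - j)) := by
    have : Associated (b * g) (_root_.linP c' ^ (M - j) * _root_.linP c' ^ j) := by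
      rw [hbg, ← pow_add, Nat.sub_add_cancel hj]
      exact hqX
    exact this.of_mul_right hgj (right_ne_zero_of_mul (hbg.trans_ne hq0))
  have hgm' : _root_.linP c' ^ j ∈ idJ A m c0 n := Ideal.mem_of_dvd _ hgj.dvd hgm
  have hbm' : _root_.linP c' ^ (M - j) ∈ idB A m c0 n := Ideal.mem_of_dvd _ hbj.dvd hbm
  suffices hjd : j = d2 by subst hjd; exact ⟨hj, hgm', hbm'⟩
  obtain ⟨v, hv, hD, hvli, hvsp⟩ := h1.exists_vec
  obtain ⟨v', hv', hD', hvli', hvsp'⟩ := h2.exists_vec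
  have hα := linP_ne_zero (A.ne_zero c0 hc0)
  let ρ : (Fin ℓ → PS K ℓ) →ₗ[PS K ℓ] PS K n := Algebra.linearMap (PS K ℓ) (PS K n) ∘ₗ nrm c0
  have hρ : ∀ y, resid c0 e (ExteriorAlgebra.ι (PS K ℓ) y) = algebraMap _ _ (ρ y) := fun y =>
    resid_eq_algebraMap (ctr_ι _ _)
  have hinj : Function.Injective (algebraMap (PS K n) (ExtF K n)) :=
    (ExteriorAlgebra.algebraMap_leftInverse (R := PS K n) (Fin n → PS K n)).injective
  have hρJ : ∀ y, ExteriorAlgebra.ι (PS K ℓ) y ∈ Omega A m 1 → ρ y ∈ idJ A m c0 n := fun y hy =>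
    h.mem_idJ.2 ⟨_, hy, _, ctr_ι _ _, rfl⟩
  have hvmem : ∀ y ∈ Submodule.span (PS K ℓ) (Set.range v),
      ExteriorAlgebra.ι (PS K ℓ) y ∈ Omega A m 1 := fun y hy => by
    have : Submodule.span (PS K ℓ) (Set.range v) ≤ (Omega A m 1).comap (ExteriorAlgebra.ι _) :=
      Submodule.span_le.2 (by rintro _ ⟨i, rfl⟩; exact hv i)
    exact this hy
  have hzero : ∀ y, ExteriorAlgebra.ι (PS K ℓ) y ∈ Omega A m 1 → (ρ y = 0 ↔
      ∃ z, ExteriorAlgebra.ι (PS K ℓ) z ∈ Omega A (mdel m c0) 1 ∧ y = _root_.linP c0 • z) := by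
    intro y hy
    rw [← map_eq_zero_iff _ hinj, ← hρ, h.resid_eq_zero_iff hc0 hm0 hy]
    constructor
    · rintro ⟨κ, hκ, hyκ⟩
      obtain ⟨z, rfl⟩ := mem_formsP_one (mem_Omega.1 hκ).1
      exact ⟨z, hκ, ι_injective (by rw [hyκ, map_smul])⟩
    · rintro ⟨z, hz, rfl⟩
      exact ⟨_, hz, map_smul _ _ _⟩
  have huΩ : ∀ k, ExteriorAlgebra.ι (PS K ℓ) (_root_.linP c0 • v' k) ∈ Omega A m 1 := fun k => by
    rw [map_smul]; exact smul_mem_Omega hm0 (hv' k)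
  obtain ⟨i₀, hi₀, hperm⟩ := h.exists_perm_degree (u := fun k => _root_.linP c0 • v' k)
    (E := fun k => msum A (mdel m c0) - expVec (d1 - 1) d2 k + 1) hD
    (fun k i => by
      rw [add_comm]; exact (linP_isHomogeneous c0).mul (hD' k i))
    (by
      rw [Fintype.linearIndependent_iff] at hvli' ⊢
      intro f hf i
      have h0 : _root_.linP c0 • ∑ k, f k • v' k = 0 := by
        rw [Finset.smul_sum, ← hf]
        exact Finset.sum_congr rfl fun k _ => smul_comm _ _ _
      exact hvli' f ((smul_eq_zero.1 h0).resolve_left hα) i)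
    ρ (fun d y hy => h.toIsPull.isHomogeneous_map (nrm_isHomogeneous c0 hy))
    (g := _root_.linP c' ^ j) (j := j) (pow_ne_zero _ hp.ne_zero)
    (by simpa using (linP_isHomogeneous c').pow j)
    (fun i => hgj.symm.dvd.trans (hg _ (hρJ _ (hv i))))
    (by
      obtain ⟨ω, hω, s, hs, hs'⟩ := h.mem_idJ.1 hgm'
      obtain ⟨y, rfl⟩ := mem_formsP_one (mem_Omega.1 hω).1
      refine ⟨y, hvsp y hω, hinj ?_⟩
      rw [← hρ, resid_eq_algebraMap hs, hs'])
    (fun k => hvsp _ (huΩ k))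
    (fun k => (hzero _ (huΩ k)).2 ⟨_, hv' k, rfl⟩)
    (fun y hy h0 => by
      obtain ⟨z, hz, rfl⟩ := (hzero _ (hvmem y hy)).1 h0
      obtain ⟨f, rfl⟩ := (Submodule.mem_span_range_iff_exists_fun _).1 (hvsp' z hz)
      refine (Submodule.mem_span_range_iff_exists_fun _).2 ⟨f, ?_⟩
      rw [Finset.smul_sum]
      exact Finset.sum_congr rfl fun k _ => smul_comm _ _ _)
  obtain ⟨c, hc, hcne⟩ := hex
  have hpos : ∀ i, 1 ≤ msum A m - expVec d1 d2 i := fun i => by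
    by_contra hlt
    refine hvli.ne_zero i (eq_zero_of_isHomogVec_zero hm hc hc0 hcne ?_ (hv i))
    have := hD i
    rwa [show msum A m - expVec d1 d2 i = 0 by omega] at this
  have := exponent_eq hℓ (fun i => rfl) (fun i => by rw [msum_mdel hc0 hm0]) hpos
    (sum_degree_eq (by omega) hv hD hvli hvsp) i₀ hperm
  omega

end ExponentsOfRankTwo

section EulerRestriction

variable {n : ℕ} [Algebra (PS K ℓ) (PS K n)] {A : Arrangement K ℓ} {B : Arrangement K n}
  {m : (Fin ℓ → K) → ℕ} {ms : (Fin n → K) → ℕ} {c0 : Fin ℓ → K}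
  {e : (Fin n → K) →ₗ[K] (Fin ℓ → K)}

theorem Arrangement.ext_hyps {A A' : Arrangement K ℓ} (h : A.hyps = A'.hyps) : A = A' := by
  cases A
  cases A'
  cases h
  rfl

/-- The hyperplanes of `A` whose restriction along `e` is proportional to `c'`. -/
def locRes (A : Arrangement K ℓ) (e : (Fin n → K) →ₗ[K] (Fin ℓ → K)) (c' : Fin n → K) :
    Arrangement K ℓ where
  hyps := A.hyps.filter fun c => ∃ t : K, resF e c = t • c'
  ne_zero := fun c hc => A.ne_zero c (Finset.mem_filter.mp hc).1
  nonprop := fun c hc c'' hc'' =>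
    A.nonprop c (Finset.mem_filter.mp hc).1 c'' (Finset.mem_filter.mp hc'').1

omit [Algebra (PS K ℓ) (PS K n)] in
theorem mem_locRes {c : Fin ℓ → K} {c' : Fin n → K} :
    c ∈ (locRes A e c').hyps ↔ c ∈ A.hyps ∧ ∃ t : K, resF e c = t • c' :=
  Finset.mem_filter

omit [Algebra (PS K ℓ) (PS K n)] in
theorem locRes_subset (A : Arrangement K ℓ) (e : (Fin n → K) →ₗ[K] (Fin ℓ → K)) (c' : Fin n → K) :
    (locRes A e c').hyps ⊆ A.hyps :=
  Finset.filter_subset _ _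

theorem IsRes.mem_locRes_self (h : IsRes c0 e) (hc0 : c0 ∈ A.hyps) (c' : Fin n → K) :
    c0 ∈ (locRes A e c').hyps :=
  mem_locRes.2 ⟨hc0, 0, by rw [h.resF_self, zero_smul]⟩

/-- `B` consists of the restrictions of the members of `A` other than `c0`. -/
structure Restricts (A : Arrangement K ℓ) (c0 : Fin ℓ → K) (e : (Fin n → K) →ₗ[K] (Fin ℓ → K))
    (B : Arrangement K n) : Prop where
  exists_mem : ∀ c ∈ A.hyps, c ≠ c0 → ∃ c' ∈ B.hyps, ∃ t : K, t ≠ 0 ∧ resF e c = t • c'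
  exists_of_mem : ∀ c' ∈ B.hyps, ∃ c ∈ A.hyps, c ≠ c0 ∧ ∃ t : K, t ≠ 0 ∧ resF e c = t • c'

theorem IsRes.associated_Qpoly_locRes (h : IsRes c0 e) (hc0 : c0 ∈ A.hyps) (c' : Fin n → K) :
    Associated (algebraMap (PS K ℓ) (PS K n) (Qpoly (delArr (locRes A e c') c0) m))
      (_root_.linP c' ^ msum (delArr (locRes A e c') c0) m) :=
  h.associated_Qpoly (h.mem_locRes_self hc0 c') fun _ hc => (mem_locRes.1 hc).2

omit [Algebra (PS K ℓ) (PS K n)] in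
theorem Restricts.Qpoly_eq_prod (hB : Restricts A c0 e B) (hc0 : ∀ c ∈ A.hyps, resF e c = 0 → c = c0) :
    Qpoly (delArr A c0) m = ∏ c' ∈ B.hyps, Qpoly (delArr (locRes A e c') c0) m := by
  have hU : (delArr A c0).hyps = B.hyps.biUnion fun c' => (delArr (locRes A e c') c0).hyps := by
    ext c
    simp only [delArr, Finset.mem_biUnion, Finset.mem_erase, mem_locRes]
    constructor
    · rintro ⟨hc, hcA⟩
      obtain ⟨c', hc', t, -, ht⟩ := hB.exists_mem c hcA hc
      exact ⟨c', hc', hc, hcA, t, ht⟩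
    · rintro ⟨c', -, hc, hcA, -⟩
      exact ⟨hc, hcA⟩
  rw [Qpoly, hU, Finset.prod_biUnion]
  · rfl
  · intro X hX Y hY hne
    rw [Function.onFun, Finset.disjoint_left]
    intro c hc hc'
    simp only [delArr, Finset.mem_erase, mem_locRes] at hc hc'
    obtain ⟨hne0, hcA, t, ht⟩ := hc
    obtain ⟨-, -, s, hs⟩ := hc'
    have ht0 : t ≠ 0 := by
      rintro rfl
      exact hne0 (hc0 c hcA (by rw [ht, zero_smul]))
    refine B.nonprop X hX Y hY hne (t⁻¹ * s) ?_
    rw [mul_smul, ← hs, ht, smul_smul, inv_mul_cancel₀ ht0, one_smul]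

theorem IsRes.eq_of_resF_eq_zero (h : IsRes c0 e) (hc0 : c0 ∈ A.hyps) :
    ∀ c ∈ A.hyps, resF e c = 0 → c = c0 := by
  intro c hc h0
  by_contra hne
  obtain ⟨s, hs⟩ := h.resF_eq_zero h0
  exact A.nonprop c hc c0 hc0 hne s hs

/-- The product of the excess powers `α_X ^ (|m''_X| - m^*(X))` over `X ∈ B`. -/
def excess (A : Arrangement K ℓ) (m : (Fin ℓ → K) → ℕ) (c0 : Fin ℓ → K)
    (e : (Fin n → K) →ₗ[K] (Fin ℓ → K)) (B : Arrangement K n) (ms : (Fin n → K) → ℕ) : PS K n :=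
  ∏ X ∈ B.hyps, linP X ^ (msum (delArr (locRes A e X) c0) m - ms X)

/-- The ideals attached to the rank two localizations contain the powers prescribed by the
exponents. -/
def EulerMem (A : Arrangement K ℓ) (m : (Fin ℓ → K) → ℕ) (c0 : Fin ℓ → K)
    (e : (Fin n → K) →ₗ[K] (Fin ℓ → K)) (B : Arrangement K n) (ms : (Fin n → K) → ℕ) : Prop :=
  ∀ X ∈ B.hyps, ms X ≤ msum (delArr (locRes A e X) c0) m ∧
    linP X ^ ms X ∈ idJ (locRes A e X) m c0 n ∧
    linP X ^ (msum (delArr (locRes A e X) c0) m - ms X) ∈ idB (locRes A e X) m c0 n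

theorem IsRes.associated_excess (h : IsRes c0 e) (hc0 : c0 ∈ A.hyps) (hB : Restricts A c0 e B)
    (hE : EulerMem A m c0 e B ms) :
    Associated (algebraMap (PS K ℓ) (PS K n) (Qpoly (delArr A c0) m))
      (excess A m c0 e B ms * Qpoly B ms) := by
  rw [hB.Qpoly_eq_prod (h.eq_of_resF_eq_zero hc0), map_prod, excess, Qpoly,
    ← Finset.prod_mul_distrib]
  refine Associated.prod _ _ _ fun X hX => ?_
  rw [← pow_add, Nat.sub_add_cancel (hE X hX).1]
  exact h.associated_Qpoly_locRes hc0 X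

omit [Algebra (PS K ℓ) (PS K n)] in
theorem excess_ne_zero (A : Arrangement K ℓ) (m : (Fin ℓ → K) → ℕ) (c0 : Fin ℓ → K)
    (e : (Fin n → K) →ₗ[K] (Fin ℓ → K)) (B : Arrangement K n) (ms : (Fin n → K) → ℕ) :
    excess A m c0 e B ms ≠ 0 :=
  Finset.prod_ne_zero_iff.2 fun X hX => pow_ne_zero _ (linP_ne_zero (B.ne_zero X hX))

/-- In rank two the residues satisfy the full divisibility. -/
theorem IsRes.exists_dP_mul_eq (h : IsRes c0 e) (hc0 : c0 ∈ A.hyps) {X : Fin n → K}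
    (hX : ∀ c ∈ A.hyps, ∃ t : K, resF e c = t • X) {p : ℕ} {x : ExtF K n}
    (hx : x ∈ Imod A m c0 e p) :
    ∃ ζ, _root_.dP X * x = _root_.linP X ^ msum (delArr A c0) m • ζ := by
  obtain ⟨η, hη, θ, hθ, rfl⟩ := mem_Imod.1 hx
  obtain ⟨c1, hc1⟩ := h.resF_surjective X
  have hθκ := eq_dP_mul_ctr h.ne_zero (dP_mul_eq_zero hc0 hθ)
  set κ := ctr (nrm c0) θ with hκ
  have key : ∀ c ∈ (delArr A c0).hyps,
      ∃ y, _root_.dP c0 * (_root_.dP c1 * κ) = _root_.linP c ^ m c • y := by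
    intro c hc
    have hcA := Finset.mem_of_mem_erase hc
    have hne := Finset.ne_of_mem_erase hc
    obtain ⟨t, ht⟩ := hX c hcA
    have ht0 : t ≠ 0 := by
      rintro rfl
      exact hne (h.eq_of_resF_eq_zero hc0 c hcA (by rw [ht, zero_smul]))
    obtain ⟨s, hs⟩ := h.resF_eq_zero (c := t⁻¹ • c - c1) (by
      ext i
      have := congrFun ht i
      have h1 := congrFun hc1 i
      simp only [resF, Pi.smul_apply, smul_eq_mul, Pi.sub_apply, sub_mul, Finset.sum_sub_distrib,
        mul_assoc, ← Finset.mul_sum, Pi.zero_apply] at this h1 ⊢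
      rw [this, h1, inv_mul_cancel_left₀ ht0, sub_self])
    have hdc1 : _root_.dP c1 = (C t⁻¹ : PS K ℓ) • _root_.dP c - (C s : PS K ℓ) • _root_.dP c0 := by
      rw [← dP_smul, ← dP_smul, ← hs]
      refine eq_sub_of_add_eq ?_
      rw [← dP_add]
      congr 1
      abel
    obtain ⟨ζ, hζ⟩ := (mem_Omega.1 hη).2 c hcA
    rw [mdel_of_ne m hne] at hζ
    have h1 : _root_.linP c0 ^ (m c0 - 1) • (_root_.dP c0 * (_root_.dP c * κ)) =
        _root_.linP c ^ m c • (_root_.dP c0 * ζ) := by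
      have e1 : ∀ y, _root_.dP c0 * (_root_.dP c * y) = - (_root_.dP c * (_root_.dP c0 * y)) := by
        intro y
        rw [← mul_assoc, ← mul_assoc, ← neg_mul]
        congr 1
        exact eq_neg_of_add_eq_zero_left (ExteriorAlgebra.ι_add_mul_swap _ _)
      rw [← mul_smul_comm (_root_.linP c ^ m c), ← hζ, e1, e1, ← hθκ, hθ, smul_neg, mul_smul_comm]
    obtain ⟨z, hz⟩ := exists_pow_smul_of_smul (prime_linP (A.ne_zero c hcA))
      (fun hd => A.not_dvd hcA hc0 hne ((prime_linP (A.ne_zero c hcA)).dvd_of_dvd_pow hd)) h1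
    refine ⟨(C t⁻¹ : PS K ℓ) • z, ?_⟩
    rw [hdc1, sub_mul, mul_sub, smul_mul_assoc, smul_mul_assoc, mul_smul_comm, mul_smul_comm,
      dP_mul_dP_mul, smul_zero, sub_zero, hz, smul_comm]
  obtain ⟨y, hy⟩ := exists_prod_smul _ _ ((delArr A c0).pairwise_isRelPrime m) key
  obtain ⟨u, hu⟩ := (h.associated_Qpoly (m := m) hc0 hX).symm
  refine ⟨(u : PS K n) • resid c0 e y, ?_⟩
  rw [smul_smul, hu, algebraMap_smul, Qpoly, ← map_smul (resid c0 e), ← hy, h.resid_dP_mul, map_mul,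
    h.toIsPull.dP, hc1, hκ, ← resid_apply]

theorem IsRes.exists_eq_excess_smul (h : IsRes c0 e) (hc0 : c0 ∈ A.hyps) (hm : 1 ≤ m c0)
    (hE : EulerMem A m c0 e B ms) {p : ℕ} {x : ExtF K n} (hx : x ∈ Imod A m c0 e p) :
    ∃ ξ ∈ Omega B ms p, x = excess A m c0 e B ms • ξ := by
  have hloc : ∀ X ∈ B.hyps, x ∈ Imod (locRes A e X) m c0 e p := fun X _ =>
    Imod_mono (locRes_subset A e X) hx
  have hdiv : ∀ X ∈ B.hyps, ∃ y,
      x = _root_.linP X ^ (msum (delArr (locRes A e X) c0) m - ms X) • y := by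
    intro X hX
    obtain ⟨hle, hJ, -⟩ := hE X hX
    obtain ⟨y, -, hy⟩ := h.idJ_smul_mem (h.mem_locRes_self hc0 X) hm hJ (hloc X hX)
    obtain ⟨u, hu⟩ := (h.associated_Qpoly_locRes (m := m) hc0 X).symm
    refine ⟨(u : PS K n) • y, smul_right_inj_extF
      (pow_ne_zero (ms X) (linP_ne_zero (B.ne_zero X hX))) ?_⟩
    rw [hy, ← algebraMap_smul (PS K n) (Qpoly (delArr (locRes A e X) c0) m), ← hu, smul_smul,
      smul_smul, ← pow_add, Nat.add_sub_cancel' hle]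
  obtain ⟨ξ, hξ⟩ := exists_prod_smul _ _ (B.pairwise_isRelPrime
    fun X => msum (delArr (locRes A e X) c0) m - ms X) hdiv
  refine ⟨ξ, mem_Omega.2 ⟨mem_formsP_of_smul (excess_ne_zero A m c0 e B ms) ?_, ?_⟩, hξ⟩
  · rw [excess, ← hξ]
    exact Imod_le_formsP hc0 _ hx
  · intro X hX
    obtain ⟨ζ, hζ⟩ := h.exists_dP_mul_eq (h.mem_locRes_self hc0 X)
      (fun c hc => (mem_locRes.1 hc).2) (hloc X hX)
    rw [hξ, ← Finset.mul_prod_erase _ _ hX, mul_smul_comm, mul_smul,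
      show msum (delArr (locRes A e X) c0) m =
        (msum (delArr (locRes A e X) c0) m - ms X) + ms X from
        (Nat.sub_add_cancel (hE X hX).1).symm, pow_add, mul_smul, Nat.add_sub_cancel] at hζ
    refine exists_pow_smul_of_smul (prime_linP (B.ne_zero X hX)) (B.not_dvd_prod
      (fun X => msum (delArr (locRes A e X) c0) m - ms X) hX (Finset.erase_subset X _)
      (Finset.notMem_erase X _)) (smul_right_inj_extF
      (pow_ne_zero (msum (delArr (locRes A e X) c0) m - ms X)
        (linP_ne_zero (B.ne_zero X hX))) hζ)

end EulerRestriction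

section PartialExpansion

variable {S : Type} [CommRing S] {M : Type} [AddCommGroup M] [Module S M] {ι : Type}

theorem ExteriorAlgebra.map_add_smulRight (f : M →ₗ[S] M) (d : Module.Dual S M) (u : M)
    (x : ExteriorAlgebra S M) :
    ExteriorAlgebra.map (f + d.smulRight u) x =
      ExteriorAlgebra.map f x + ExteriorAlgebra.ι S u * ExteriorAlgebra.map f (ctr d x) := by
  induction x using CliffordAlgebra.left_induction with
  | algebraMap r =>
    have h0 : ctr d (algebraMap S (ExteriorAlgebra S M) r) = 0 := ctr_algebraMap d r
    change _ = _ + _ * ExteriorAlgebra.map f (ctr d (algebraMap S (ExteriorAlgebra S M) r))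
    rw [h0, map_zero, mul_zero, add_zero]
    exact ((ExteriorAlgebra.map _).commutes r).trans ((ExteriorAlgebra.map f).commutes r).symm
  | add x y hx hy => rw [map_add, map_add, map_add, map_add, mul_add, hx, hy]; abel
  | ι_mul x v hx =>
    change ExteriorAlgebra.map _ (ExteriorAlgebra.ι S v * x) =
      ExteriorAlgebra.map f (ExteriorAlgebra.ι S v * x) +
        ExteriorAlgebra.ι S u * ExteriorAlgebra.map f (ctr d (ExteriorAlgebra.ι S v * x))
    rw [ctr_ι_mul, map_mul, map_mul, hx, ExteriorAlgebra.map_apply_ι, ExteriorAlgebra.map_apply_ι,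
      map_sub, map_smul, map_mul, ExteriorAlgebra.map_apply_ι, LinearMap.add_apply,
      LinearMap.smulRight_apply, map_add, map_smul, add_mul, mul_add, mul_add, mul_sub,
      smul_mul_assoc, smul_mul_assoc, ι_mul_ι_mul, smul_zero, add_zero, mul_smul_comm,
      ← mul_assoc, ← mul_assoc,
      eq_neg_of_add_eq_zero_left (ExteriorAlgebra.ι_add_mul_swap (R := S) (f v) u), neg_mul]
    abel

end PartialExpansion

theorem map_zero_of_mem_formsP {p : ℕ} {x : ExtF K ℓ} (hx : x ∈ formsP K ℓ (p + 1)) :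
    ExteriorAlgebra.map (0 : (Fin ℓ → PS K ℓ) →ₗ[PS K ℓ] (Fin ℓ → PS K ℓ)) x = 0 := by
  rw [formsP, pow_succ] at hx
  induction hx using Submodule.mul_induction_on' with
  | mem_mul_mem a ha b hb =>
    obtain ⟨v, rfl⟩ := hb
    rw [map_mul, ExteriorAlgebra.map_apply_ι, LinearMap.zero_apply, map_zero, mul_zero]
  | add a _ b _ ha hb => rw [map_add, ha, hb, add_zero]

theorem map_smul_id_of_mem_formsP (q : PS K ℓ) {p : ℕ} {x : ExtF K ℓ} (hx : x ∈ formsP K ℓ p) :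
    ExteriorAlgebra.map (q • (LinearMap.id : (Fin ℓ → PS K ℓ) →ₗ[PS K ℓ] (Fin ℓ → PS K ℓ))) x =
      q ^ p • x := by
  induction p generalizing x with
  | zero =>
    obtain ⟨s, rfl⟩ := mem_formsP_zero.1 hx
    rw [pow_zero, one_smul, AlgHom.commutes]
  | succ p ih =>
    rw [formsP, pow_succ] at hx
    induction hx using Submodule.mul_induction_on' with
    | mem_mul_mem a ha b hb =>
      obtain ⟨v, rfl⟩ := hb
      rw [map_mul, ih ha, ExteriorAlgebra.map_apply_ι, LinearMap.smul_apply, LinearMap.id_apply,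
        map_smul, smul_mul_smul_comm, pow_succ]
    | add a _ b _ ha hb => rw [map_add, ha, hb, smul_add]

/-- A logarithmic form is expanded, up to `Q(A,m)`, in products of a system of one-forms dual to a
system of logarithmic derivations. -/
theorem IsLog.exists_map_eq {A : Arrangement K ℓ} {m : (Fin ℓ → K) → ℕ} {ι : Type}
    {d : ι → Module.Dual (PS K ℓ) (Fin ℓ → PS K ℓ)} (hd : ∀ k, IsDer A m (d k))
    (u : ι → Fin ℓ → PS K ℓ) (s : Finset ι) {p : ℕ} {x : ExtF K ℓ} (hx : x ∈ Omega A m p) :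
    ∃ y ∈ (Submodule.span (PS K ℓ)
        (Set.range fun k => ExteriorAlgebra.ι (PS K ℓ) (u k)) : Submodule (PS K ℓ) (ExtF K ℓ)) ^ p,
      ExteriorAlgebra.map (∑ k ∈ s, (d k).smulRight (u k)) x = Qpoly A m • y := by
  induction s using Finset.induction_on generalizing p x with
  | empty =>
    rw [Finset.sum_empty]
    rcases p with _ | p
    · obtain ⟨t, rfl⟩ := mem_Omega_zero.1 hx
      refine ⟨algebraMap _ _ t, ?_, ?_⟩
      · rw [pow_zero]
        exact Submodule.algebraMap_mem t
      · rw [AlgHom.commutes, map_mul, ← Algebra.smul_def]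
    · exact ⟨0, zero_mem _, by rw [map_zero_of_mem_formsP (mem_Omega.1 hx).1, smul_zero]⟩
  | insert k s hk ih =>
    rw [Finset.sum_insert hk, add_comm, ExteriorAlgebra.map_add_smulRight]
    obtain ⟨y, hy, hxy⟩ := ih hx
    rcases p with _ | p
    · obtain ⟨t, ht⟩ := mem_Omega_zero.1 hx
      refine ⟨y, hy, ?_⟩
      rw [hxy, ht, ctr_algebraMap, map_zero, mul_zero, add_zero]
    · obtain ⟨z, hz, hxz⟩ := ih (mem_Omega.2 ⟨ctr_mem_formsP (d k) (mem_Omega.1 hx).1,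
        (mem_Omega.1 hx).2.ctr (hd k)⟩)
      refine ⟨y + ExteriorAlgebra.ι (PS K ℓ) (u k) * z, add_mem hy ?_, ?_⟩
      · rw [pow_succ']
        exact Submodule.mul_mem_mul (Submodule.subset_span ⟨k, rfl⟩) hz
      · rw [hxy, hxz, smul_add, mul_smul_comm]

section EulerRestriction

variable {n : ℕ} [Algebra (PS K ℓ) (PS K n)] {A : Arrangement K ℓ} {B : Arrangement K n}
  {m : (Fin ℓ → K) → ℕ} {ms : (Fin n → K) → ℕ} {c0 : Fin ℓ → K}
  {e : (Fin n → K) →ₗ[K] (Fin ℓ → K)}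

theorem IsRes.Qpoly_smul_pullF_mem (h : IsRes c0 e) (hc0 : c0 ∈ A.hyps) {p : ℕ} {κ : ExtF K ℓ}
    (hκ : κ ∈ formsP K ℓ p) : Qpoly (delArr A c0) m • pullF e κ ∈ Imod A m c0 e p := by
  refine mem_Imod.2 ⟨_, Qpoly_smul_mem_Omega A (mdel m c0) hκ,
    Qpoly (delArr A c0) m • (_root_.dP c0 * κ), ?_, ?_⟩
  · rw [Qpoly_mdel m hc0, mul_smul_comm, mul_smul]
  · rw [map_smul (resid c0 e), h.resid_dP_mul]

theorem IsRes.Qpoly_smul_ι_mem (h : IsRes c0 e) (hc0 : c0 ∈ A.hyps) (v : Fin n → PS K n) :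
    algebraMap (PS K ℓ) (PS K n) (Qpoly (delArr A c0) m) • ExteriorAlgebra.ι (PS K n) v ∈
      h.toRestr (Imod A m c0 e 1) := by
  have hv : v = ∑ i, v i • cvec (Pi.single i (1 : K)) := by
    ext j
    simp [cvec, Pi.single_apply, Finset.sum_apply, apply_ite C]
  rw [hv, map_sum, Finset.smul_sum]
  refine sum_mem fun i _ => ?_
  rw [map_smul, smul_comm]
  refine Submodule.smul_mem _ _ ?_
  obtain ⟨c, hc⟩ := h.resF_surjective (Pi.single i (1 : K))
  rw [← hc, ← dP_eq, ← h.toIsPull.dP, algebraMap_smul]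
  exact h.Qpoly_smul_pullF_mem hc0 (dP_mem_formsP c)

theorem IsRes.Qpoly_smul_algebraMap_mem (h : IsRes c0 e) (hc0 : c0 ∈ A.hyps) (s : PS K n) :
    algebraMap (PS K ℓ) (PS K n) (Qpoly (delArr A c0) m) • algebraMap (PS K n) (ExtF K n) s ∈
      Imod A m c0 e 0 := by
  rw [Algebra.algebraMap_eq_smul_one (A := ExtF K n) s, smul_comm]
  refine h.smul_mem _ _ ?_
  rw [algebraMap_smul, ← map_one (pullF e)]
  exact h.Qpoly_smul_pullF_mem hc0 (by rw [formsP, pow_zero]; exact Submodule.one_le.1 le_rfl)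

theorem IsRes.coQ_smul_dP_mem (h : IsRes c0 e) (hc0 : c0 ∈ A.hyps) (hm : 1 ≤ m c0) {X : Fin n → K}
    {b : PS K n} (hb : b ∈ idB (locRes A e X) m c0 n) :
    (algebraMap (PS K ℓ) (PS K n) (coQ A (locRes A e X) m) * b) • _root_.dP X ∈
      Imod A m c0 e 1 := by
  obtain ⟨c1, hc1⟩ := h.resF_surjective X
  have hJ : _root_.dP X ∈ Jmod (locRes A e X) m c0 e 2 := by
    refine mem_Jmod.2 ⟨_root_.dP c0 * _root_.dP c1, mem_Omega.2
      ⟨mul_mem_formsP (dP_mem_formsP c0) (dP_mem_formsP c1), fun c hc => ⟨0, ?_⟩⟩, ?_⟩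
    · obtain ⟨t, ht⟩ := (mem_locRes.1 hc).2
      obtain ⟨s, hs⟩ := h.resF_eq_zero (c := c - t • c1) (by
        ext i
        have := congrFun ht i
        have h1 := congrFun hc1 i
        simp only [resF, Pi.smul_apply, smul_eq_mul, Pi.sub_apply, sub_mul,
          Finset.sum_sub_distrib, mul_assoc, ← Finset.mul_sum, Pi.zero_apply] at this h1 ⊢
        rw [this, h1, sub_self])
      rw [sub_eq_iff_eq_add.1 hs, dP_add, dP_smul, dP_smul, add_mul, smul_mul_assoc,
        smul_mul_assoc, dP_mul_dP_mul, smul_zero, zero_add]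
      have := dP_mul_mul_dP_mul c1 (_root_.dP c0) 1
      rw [mul_one] at this
      rw [this, smul_zero, smul_zero]
    · rw [h.resid_dP_mul, h.toIsPull.dP, hc1]
  rw [mul_smul, algebraMap_smul]
  exact smul_mem_Imod (dvd_coQ A _ m) (h.mem_locRes_self hc0 X)
    (h.idB_smul_mem (h.mem_locRes_self hc0 X) hm hb hJ)

theorem IsRes.exists_dual_system (h : IsRes c0 e) (hc0 : c0 ∈ A.hyps) (hm : 1 ≤ m c0)
    (hE : EulerMem A m c0 e B ms) (h1 : Module.Projective (PS K ℓ) (Omega A m 1))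
    (h2 : Module.Projective (PS K ℓ) (Omega A (mdel m c0) 1)) :
    ∃ (N : ℕ) (d : Fin N → Module.Dual (PS K n) (Fin n → PS K n)) (u : Fin N → Fin n → PS K n),
      (∀ k, IsDer B ms (d k)) ∧
      (∀ k, ExteriorAlgebra.ι (PS K n) (u k) ∈ Imod A m c0 e 1) ∧
      ∑ k, (d k).smulRight (u k) =
        algebraMap (PS K ℓ) (PS K n) (Qpoly (delArr A c0) m) • LinearMap.id := by
  set q := algebraMap (PS K ℓ) (PS K n) (Qpoly (delArr A c0) m) with hq
  let P := h.toRestr (Imod A m c0 e 1)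
  have hP : Module.Projective (PS K n) P := pdLT_one_iff.1 (h.pdLT_toRestr _
    (h.pdLT_Imod hc0 hm (pdLT_one_iff.2 h1) ((pdLT_one_iff.2 h2).mono (by omega))))
  have : IsNoetherian (PS K n) (ExtF K n) := isNoetherian_of_isNoetherianRing_of_finite _ _
  obtain ⟨N, f, g, -, -, hfg⟩ := Module.Finite.exists_comp_eq_id_of_projective (PS K n) P
  let μ : (Fin n → PS K n) →ₗ[PS K n] P :=
    (q • ExteriorAlgebra.ι (PS K n)).codRestrict P fun v => h.Qpoly_smul_ι_mem hc0 v
  have hu : ∀ k, ∃ u, (f (Pi.single k 1)).1 = ExteriorAlgebra.ι (PS K n) u := fun k =>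
    mem_formsP_one (Imod_le_formsP hc0 _ (f (Pi.single k 1)).2)
  choose u hu using hu
  refine ⟨N, fun k => LinearMap.proj k ∘ₗ g ∘ₗ μ, u, fun k X hX => ?_, fun k => ?_, ?_⟩
  · obtain ⟨hle, -, hb⟩ := hE X hX
    obtain ⟨a, ha⟩ := (h.associated_Qpoly_locRes (m := m) hc0 X).symm
    have hmem := h.coQ_smul_dP_mem hc0 hm hb
    have : μ (cvec X) = (_root_.linP X ^ ms X * a) • (⟨_, hmem⟩ : P) := by
      refine Subtype.ext ?_
      change q • ExteriorAlgebra.ι (PS K n) (cvec X) = (_root_.linP X ^ ms X * a) • (_ • _root_.dP X)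
      rw [← dP_eq, smul_smul, hq, ← coQ_mul_Qpoly (locRes_subset A e X) m (h.mem_locRes_self hc0 X),
        map_mul, ← ha, ← Nat.add_sub_cancel' hle, pow_add, Nat.add_sub_cancel_left]
      congr 1
      ring
    change _ ∣ g (μ (cvec X)) k
    rw [this, map_smul, Pi.smul_apply, smul_eq_mul, mul_assoc]
    exact dvd_mul_right _ _
  · rw [← hu k]
    exact (f (Pi.single k 1)).2
  · refine LinearMap.ext fun v => ι_injective ?_
    rw [LinearMap.sum_apply, map_sum, LinearMap.smul_apply, LinearMap.id_apply, map_smul]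
    have h3 : f (g (μ v)) = μ v := LinearMap.congr_fun hfg _
    have h4 : g (μ v) = ∑ k, g (μ v) k • Pi.single k (1 : PS K n) := by
      ext j
      simp [Pi.single_apply, Finset.sum_apply]
    rw [h4, map_sum] at h3
    have h5 := congrArg Subtype.val h3
    rw [AddSubmonoidClass.coe_finsetSum] at h5
    refine Eq.trans ?_ h5
    refine Finset.sum_congr rfl fun k _ => ?_
    rw [LinearMap.smulRight_apply, map_smul, map_smul, ← hu k]
    rfl

theorem IsRes.excess_smul_mem (h : IsRes c0 e) (hc0 : c0 ∈ A.hyps) (hm : 1 ≤ m c0)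
    (hB : Restricts A c0 e B) (hE : EulerMem A m c0 e B ms)
    (h1 : Module.Projective (PS K ℓ) (Omega A m 1))
    (h2 : Module.Projective (PS K ℓ) (Omega A (mdel m c0) 1)) {p : ℕ} {ξ : ExtF K n}
    (hξ : ξ ∈ Omega B ms p) : excess A m c0 e B ms • ξ ∈ Imod A m c0 e p := by
  obtain ⟨N, d, u, hd, hu, hdu⟩ := h.exists_dual_system hc0 hm hE h1 h2
  obtain ⟨y, hy, hξy⟩ := IsLog.exists_map_eq hd u Finset.univ hξ
  rw [hdu, map_smul_id_of_mem_formsP _ (mem_Omega.1 hξ).1] at hξy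
  set q := algebraMap (PS K ℓ) (PS K n) (Qpoly (delArr A c0) m) with hq
  have hq0 : q ≠ 0 := h.alg_Qpoly_ne_zero hc0
  have hspan : ∀ x ∈ (Submodule.span (PS K n) (Set.range fun k => ExteriorAlgebra.ι (PS K n) (u k)) :
      Submodule (PS K n) (ExtF K n)), x ∈ Imod A m c0 e 1 := fun x hx =>
    (Submodule.span_le (p := h.toRestr (Imod A m c0 e 1))).2 (by rintro _ ⟨k, rfl⟩; exact hu k) hx
  have key : ∀ (r : ℕ), ∀ z ∈ (Submodule.span (PS K n)
      (Set.range fun k => ExteriorAlgebra.ι (PS K n) (u k)) : Submodule (PS K n) (ExtF K n)) ^ r,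
      ∃ w ∈ Imod A m c0 e r, q • z = q ^ r • w := by
    intro r
    induction r with
    | zero =>
      intro z hz
      rw [pow_zero, Submodule.mem_one] at hz
      obtain ⟨s, rfl⟩ := hz
      exact ⟨_, h.Qpoly_smul_algebraMap_mem hc0 s, by rw [pow_zero, one_smul]⟩
    | succ r ih =>
      intro z hz
      rw [pow_succ] at hz
      induction hz using Submodule.mul_induction_on' with
      | mem_mul_mem a ha b hb =>
        obtain ⟨w, hw, haw⟩ := ih a ha
        obtain ⟨w', hw', hww⟩ := h.mul_mem_Imod hc0 hw (hspan b hb)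
        refine ⟨w', hw', ?_⟩
        rw [← smul_mul_assoc, haw, smul_mul_assoc, hww, pow_succ, mul_smul, algebraMap_smul]
      | add a _ b _ ha hb =>
        obtain ⟨w, hw, e1⟩ := ha
        obtain ⟨w', hw', e2⟩ := hb
        exact ⟨w + w', add_mem hw hw', by rw [smul_add, e1, e2, smul_add]⟩
  obtain ⟨w, hw, hyw⟩ := key p y hy
  have e1 : q • ξ = Qpoly B ms • w := by
    refine smul_right_inj_extF (pow_ne_zero p hq0) ?_
    rw [smul_comm, hξy, smul_comm, hyw, smul_comm]
  obtain ⟨a, ha⟩ := (h.associated_excess (m := m) (ms := ms) hc0 hB hE)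
  have e2 : excess A m c0 e B ms • ξ = (a : PS K n) • w := by
    refine smul_right_inj_extF (Qpoly_ne_zero B ms) ?_
    rw [smul_smul, mul_comm, ← ha, mul_comm, mul_smul, e1, smul_comm]
  rw [e2]
  exact h.smul_mem _ _ hw

end EulerRestriction

section EulerTameness

variable {n : ℕ} {A : Arrangement K ℓ} {B : Arrangement K n}
  {m : (Fin ℓ → K) → ℕ} {ms : (Fin n → K) → ℕ} {c0 : Fin ℓ → K}
  {e : (Fin n → K) →ₗ[K] (Fin ℓ → K)}

theorem mem_locArr_iff {c x : Fin ℓ → K} :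
    c ∈ (locArr A x).hyps ↔ c ∈ A.hyps ∧ ∑ i, c i * x i = 0 :=
  Finset.mem_filter

theorem sum_mul_eq_zero_iff {c : Fin ℓ → K} {c' : Fin n → K} {t : K} (ht : t ≠ 0)
    (h : resF e c = t • c') (x : Fin n → K) : ∑ i, c i * e x i = 0 ↔ ∑ i, c' i * x i = 0 := by
  rw [← resF_dot, h]
  simp only [Pi.smul_apply, smul_eq_mul, mul_assoc, ← Finset.mul_sum, mul_eq_zero, ht, false_or]

theorem Restricts.locArr (hB : Restricts A c0 e B) (x : Fin n → K) :
    Restricts (locArr A (e x)) c0 e (locArr B x) where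
  exists_mem := fun c hc hne => by
    obtain ⟨hcA, hx⟩ := mem_locArr_iff.1 hc
    obtain ⟨c', hc', t, ht, h⟩ := hB.exists_mem c hcA hne
    exact ⟨c', mem_locArr_iff.2 ⟨hc', (sum_mul_eq_zero_iff ht h x).1 hx⟩, t, ht, h⟩
  exists_of_mem := fun c' hc' => by
    obtain ⟨hcB, hx⟩ := mem_locArr_iff.1 hc'
    obtain ⟨c, hc, hne, t, ht, h⟩ := hB.exists_of_mem c' hcB
    exact ⟨c, mem_locArr_iff.2 ⟨hc, (sum_mul_eq_zero_iff ht h x).2 hx⟩, hne, t, ht, h⟩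

theorem locRes_locArr {X x : Fin n → K} (hX : ∑ i, X i * x i = 0) :
    locRes (locArr A (e x)) e X = locRes A e X := by
  refine Arrangement.ext_hyps (Finset.ext fun c => ?_)
  rw [mem_locRes, mem_locRes, mem_locArr_iff]
  refine ⟨fun h => ⟨h.1.1, h.2⟩, fun h => ⟨⟨h.1, ?_⟩, h.2⟩⟩
  obtain ⟨-, t, ht⟩ := h
  rw [← resF_dot, ht]
  simp only [Pi.smul_apply, smul_eq_mul, mul_assoc, ← Finset.mul_sum, hX, mul_zero]

variable [Algebra (PS K ℓ) (PS K n)]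

theorem EulerMem.locArr (hE : EulerMem A m c0 e B ms) (x : Fin n → K) :
    EulerMem (locArr A (e x)) m c0 e (locArr B x) ms := by
  intro X hX
  obtain ⟨hXB, hx⟩ := mem_locArr_iff.1 hX
  rw [locRes_locArr hx]
  exact hE X hXB

omit [Algebra (PS K ℓ) (PS K n)] in
theorem excess_locArr_dvd (x : Fin n → K) :
    excess (locArr A (e x)) m c0 e (locArr B x) ms ∣ excess A m c0 e B ms := by
  have : excess (locArr A (e x)) m c0 e (locArr B x) ms =
      ∏ X ∈ (locArr B x).hyps, linP X ^ (msum (delArr (locRes A e X) c0) m - ms X) :=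
    Finset.prod_congr rfl fun X hX => by rw [locRes_locArr (mem_locArr_iff.1 hX).2]
  rw [this]
  exact Finset.prod_dvd_prod_of_subset _ _ _ (locArr_subset B x)

theorem IsRes.coQ_smul_excess_smul_mem (h : IsRes c0 e) (hc0 : c0 ∈ A.hyps) (hm : 1 ≤ m c0)
    (hB : Restricts A c0 e B) (hE : EulerMem A m c0 e B ms) (hlf : LocallyFreeAlong A m c0)
    (hlf' : LocallyFreeAlong A (mdel m c0) c0) {x : Fin n → K} (hx : x ≠ 0) {p : ℕ} {ξ : ExtF K n}
    (hξ : ξ ∈ Omega B ms p) :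
    coQ A (_root_.locArr A (e x)) m • excess A m c0 e B ms • ξ ∈ Imod A m c0 e p := by
  have hx' : e x ≠ 0 := fun h0 => hx (h.inj (h0.trans (map_zero e).symm))
  have h1 : Module.Free (PS K ℓ) (Omega (_root_.locArr A (e x)) m 1) := hlf _ hx' (h.dot x)
  have h2 : Module.Free (PS K ℓ) (Omega (_root_.locArr A (e x)) (mdel m c0) 1) :=
    hlf' _ hx' (h.dot x)
  have hmem := h.excess_smul_mem (h.mem_locArr hc0 x) hm (hB.locArr x) (hE.locArr x)
    inferInstance inferInstance (Omega_mono (locArr_subset B x) hξ)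
  obtain ⟨g, hg⟩ := excess_locArr_dvd (A := A) (B := B) (m := m) (ms := ms) (c0 := c0) (e := e) x
  refine smul_mem_Imod (dvd_coQ A _ m) (h.mem_locArr hc0 x) ?_
  rw [hg, mul_comm, mul_smul]
  exact h.smul_mem _ _ hmem

theorem IsRes.exists_X_pow_smul_excess_smul_mem (h : IsRes c0 e) (hc0 : c0 ∈ A.hyps)
    (hm : 1 ≤ m c0) (hB : Restricts A c0 e B) (hE : EulerMem A m c0 e B ms)
    (hlf : LocallyFreeAlong A m c0) (hlf' : LocallyFreeAlong A (mdel m c0) c0) (p : ℕ) :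
    ∃ k, ∀ i, ∀ ξ ∈ Omega B ms p,
      (X i : PS K ℓ) ^ k • excess A m c0 e B ms • ξ ∈ Imod A m c0 e p := by
  let 𝔞 : Ideal (PS K n) :=
    { carrier := {a | ∀ ξ ∈ Omega B ms p, a • excess A m c0 e B ms • ξ ∈ Imod A m c0 e p}
      add_mem' := fun ha hb ξ hξ => by
        rw [add_smul]
        exact add_mem (ha ξ hξ) (hb ξ hξ)
      zero_mem' := fun ξ _ => by
        rw [zero_smul]
        exact zero_mem _
      smul_mem' := fun a b hb ξ hξ => by
        rw [smul_eq_mul, mul_smul]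
        exact h.smul_mem _ _ (hb ξ hξ) }
  obtain ⟨k, hk⟩ := _root_.exists_X_pow_mem 𝔞 fun x hx => by
    refine ⟨algebraMap _ _ (coQ A (_root_.locArr A (e x)) m), fun ξ hξ => ?_, fun P hP hPx => ?_⟩
    · rw [algebraMap_smul]
      exact h.coQ_smul_excess_smul_mem hc0 hm hB hE hlf hlf' hx hξ
    · obtain ⟨c, -, -, hc⟩ := h.exists_linP_mem_of_coQ_mem x hP hPx
      exact ⟨_, hc⟩
  obtain ⟨k, hk⟩ := h.toIsPull.exists_X_pow_mem hk
  refine ⟨k, fun i ξ hξ => ?_⟩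
  rw [← algebraMap_smul (PS K n) ((X i : PS K ℓ) ^ k), map_pow]
  exact hk i ξ hξ

theorem IsRes.tameM_restriction (h : IsRes c0 e) (hn : n ≤ ℓ) (hc0 : c0 ∈ A.hyps)
    (hm : 1 ≤ m c0) (hB : Restricts A c0 e B) (hE : EulerMem A m c0 e B ms)
    (hlf : LocallyFreeAlong A m c0) (hlf' : LocallyFreeAlong A (mdel m c0) c0)
    (ht : TameM A m) (hdel : TameM A (mdel m c0)) : TameM B ms := by
  intro p hp
  rw [pdLE_iff]
  rcases le_or_gt ℓ 2 with hℓ | hℓ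
  · exact (pdLT_Omega B ms p).mono (by omega)
  have hg := excess_ne_zero A m c0 e B ms
  let μ : ExtF K n →ₗ[PS K n] ExtF K n :=
    LinearMap.lsmul (PS K n) (ExtF K n) (excess A m c0 e B ms)
  have hμ : Function.Injective μ := fun x y hxy => smul_right_inj_extF hg hxy
  let N : Submodule (PS K ℓ) (ExtF K n) := ((Omega B ms p).map μ).restrictScalars (PS K ℓ)
  have hIN : Imod A m c0 e p ≤ N := fun x hx => by
    obtain ⟨ξ, hξ, rfl⟩ := h.exists_eq_excess_smul hc0 hm hE hx
    exact ⟨ξ, hξ, rfl⟩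
  obtain ⟨k, hk⟩ := h.exists_X_pow_smul_excess_smul_mem hc0 hm hB hE hlf hlf' p
  have := h.finite_submodule N
  have hI : PdLT (PS K ℓ) (Imod A m c0 e p) (p + 2) :=
    h.pdLT_Imod hc0 hm (pdLE_iff.1 (ht p (hp.trans hn)))
      ((pdLE_iff.1 (hdel p (hp.trans hn))).mono (by omega))
  have hN : PdLT (PS K ℓ) N (p + 2) := PdLT.of_cofinite_le hIN k
    (by rintro i _ ⟨ξ, hξ, rfl⟩; exact hk i ξ hξ) hI
    ((h.pdLT_submodule N).mono (max_le hℓ.le le_rfl))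
  have hR := h.pdLT_toRestr N hN
  have hNeq : h.toRestr N = (Omega B ms p).map μ := rfl
  rw [hNeq] at hR
  exact PdLT.of_equiv (Submodule.equivMapOfInjective μ hμ (Omega B ms p)).symm hR

end EulerTameness

theorem IsRes.eulerMem_of_isEulerMult {A : Arrangement K ℓ} {m : (Fin ℓ → K) → ℕ}
    {c0 : Fin ℓ → K} {e : (Fin (ℓ - 1) → K) →ₗ[K] (Fin ℓ → K)} {B : Arrangement K (ℓ - 1)}
    {ms : (Fin (ℓ - 1) → K) → ℕ} [Algebra (PS K ℓ) (PS K (ℓ - 1))] (h : IsRes c0 e) (hℓ : 2 ≤ ℓ)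
    (hc0 : c0 ∈ A.hyps) (hm : ∀ c ∈ A.hyps, 0 < m c) (hB : Restricts A c0 e B)
    (hms : IsEulerMult A m c0 e B ms) : EulerMem A m c0 e B ms := by
  intro Y hY
  obtain ⟨d1, d2, h1, h2, h3⟩ := hms Y hY
  obtain ⟨c, hc, hne, t, -, ht⟩ := hB.exists_of_mem Y hY
  rw [h3]
  exact h.pow_mem_of_freeWithExp (A := locRes A e Y) hℓ (h.mem_locRes_self hc0 Y)
    (fun c hc => hm c (locRes_subset A e Y hc)) (B.ne_zero Y hY)
    (fun c hc => (mem_locRes.1 hc).2) ⟨c, mem_locRes.2 ⟨hc, t, ht⟩, hne⟩ h1 h2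

/-- **Addition theorem for tameness of multiarrangements.**  If `(A, m - δ_H)` is tame and
both `(A, m)` and `(A, m - δ_H)` are locally free along `H`, then both `(A, m)` and the
Euler restriction `(A^H, m^*)` are tame. -/
theorem addition_theorem_for_tameness_multi
    {K : Type} [Field K] {ℓ : ℕ} (A : Arrangement K ℓ) (hess : Essential A)
    (m : (Fin ℓ → K) → ℕ) (hm : ∀ c ∈ A.hyps, 0 < m c)
    (c0 : Fin ℓ → K) (hc0 : c0 ∈ A.hyps)
    (hdel_tame : TameM A (mdel m c0))
    (hlf : LocallyFreeAlong A m c0)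
    (hlf' : LocallyFreeAlong A (mdel m c0) c0) :
    TameM A m ∧
      ∀ (e : (Fin (ℓ - 1) → K) →ₗ[K] (Fin ℓ → K)) (B : Arrangement K (ℓ - 1))
        (ms : (Fin (ℓ - 1) → K) → ℕ),
        IsHypEmbedding c0 e → IsRestrictionOf B A c0 e → IsEulerMult A m c0 e B ms →
          TameM B ms := by
  have ht := tameM_of_deletion hc0 (hm c0 hc0) hdel_tame hlf hlf'
  refine ⟨ht, fun e B ms he hB hE => ?_⟩
  rcases lt_or_ge ℓ 2 with hℓ | hℓ
  · intro p _
    rw [pdLE_iff]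
    exact (pdLT_Omega B ms p).mono (by omega)
  · obtain ⟨_, h⟩ := exists_isPull e
    have h' : IsRes c0 e := ⟨h, he.1, he.2, A.ne_zero c0 hc0⟩
    have hB' : Restricts A c0 e B := ⟨hB.1, hB.2⟩
    exact h'.tameM_restriction (Nat.sub_le ℓ 1) hc0 (hm c0 hc0) hB'
      (h'.eulerMem_of_isEulerMult hℓ hc0 hm hB' hE) hlf hlf' ht hdel_tame
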